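/- arXiv:1405.7972 — 8 statements merged into one kernel-verified Lean document; each statement's English description precedes it below -/
import Mathlib

section
/- Two (partial) orientations P and P' of a graph G are equivalent in the modified cut–cycle reversal system (P ∼ P') if and only if their associated divisors are linearly equivalent (D_P ∼ D_{P'}). -/
/-!
STATEMENT 0: Two partial orientations `P`, `P'` of a graph `G` are equivalent in the
modified cut–cycle reversal system iff their associated divisors are linearly equivalent.
-/

open Finset

/-- A finite, unweighted multigraph without loops. -/
structure Multigraph (V E : Type) where
  fst : E → V
  snd : E → V
  no_loop : ∀ e, fst e ≠ snd e

/-- The inverse dart `ē`. -/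
def dartInv {E : Type} (d : E × Bool) : E × Bool := (d.1, !d.2)

/-- A partial orientation: a set of darts containing at most one of `e`, `ē` per edge. -/
def IsPartialOrientation {E : Type} (P : Finset (E × Bool)) : Prop :=
  ∀ e : E, ¬ ((e, true) ∈ P ∧ (e, false) ∈ P)

namespace Multigraph

variable {V E : Type} (G : Multigraph V E)

/-- Head of a dart. -/
def dhead (d : E × Bool) : V := if d.2 then G.snd d.1 else G.fst d.1

/-- Tail of a dart. -/
def dtail (d : E × Bool) : V := if d.2 then G.fst d.1 else G.snd d.1


/-- Adjacency of vertices. -/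
def Adj (u v : V) : Prop := ∃ d : E × Bool, G.dtail d = u ∧ G.dhead d = v

/-- `G` is connected. -/
def Connected : Prop := ∀ u v : V, Relation.ReflTransGen G.Adj u v


/-- A directed cycle. -/
def IsDirCycle (l : List (E × Bool)) : Prop :=
  l ≠ [] ∧ l.Nodup ∧ l.Chain' (fun d d' => G.dhead d = G.dtail d') ∧
    ∀ h : l ≠ [], G.dhead (l.getLast h) = G.dtail (l.head h)

variable [Fintype V] [Fintype E] [DecidableEq V] [DecidableEq E]

/-- Indegree in a set of darts. -/
def indeg (P : Finset (E × Bool)) (v : V) : ℕ :=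
  (P.filter (fun d => G.dhead d = v)).card

/-- The divisor of a (partial) orientation: `D_P(v) = indeg_P(v) - 1`. -/
def divisorOf (P : Finset (E × Bool)) : V → ℤ := fun v => (G.indeg P v : ℤ) - 1

/-- The Laplacian. -/
def lap (f : V → ℤ) : V → ℤ := fun v =>
  ∑ d : E × Bool, if G.dhead d = v then f v - f (G.dtail d) else 0

/-- Linear equivalence of divisors. -/
def LinEquiv (D₁ D₂ : V → ℤ) : Prop := ∃ f : V → ℤ, ∀ v, D₂ v = D₁ v - G.lap f v

/-- The directed cut `𝔼(A, Aᶜ)`: darts with head in `A` and tail outside `A`. -/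
def cut (A : Finset V) : Finset (E × Bool) :=
  univ.filter (fun d => G.dhead d ∈ A ∧ G.dtail d ∉ A)

/-- The elementary move of Remark 3.2: replace a dart `d ∈ P` by a dart `d' ∉ P`
with the same head (keeping a partial orientation). -/
def Step1 (P P' : Finset (E × Bool)) : Prop :=
  ∃ d d' : E × Bool, d ∈ P ∧ d' ∉ P ∧ dartInv d' ∉ P.erase d ∧
    G.dhead d' = G.dhead d ∧ P' = insert d' (P.erase d)

/-- Inverting a directed cut contained in `P`. -/
def CutRev (P P' : Finset (E × Bool)) : Prop :=
  ∃ A : Finset V, A.Nonempty ∧ A ≠ univ ∧ G.cut A ⊆ P ∧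
    P' = (P \ G.cut A) ∪ (G.cut A).image dartInv

/-- Inverting a directed cycle contained in `P`. -/
def CycleRev (P P' : Finset (E × Bool)) : Prop :=
  ∃ l : List (E × Bool), G.IsDirCycle l ∧ (∀ d ∈ l, d ∈ P) ∧
    P' = (P \ l.toFinset) ∪ (l.toFinset.image dartInv)

/-- Equivalence in the modified cut–cycle reversal system: a sequence of
edge-exchange moves, cut reversals and cycle reversals. -/
def OrientEquiv : Finset (E × Bool) → Finset (E × Bool) → Prop :=
  Relation.ReflTransGen (fun P P' => G.Step1 P P' ∨ G.CutRev P P' ∨ G.CycleRev P P')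

end Multigraph

namespace Multigraph

theorem dInv_dInv {E : Type} (d : E × Bool) : dartInv (dartInv d) = d := by
  simp [dartInv]

theorem po_iff {E : Type} (P : Finset (E × Bool)) :
    IsPartialOrientation P ↔ ∀ d ∈ P, dartInv d ∉ P := by
  constructor
  · rintro h ⟨e, b⟩ hd hd'
    cases b
    · exact h e ⟨hd', hd⟩
    · exact h e ⟨hd, hd'⟩
  · intro h e he
    exact h _ he.1 he.2

section basic
variable {V E : Type} (G : Multigraph V E)

theorem dhead_inv (d : E × Bool) : G.dhead (dartInv d) = G.dtail d := by
  rcases d with ⟨e, b⟩; cases b <;> simp [dartInv, dhead, dtail]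

theorem dtail_inv (d : E × Bool) : G.dtail (dartInv d) = G.dhead d := by
  rcases d with ⟨e, b⟩; cases b <;> simp [dartInv, dhead, dtail]

theorem head_ne_tail (d : E × Bool) : G.dhead d ≠ G.dtail d := by
  rcases d with ⟨e, b⟩
  have := G.no_loop e
  cases b <;> simp [dhead, dtail, this, this.symm]

theorem cyc_heads (a : E × Bool) (t : List (E × Bool))
    (h : (a :: t).IsChain (fun d d' => G.dhead d = G.dtail d')) :
    (a :: t).map G.dhead = t.map G.dtail ++ [G.dhead ((a :: t).getLast (by simp))] := by
  induction t generalizing a with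
  | nil => simp
  | cons b t ih =>
    rw [List.isChain_cons_cons] at h
    rw [List.map_cons, ih b h.2, h.1]
    simp

end basic

variable {V E : Type} [Fintype V] [Fintype E] [DecidableEq V] [DecidableEq E]
  (G : Multigraph V E)

theorem indeg_sum (P : Finset (E × Bool)) (v : V) :
    (G.indeg P v : ℤ) = ∑ d : E × Bool, if G.dhead d = v then (if d ∈ P then 1 else 0) else 0 := by
  unfold indeg
  rw [Finset.card_eq_sum_ones, Finset.sum_filter]
  push_cast
  rw [← Finset.sum_filter_add_sum_filter_not univ (fun d => d ∈ P)]
  rw [Finset.sum_eq_zero (s := univ.filter (fun d => ¬ d ∈ P))]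
  · rw [Finset.filter_univ_mem, add_zero]
    refine Finset.sum_congr rfl fun d hd => ?_
    simp [hd]
  · intro d hd
    simp at hd
    simp [hd]

/-- reversal -/
theorem mem_rev {P C : Finset (E × Bool)} (d : E × Bool) :
    d ∈ (P \ C) ∪ C.image dartInv ↔ (d ∈ P ∧ d ∉ C) ∨ dartInv d ∈ C := by
  simp only [mem_union, mem_sdiff, mem_image]
  constructor
  · rintro (h | ⟨a, ha, rfl⟩)
    · exact Or.inl h
    · right; rwa [dInv_dInv]
  · rintro (h | h)
    · exact Or.inl h
    · exact Or.inr ⟨_, h, dInv_dInv d⟩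

theorem po_rev {P C : Finset (E × Bool)} (hP : IsPartialOrientation P) (hC : C ⊆ P) :
    IsPartialOrientation ((P \ C) ∪ C.image dartInv) := by
  rw [po_iff] at *
  intro d hd hd'
  rw [mem_rev] at hd hd'
  rw [dInv_dInv] at hd'
  rcases hd with ⟨h1, h2⟩ | h1 <;> rcases hd' with ⟨h3, h4⟩ | h3
  · exact hP _ h1 h3
  · exact h2 h3
  · exact h4 h1
  · exact hP _ (hC h3) (hC h1)

theorem cut_indeg {P : Finset (E × Bool)} (hP : IsPartialOrientation P) (A : Finset V)
    (hC : G.cut A ⊆ P) (v : V) :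
    (G.indeg ((P \ G.cut A) ∪ (G.cut A).image dartInv) v : ℤ) =
      G.indeg P v - G.lap (fun x => if x ∈ A then 1 else 0) v := by
  rw [po_iff] at hP
  rw [indeg_sum, indeg_sum, lap, ← Finset.sum_sub_distrib]
  refine Finset.sum_congr rfl fun d _ => ?_
  by_cases hv : G.dhead d = v
  swap
  · simp [hv]
  subst hv
  have h1 : d ∈ G.cut A ↔ G.dhead d ∈ A ∧ G.dtail d ∉ A := by simp [cut]
  have h2 : dartInv d ∈ G.cut A ↔ G.dtail d ∈ A ∧ G.dhead d ∉ A := by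
    simp [cut, dhead_inv, dtail_inv]
  have h3 := @hC d
  have h4 := @hC (dartInv d)
  have h5 := hP d
  simp only [mem_rev, h1, h2, if_true] at *
  by_cases a : G.dhead d ∈ A <;> by_cases b : G.dtail d ∈ A <;> by_cases c : d ∈ P <;> simp_all

theorem cyc_indeg {P : Finset (E × Bool)} (hP : IsPartialOrientation P) (l : List (E × Bool))
    (hl : G.IsDirCycle l) (hC : ∀ d ∈ l, d ∈ P) (v : V) :
    (G.indeg ((P \ l.toFinset) ∪ l.toFinset.image dartInv) v : ℤ) = G.indeg P v := by
  rw [po_iff] at hP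
  obtain ⟨h0, hnd, hch, hlast⟩ := hl
  have key : ∑ d : E × Bool, (if G.dhead d = v then (if d ∈ l then (1:ℤ) else 0) else 0) =
      ∑ d : E × Bool, (if G.dhead d = v then (if dartInv d ∈ l then (1:ℤ) else 0) else 0) := by
    have e1 : ∀ F : E × Bool → V, 
        ∑ d : E × Bool, (if F d = v then (if d ∈ l then (1:ℤ) else 0) else 0) =
        ((l.map F).map (fun x => if x = v then (1:ℤ) else 0)).sum := by
      intro F
      rw [List.map_map, ← List.sum_toFinset _ hnd]
      rw [← Finset.sum_subset (Finset.subset_univ l.toFinset)]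
      · refine Finset.sum_congr rfl fun d hd => ?_
        simp at hd
        simp [hd]
      · intro d _ hd
        simp at hd
        simp [hd]
    have e2 : ∑ d : E × Bool, (if G.dhead d = v then (if dartInv d ∈ l then (1:ℤ) else 0) else 0)
        = ∑ d : E × Bool, (if G.dtail d = v then (if d ∈ l then (1:ℤ) else 0) else 0) := by
      refine Finset.sum_bij' (fun d _ => dartInv d) (fun d _ => dartInv d) ?_ ?_ ?_ ?_ ?_ <;>
        simp [dInv_dInv, dtail_inv]
    rw [e2, e1, e1]
    cases l with
    | nil => exact absurd rfl h0
    | cons a t =>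
      rw [G.cyc_heads a t hch, hlast (by simp)]
      simp
      ring
  have : (G.indeg ((P \ l.toFinset) ∪ l.toFinset.image dartInv) v : ℤ) = G.indeg P v
      - ∑ d : E × Bool, (if G.dhead d = v then (if d ∈ l then (1:ℤ) else 0) else 0)
      + ∑ d : E × Bool, (if G.dhead d = v then (if dartInv d ∈ l then (1:ℤ) else 0) else 0) := by
    rw [indeg_sum, indeg_sum, ← Finset.sum_sub_distrib, ← Finset.sum_add_distrib]
    refine Finset.sum_congr rfl fun d _ => ?_
    by_cases hv : G.dhead d = v
    swap
    · simp [hv]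
    have h3 := hC d
    have h4 := hC (dartInv d)
    have h5 := hP d
    simp only [mem_rev, hv, if_true, List.mem_toFinset] at *
    by_cases a : d ∈ l <;> by_cases b : dartInv d ∈ l <;> by_cases c : d ∈ P <;> simp_all
  rw [this, key]; ring

theorem step_indeg {P : Finset (E × Bool)} {d d' : E × Bool} (hd : d ∈ P) (hd' : d' ∉ P)
    (hh : G.dhead d' = G.dhead d) (v : V) :
    G.indeg (insert d' (P.erase d)) v = G.indeg P v := by
  unfold indeg
  rw [Finset.filter_insert, Finset.filter_erase]
  by_cases hv : G.dhead d = v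
  · rw [if_pos (hh.trans hv), Finset.card_insert_of_notMem (by simp [hd']),
      Finset.card_erase_add_one (by simp [hd, hv])]
  · rw [if_neg (by rwa [hh]), Finset.erase_eq_of_notMem (by simp [hv])]

theorem step_po {P : Finset (E × Bool)} (hP : IsPartialOrientation P) {d d' : E × Bool}
    (hd' : dartInv d' ∉ P.erase d) :
    IsPartialOrientation (insert d' (P.erase d)) := by
  rw [po_iff] at *
  have hne : ∀ x : E × Bool, dartInv x ≠ x := by
    rintro ⟨e, b⟩; cases b <;> simp [dartInv]
  intro x hx hx'
  rw [Finset.mem_insert] at hx hx'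
  rcases hx with rfl | hx
  · rcases hx' with h | h
    · exact hne _ h
    · exact hd' h
  · rcases hx' with h | h
    · rw [← h, dInv_dInv] at hd'; exact hd' hx
    · exact hP _ (Finset.mem_of_mem_erase hx) (Finset.mem_of_mem_erase h)

theorem lap_add (f g : V → ℤ) (v : V) :
    G.lap (fun x => f x + g x) v = G.lap f v + G.lap g v := by
  unfold lap
  rw [← Finset.sum_add_distrib]
  refine Finset.sum_congr rfl fun d _ => ?_
  split_ifs <;> ring

theorem lap_sub (f g : V → ℤ) (v : V) :
    G.lap (fun x => f x - g x) v = G.lap f v - G.lap g v := by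
  unfold lap
  rw [← Finset.sum_sub_distrib]
  refine Finset.sum_congr rfl fun d _ => ?_
  split_ifs <;> ring

theorem forward {P P' : Finset (E × Bool)} (hP : IsPartialOrientation P)
    (h : G.OrientEquiv P P') :
    IsPartialOrientation P' ∧ ∃ f : V → ℤ, ∀ v, (G.indeg P' v : ℤ) = G.indeg P v - G.lap f v := by
  induction h with
  | refl => exact ⟨hP, fun _ => 0, fun v => by simp [lap]⟩
  | tail _ hs ih =>
    obtain ⟨hQ, f, hf⟩ := ih
    rcases hs with ⟨d, d', h1, h2, h3, h4, rfl⟩ | ⟨A, _, _, hA, rfl⟩ | ⟨l, hl, hl', rfl⟩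
    · refine ⟨step_po hQ h3, f, fun v => ?_⟩
      rw [G.step_indeg h1 h2 h4, hf]
    · refine ⟨po_rev hQ hA, fun x => f x + (if x ∈ A then 1 else 0), fun v => ?_⟩
      rw [G.cut_indeg hQ A hA, hf, lap_add]; ring
    · refine ⟨po_rev hQ (fun d hd => hl' d (by simpa using hd)), f, fun v => ?_⟩
      rw [G.cyc_indeg hQ l hl hl', hf]

theorem same_div {P' : Finset (E × Bool)} (hP' : IsPartialOrientation P') (n : ℕ) :
    ∀ P : Finset (E × Bool), IsPartialOrientation P → (∀ v, G.indeg P v = G.indeg P' v) →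
    (P \ P').card = n → G.OrientEquiv P P' := by
  induction n using Nat.strong_induction_on with
  | _ n ih =>
  intro P hP hdeg hn
  have hP0 := hP
  rw [po_iff] at hP hP'
  -- each d in P \ P' has partner
  have partner : ∀ d ∈ P \ P', ∃ d' ∈ P' \ P, G.dhead d' = G.dhead d := by
    intro d hd
    by_contra hcon
    push Not at hcon
    have hlt : G.indeg P' (G.dhead d) < G.indeg P (G.dhead d) := by
      apply Finset.card_lt_card
      rw [Finset.ssubset_iff_of_subset]
      · refine ⟨d, ?_, ?_⟩ <;> simp_all
      · intro x hx
        simp only [mem_filter] at hx ⊢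
        refine ⟨?_, hx.2⟩
        by_contra hxP
        exact hcon x (by simp [hx.1, hxP]) hx.2
    rw [hdeg] at hlt
    exact lt_irrefl _ hlt
  by_cases hst : ∃ d ∈ P \ P', ∃ d' ∈ P' \ P, G.dhead d' = G.dhead d ∧ dartInv d' ∉ P
  · obtain ⟨d, hd, d', hd', hh, hi⟩ := hst
    rw [mem_sdiff] at hd hd'
    have hi' : dartInv d' ∉ P.erase d := fun h => hi (Finset.mem_of_mem_erase h)
    refine Relation.ReflTransGen.head (b := insert d' (P.erase d))
      (Or.inl ⟨d, d', hd.1, hd'.2, hi', hh, rfl⟩) ?_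
    refine ih _ ?_ _ (step_po hP0 hi') (fun v => ?_) rfl
    · rw [← hn]
      apply Finset.card_lt_card
      rw [Finset.ssubset_iff_of_subset]
      · refine ⟨d, by simp [hd], ?_⟩
        have : d ≠ d' := by rintro rfl; exact hd.2 hd'.1
        simp [this]
      · intro x hx
        simp only [mem_sdiff, mem_insert, mem_erase] at hx ⊢
        rcases hx with ⟨rfl | h, h2⟩
        · exact absurd hd'.1 h2
        · exact ⟨h.2, h2⟩
    · rw [G.step_indeg hd.1 hd'.2 hh, hdeg]
  · push Not at hst
    by_cases hemp : P \ P' = ∅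
    · have hsub : P ⊆ P' := by rwa [Finset.sdiff_eq_empty_iff_subset] at hemp
      have : P = P' := by
        refine Finset.Subset.antisymm hsub fun x hx => ?_
        have : P.filter (fun d => G.dhead d = G.dhead x) = P'.filter (fun d => G.dhead d = G.dhead x) :=
          Finset.eq_of_subset_of_card_le (Finset.filter_subset_filter _ hsub) (hdeg (G.dhead x)).ge
        have hx' : x ∈ P'.filter (fun d => G.dhead d = G.dhead x) := by simp [hx]
        rw [← this] at hx'
        exact (Finset.mem_filter.1 hx').1
      rw [this]; exact Relation.ReflTransGen.refl
    · have hnext : ∀ d : {x // x ∈ P \ P'}, ∃ d2 : {x // x ∈ P \ P'},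
          G.dtail d2.1 = G.dhead d.1 ∧ dartInv d2.1 ∈ P' := by
        rintro ⟨d, hd⟩
        obtain ⟨d', h1, h2⟩ := partner d hd
        have h3 := hst d hd d' h1 h2
        refine ⟨⟨dartInv d', ?_⟩, ?_, ?_⟩
        · rw [mem_sdiff] at h1 ⊢
          exact ⟨h3, hP' _ h1.1⟩
        · simp [dtail_inv, h2]
        · rw [mem_sdiff] at h1
          simp [dInv_dInv, h1]
      choose nx hnx1 hnx2 using hnext
      obtain ⟨d0, hd0⟩ := Finset.nonempty_iff_ne_empty.2 hemp
      obtain ⟨i, j, hij, heq⟩ := Finite.exists_ne_map_eq_of_infinite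
        (fun i : ℕ => nx^[i] ⟨d0, hd0⟩)
      have hper : ∃ p, p ∈ Function.periodicPts nx := by
        wlog hlt : i < j generalizing i j
        · exact this j i hij.symm heq.symm (by omega)
        refine ⟨nx^[i] ⟨d0, hd0⟩, j - i, by omega, ?_⟩
        show nx^[j - i] _ = _
        rw [← Function.iterate_add_apply, Nat.sub_add_cancel hlt.le]
        exact heq.symm
      obtain ⟨p, hp⟩ := hper
      set m := Function.minimalPeriod nx p with hm
      have hmpos : 0 < m := Function.minimalPeriod_pos_of_mem_periodicPts hp
      have hmp : nx^[m] p = p := Function.iterate_minimalPeriod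
      set l : List (E × Bool) := (List.range m).map (fun i => (nx^[i] p).1) with hl
      have hlP : ∀ d ∈ l, d ∈ P \ P' := by
        intro d hd
        simp only [hl, List.mem_map] at hd
        obtain ⟨i, _, rfl⟩ := hd
        exact (nx^[i] p).2
      have hlI : ∀ d ∈ l, dartInv d ∈ P' := by
        intro d hd
        simp only [hl, List.mem_map, List.mem_range] at hd
        obtain ⟨i, hi, rfl⟩ := hd
        cases i with
        | zero =>
          have : nx^[0] p = nx (nx^[m-1] p) := by
            rw [← Function.iterate_succ_apply' nx, Nat.succ_eq_add_one, Nat.sub_add_cancel hmpos, hmp]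
            rfl
          rw [this]; exact hnx2 _
        | succ i =>
          rw [Function.iterate_succ_apply']; exact hnx2 _
      have hcyc : G.IsDirCycle l := by
        have hne : l ≠ [] := by simp [hl]; omega
        refine ⟨hne, ?_, ?_, ?_⟩
        · refine List.Nodup.map_on ?_ List.nodup_range
          intro x hx y hy hxy
          simp only [List.mem_range] at hx hy
          exact Function.iterate_injOn_Iio_minimalPeriod hx hy (Subtype.ext hxy)
        · show List.IsChain _ l
          rw [List.isChain_iff_getElem]
          intro i hi
          simp only [hl, List.getElem_map, List.getElem_range]
          rw [Function.iterate_succ_apply', hnx1]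
        · intro h
          simp only [hl, List.getLast_eq_getElem, List.head_eq_getElem, List.getElem_map,
            List.getElem_range, List.length_map, List.length_range]
          have : nx^[0] p = nx (nx^[m-1] p) := by
            rw [← Function.iterate_succ_apply' nx, Nat.succ_eq_add_one, Nat.sub_add_cancel hmpos, hmp]
            rfl
          rw [this, hnx1]
      have hlP2 : ∀ d ∈ l, d ∈ P := fun d hd => (mem_sdiff.1 (hlP d hd)).1
      refine Relation.ReflTransGen.head (b := (P \ l.toFinset) ∪ (l.toFinset.image dartInv))
        (Or.inr (Or.inr ⟨l, hcyc, hlP2, rfl⟩)) ?_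
      refine ih _ ?_ _ (po_rev hP0 (fun d hd => hlP2 d (by simpa using hd))) (fun v => ?_) rfl
      · rw [← hn]
        apply Finset.card_lt_card
        have hpl : p.1 ∈ l := by
          simp only [hl, List.mem_map, List.mem_range]
          exact ⟨0, hmpos, rfl⟩
        rw [Finset.ssubset_iff_of_subset]
        · refine ⟨p.1, p.2, ?_⟩
          rw [mem_sdiff, mem_rev]
          rintro ⟨⟨_, h⟩ | h, _⟩
          · exact h (by simpa using hpl)
          · exact hP _ (hlP2 _ hpl) (hlP2 _ (by simpa using h))
        · intro x hx
          rw [mem_sdiff, mem_rev] at hx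
          rcases hx with ⟨⟨h1, _⟩ | h, h2⟩
          · simp [h1, h2]
          · have := hlI _ (List.mem_toFinset.1 h)
            rw [dInv_dInv] at this
            exact absurd this h2
      · have := G.cyc_indeg hP0 l hcyc hlP2 v
        rw [← hdeg v]
        exact_mod_cast this

/-- pivoting along a directed walk outside `A` -/
theorem pivot (A : Finset V) (n : ℕ) :
    ∀ (Q : Finset (E × Bool)) (g : ℕ → E × Bool) (d : E × Bool), IsPartialOrientation Q →
    (∀ i ≤ n, g i ∈ Q) → (∀ i < n, G.dhead (g i) = G.dtail (g (i+1))) →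
    (∀ i ≤ n, G.dhead (g i) ∉ A) → G.dhead d = G.dhead (g n) → d ∉ Q → dartInv d ∉ Q →
    ∃ Q', G.OrientEquiv Q Q' ∧ IsPartialOrientation Q' ∧ (∀ v, G.indeg Q' v = G.indeg Q v) ∧
      g 0 ∉ Q' ∧ dartInv (g 0) ∉ Q' ∧ ∀ x, G.dhead x ∈ A → (x ∈ Q' ↔ x ∈ Q) := by
  induction n using Nat.strong_induction_on with
  | _ n ih =>
  intro Q g d hQ hg hch hA hd hdQ hdQ'
  have hi : dartInv d ∉ Q.erase (g n) := fun h => hdQ' (Finset.mem_of_mem_erase h)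
  set Q1 := insert d (Q.erase (g n)) with hQ1
  have hgn := hg n le_rfl
  have hPO1 : IsPartialOrientation Q1 := step_po hQ hi
  have hst : G.OrientEquiv Q Q1 :=
    Relation.ReflTransGen.single (Or.inl ⟨g n, d, hgn, hdQ, hi, hd, rfl⟩)
  have hdeg : ∀ v, G.indeg Q1 v = G.indeg Q v := G.step_indeg hgn hdQ hd
  have hun1 : g n ∉ Q1 := by
    have : g n ≠ d := by rintro h; exact hdQ (h ▸ hgn)
    simp [hQ1, this]
  have hun2 : dartInv (g n) ∉ Q1 := by
    have h1 : dartInv (g n) ≠ d := by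
      rintro h; apply hdQ'; rw [← h, dInv_dInv]; exact hgn
    have h2 := (po_iff Q).1 hQ _ hgn
    simp [hQ1, h1, h2]
  have hsame : ∀ x, G.dhead x ∈ A → (x ∈ Q1 ↔ x ∈ Q) := by
    intro x hx
    have h1 : x ≠ d := by rintro rfl; rw [hd] at hx; exact hA n le_rfl hx
    have h2 : x ≠ g n := by rintro rfl; exact hA n le_rfl hx
    simp [hQ1, h1, h2]
  cases n with
  | zero => exact ⟨Q1, hst, hPO1, hdeg, hun1, hun2, hsame⟩
  | succ n =>
    by_cases hrep : ∃ i ≤ n, g i = g (n+1)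
    · obtain ⟨i, hin, hgi⟩ := hrep
      exact ih i (by omega) Q g d hQ (fun j hj => hg j (by omega)) (fun j hj => hch j (by omega))
        (fun j hj => hA j (by omega)) (by rw [hd, hgi]) hdQ hdQ'
    · push Not at hrep
      obtain ⟨Q2, a1, a2, a3, a4, a5, a6⟩ := ih n (by omega) Q1 g (dartInv (g (n+1))) hPO1
        (fun j hj => by simp [hQ1, hrep j hj, hg j (by omega)])
        (fun j hj => hch j (by omega)) (fun j hj => hA j (by omega))
        (by rw [dhead_inv, hch n (by omega)]) hun2 (by rwa [dInv_dInv])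
      exact ⟨Q2, hst.trans a1, a2, fun v => by rw [a3, hdeg], a4, a5,
        fun x hx => by rw [a6 x hx, hsame x hx]⟩

theorem lap_ge (f : V → ℤ) (M : ℤ) (hM : ∀ v, f v ≤ M) (v : V) (hv : f v = M) :
    (((G.cut (univ.filter (fun x => f x = M))).filter (fun d => G.dhead d = v)).card : ℤ)
      ≤ G.lap f v := by
  unfold lap cut
  rw [Finset.filter_filter, Finset.card_filter]
  push_cast
  refine Finset.sum_le_sum fun d _ => ?_
  have := hM (G.dtail d)
  by_cases h : G.dhead d = v
  · by_cases h2 : f (G.dtail d) = M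
    · simp [h, hv, h2]
    · simp [h, hv, h2]; omega
  · simp [h]

theorem lap_sum (f : V → ℤ) : ∑ v, G.lap f v = 0 := by
  unfold lap
  rw [Finset.sum_comm]
  have h1 : ∀ d : E × Bool, ∑ v, (if G.dhead d = v then f v - f (G.dtail d) else 0) =
      f (G.dhead d) - f (G.dtail d) := by
    intro d; simp
  simp only [h1]
  rw [Finset.sum_sub_distrib, sub_eq_zero]
  refine Finset.sum_bij' (fun d _ => dartInv d) (fun d _ => dartInv d) ?_ ?_ ?_ ?_ ?_ <;>
    simp [dInv_dInv, dtail_inv]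

theorem sum_indeg (P : Finset (E × Bool)) (S : Finset V) :
    ∑ v ∈ S, G.indeg P v = (P.filter (fun d => G.dhead d ∈ S)).card := by
  unfold indeg
  rw [Finset.card_eq_sum_card_fiberwise (f := G.dhead) (t := S)]
  · refine Finset.sum_congr rfl fun v hv => ?_
    congr 1
    ext d
    simp only [mem_filter]
    constructor
    · rintro ⟨h1, rfl⟩; exact ⟨⟨h1, hv⟩, rfl⟩
    · rintro ⟨⟨h1, _⟩, h2⟩; exact ⟨h1, h2⟩
  · intro d hd
    exact (Finset.mem_filter.1 hd).2

theorem fire {P P' : Finset (E × Bool)} (hP : IsPartialOrientation P)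
    (hP' : IsPartialOrientation P') (f : V → ℤ)
    (hf : ∀ v, (G.indeg P' v : ℤ) = G.indeg P v - G.lap f v) (M : ℤ) (hM : ∀ v, f v ≤ M)
    (hne : ∃ v, f v = M) (hnu : ∃ v, f v ≠ M) :
    ∃ Q, G.OrientEquiv P Q ∧ IsPartialOrientation Q ∧ (∀ v, G.indeg Q v = G.indeg P v) ∧
      ∃ A : Finset V, A.Nonempty ∧ A ≠ univ ∧ G.cut A ⊆ Q ∧ ∀ v, f v = M → v ∈ A := by
  classical
  set A0 : Finset V := univ.filter (fun x => f x = M) with hA0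
  have memA0 : ∀ v, v ∈ A0 ↔ f v = M := by intro v; simp [hA0]
  have memcut : ∀ (A : Finset V) d, d ∈ G.cut A ↔ G.dhead d ∈ A ∧ G.dtail d ∉ A := by
    intro A d; simp [cut]
  obtain ⟨Q, hQm, hmax⟩ := Finset.exists_max_image
    (univ.filter (fun Q : Finset (E × Bool) => G.OrientEquiv P Q ∧ IsPartialOrientation Q ∧
      (∀ v, G.indeg Q v = G.indeg P v))) (fun Q => (G.cut A0 ∩ Q).card)
    ⟨P, Finset.mem_filter.2 ⟨mem_univ _, Relation.ReflTransGen.refl, hP, fun _ => rfl⟩⟩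
  simp only [mem_filter, mem_univ, true_and] at hQm hmax
  obtain ⟨hPQ, hQ, hdegQ⟩ := hQm
  -- augmentation is impossible
  have aug : ∀ R, G.OrientEquiv P R → IsPartialOrientation R → (∀ v, G.indeg R v = G.indeg P v) →
      (G.cut A0 ∩ R).card = (G.cut A0 ∩ Q).card → ∀ c ∈ G.cut A0, c ∉ R → dartInv c ∉ R → False := by
    intro R hPR hR hdegR hcard c hc hcR hcR'
    have hc2 := (memcut _ _).1 hc
    have hex : ∃ h ∈ R, G.dhead h = G.dhead c ∧ h ∉ G.cut A0 := by
      by_contra hcon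
      push Not at hcon
      have h1 : G.indeg R (G.dhead c) < ((G.cut A0).filter (fun d => G.dhead d = G.dhead c)).card := by
        apply Finset.card_lt_card
        rw [Finset.ssubset_iff_of_subset]
        · exact ⟨c, by simp [hc], by simp [hcR]⟩
        · intro x hx
          rw [mem_filter] at hx ⊢
          exact ⟨hcon x hx.1 hx.2, hx.2⟩
      have h2 := G.lap_ge f M hM (G.dhead c) ((memA0 _).1 hc2.1)
      have h3 := hf (G.dhead c)
      rw [← hA0] at h2
      rw [hdegR] at h1
      omega
    obtain ⟨h, hhR, hhead, hhcut⟩ := hex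
    have hi : dartInv c ∉ R.erase h := fun h => hcR' (Finset.mem_of_mem_erase h)
    have := hmax (insert c (R.erase h)) ⟨hPR.tail (Or.inl ⟨h, c, hhR, hcR, hi, hhead.symm, rfl⟩),
      step_po hR hi, fun v => by rw [G.step_indeg hhR hcR hhead.symm, hdegR]⟩
    rw [← hcard] at this
    have hlt : (G.cut A0 ∩ R).card < (G.cut A0 ∩ insert c (R.erase h)).card := by
      apply Finset.card_lt_card
      rw [Finset.ssubset_iff_of_subset]
      · exact ⟨c, by simp [hc], by simp [hcR]⟩
      · intro x hx
        rw [mem_inter] at hx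
        have : x ≠ h := by rintro rfl; exact hhcut hx.1
        simp [hx, this]
    omega
  let W : V → Prop := fun x => ∃ (n : ℕ) (g : ℕ → E × Bool), (∀ i ≤ n, g i ∈ Q) ∧
    (∀ i < n, G.dhead (g i) = G.dtail (g (i+1))) ∧ (∀ i ≤ n, G.dhead (g i) ∉ A0) ∧
    G.dtail (g 0) ∈ A0 ∧ G.dhead (g n) = x
  have noun1 : ∀ d, W (G.dhead d) → d ∉ Q → dartInv d ∉ Q → False := by
    rintro d ⟨n, g, h1, h2, h3, h4, h5⟩ hd hd'
    obtain ⟨R, a1, a2, a3, a4, a5, a6⟩ := G.pivot A0 n Q g d hQ h1 h2 h3 h5.symm hd hd'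
    refine aug R (hPQ.trans a1) a2 (fun v => by rw [a3, hdegQ]) ?_ (dartInv (g 0)) ?_ a5
      (by rwa [dInv_dInv])
    · congr 1
      ext x
      simp only [mem_inter, memcut]
      constructor
      · rintro ⟨h, h'⟩; exact ⟨h, (a6 x h.1).1 h'⟩
      · rintro ⟨h, h'⟩; exact ⟨h, (a6 x h.1).2 h'⟩
    · rw [memcut, dhead_inv, dtail_inv]
      exact ⟨h4, h3 0 (by omega)⟩
  have noun2 : ∀ c ∈ G.cut A0, c ∉ Q → dartInv c ∉ Q → False := aug Q hPQ hQ hdegQ rfl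
  have hclos : ∀ d ∈ Q, (G.dtail d ∈ A0 ∨ W (G.dtail d)) → G.dhead d ∉ A0 → W (G.dhead d) := by
    rintro d hd (ht | ⟨n, g, h1, h2, h3, h4, h5⟩) hh
    · exact ⟨0, fun _ => d, fun _ _ => hd, fun _ h => absurd h (by omega), fun _ _ => hh, ht, rfl⟩
    · refine ⟨n+1, fun i => if i ≤ n then g i else d, ?_, ?_, ?_, ?_, ?_⟩
      · intro i hi
        dsimp only
        split_ifs with h
        · exact h1 i h
        · exact hd
      · intro i hi
        dsimp only
        rw [if_pos (by omega : i ≤ n)]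
        split_ifs with h
        · exact h2 i (by omega)
        · have : i = n := by omega
          rw [this, h5]
      · intro i hi
        dsimp only
        split_ifs with h
        · exact h3 i h
        · exact hh
      · simpa using h4
      · simp
  refine ⟨Q, hPQ, hQ, hdegQ, univ.filter (fun v => v ∈ A0 ∨ W v), ?_, ?_, ?_, ?_⟩
  · obtain ⟨v, hv⟩ := hne
    exact ⟨v, by simp [memA0, hv]⟩
  · intro huniv
    have hall : ∀ v, v ∈ A0 ∨ W v := by
      intro v
      have : v ∈ univ.filter (fun v => v ∈ A0 ∨ W v) := by rw [huniv]; simp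
      simpa using this
    -- counting
    have c1 : (P'.filter (fun d => G.dhead d ∈ A0)).card + (G.cut A0).card ≤
        (Q.filter (fun d => G.dhead d ∈ A0)).card := by
      have e : (G.cut A0).card = ∑ v ∈ A0, ((G.cut A0).filter (fun d => G.dhead d = v)).card := by
        rw [← Finset.card_eq_sum_card_fiberwise]
        intro d hd
        exact ((memcut _ _).1 hd).1
      rw [e, ← sum_indeg, ← sum_indeg, ← Finset.sum_add_distrib]
      refine Finset.sum_le_sum fun v hv => ?_
      have h2 := G.lap_ge f M hM v ((memA0 _).1 hv)
      have h3 := hf v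
      rw [← hA0] at h2
      rw [hdegQ]
      omega
    have c2 : P'.card = Q.card := by
      have t : ∀ R : Finset (E × Bool), R.card = ∑ v, G.indeg R v := by
        intro R; rw [sum_indeg]; simp
      rw [t, t]
      have : (∑ v, (G.indeg P' v : ℤ)) = ∑ v, (G.indeg Q v : ℤ) := by
        simp only [hf, hdegQ]
        rw [Finset.sum_sub_distrib, lap_sum, sub_zero]
      exact_mod_cast this
    have c3 := Finset.card_filter_add_card_filter_not (s := P') (fun d => G.dhead d ∈ A0)
    have c4 := Finset.card_filter_add_card_filter_not (s := Q) (fun d => G.dhead d ∈ A0)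
    have c5 : (P'.filter (fun d => ¬ G.dhead d ∈ A0)).card ≤
        (Q.filter (fun d => ¬ G.dhead d ∈ A0) ∪ (G.cut A0 ∩ Q)).card := by
      refine Finset.card_le_card_of_injOn (fun d => if d ∈ Q then d else dartInv d) ?_ ?_
      · intro d hd
        have hd := Finset.mem_filter.1 (Finset.mem_coe.1 hd)
        rw [Finset.mem_coe]
        dsimp only
        split_ifs with h
        · simp [h, hd]
        · have hq : dartInv d ∈ Q := by
            by_contra hq
            exact noun1 d ((hall _).resolve_left hd.2) h hq
          rw [mem_union, mem_filter, mem_inter, memcut, dtail_inv]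
          by_cases hh : G.dhead (dartInv d) ∈ A0
          · exact Or.inr ⟨⟨hh, hd.2⟩, hq⟩
          · exact Or.inl ⟨hq, hh⟩
      · intro x hx y hy hxy
        have hx := Finset.mem_filter.1 (Finset.mem_coe.1 hx)
        have hy := Finset.mem_filter.1 (Finset.mem_coe.1 hy)
        have hp := (po_iff _).1 hP'
        dsimp only at hxy
        split_ifs at hxy with h1 h2 h2
        · exact hxy
        · rw [hxy] at hx; exact absurd hx.1 (hp y hy.1)
        · rw [← hxy] at hy; exact absurd hy.1 (hp x hx.1)
        · rw [← dInv_dInv x, hxy, dInv_dInv]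
    have c6 := Finset.card_union_le (Q.filter (fun d => ¬ G.dhead d ∈ A0)) (G.cut A0 ∩ Q)
    have c7 : G.cut A0 ∩ Q = G.cut A0 :=
      Finset.eq_of_subset_of_card_le Finset.inter_subset_left (by omega)
    obtain ⟨y, hy⟩ := hnu
    obtain ⟨n, g, h1, h2, h3, h4, h5⟩ := (hall y).resolve_left (by simpa [memA0] using hy)
    have : dartInv (g 0) ∈ G.cut A0 := by
      rw [memcut, dhead_inv, dtail_inv]
      exact ⟨h4, h3 0 (by omega)⟩
    rw [← c7] at this
    exact (po_iff _).1 hQ _ (h1 0 (by omega)) (mem_inter.1 this).2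
  · intro d hd
    rw [memcut] at hd
    simp only [mem_filter, mem_univ, true_and, not_or] at hd
    obtain ⟨h1, h2, h3⟩ := hd
    by_contra hdQ
    have hinv : dartInv d ∉ Q := by
      intro h
      have := hclos _ h (by rwa [dtail_inv]) (by rwa [dhead_inv])
      rw [dhead_inv] at this
      exact h3 this
    rcases h1 with h1 | h1
    · exact noun2 d ((memcut _ _).2 ⟨h1, h2⟩) hdQ hinv
    · exact noun1 d h1 hdQ hinv
  · intro v hv
    simp [memA0, hv]

theorem backward {P' : Finset (E × Bool)} (hP' : IsPartialOrientation P') (n : ℕ) :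
    ∀ (P : Finset (E × Bool)) (f : V → ℤ) (M : ℤ), IsPartialOrientation P →
    (∀ v, (G.indeg P' v : ℤ) = G.indeg P v - G.lap f v) → (∀ v, f v ≤ M) →
    ∑ v, (M - f v) = n → G.OrientEquiv P P' := by
  induction n using Nat.strong_induction_on with
  | _ n ih =>
  intro P f M hP hf hM hn
  by_cases hnu : ∃ v, f v ≠ M
  swap
  · push Not at hnu
    refine G.same_div hP' _ P hP (fun v => ?_) rfl
    have := hf v
    have h0 : G.lap f v = 0 := by simp [lap, hnu]
    omega
  have next : ∀ (P1 : Finset (E × Bool)) (f1 : V → ℤ), IsPartialOrientation P1 →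
    (∀ v, (G.indeg P' v : ℤ) = G.indeg P1 v - G.lap f1 v) → (∀ v, f1 v ≤ M - 1) →
    (∑ v, (M - 1 - f1 v) < ∑ v, (M - f v)) → G.OrientEquiv P1 P' := by
    intro P1 f1 h1 h2 h3 h4
    have h5 : 0 ≤ ∑ v, (M - 1 - f1 v) := Finset.sum_nonneg fun v _ => by have := h3 v; omega
    exact ih (∑ v, (M - 1 - f1 v)).toNat (by omega) P1 f1 (M-1) h1 h2 h3 (by omega)
  obtain ⟨w, hw⟩ := hnu
  by_cases hne : ∃ v, f v = M
  · obtain ⟨Q, h1, h2, h3, A, h4, h5, h6, h7⟩ := G.fire hP hP' f hf M hM hne ⟨w, hw⟩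
    refine (h1.tail (Or.inr (Or.inl ⟨A, h4, h5, h6, rfl⟩))).trans
      (next _ (fun x => f x - (if x ∈ A then 1 else 0)) (po_rev h2 h6) ?_ ?_ ?_)
    · intro v
      rw [G.cut_indeg h2 A h6, lap_sub, hf, h3]; ring
    · intro v
      have := hM v
      have := h7 v
      split_ifs with h
      · omega
      · have : f v ≠ M := fun h' => h (this h')
        omega
    · obtain ⟨y, hy⟩ : ∃ y, y ∉ A := by
        by_contra hcon
        push Not at hcon
        exact h5 (Finset.eq_univ_iff_forall.2 hcon)
      refine Finset.sum_lt_sum (fun v _ => ?_) ⟨y, mem_univ _, ?_⟩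
      · split_ifs <;> omega
      · simp [hy]
  · push Not at hne
    refine next P f hP hf (fun v => ?_) ?_
    · have := hM v
      have := hne v
      omega
    · exact Finset.sum_lt_sum (fun v _ => by omega) ⟨w, mem_univ _, by omega⟩

end Multigraph

theorem orientEquiv_iff_divisor_linEquiv
    {V E : Type} [Fintype V] [Fintype E] [DecidableEq V] [DecidableEq E]
    (G : Multigraph V E) (hG : G.Connected)
    (P P' : Finset (E × Bool))
    (hP : IsPartialOrientation P) (hP' : IsPartialOrientation P') :
    G.OrientEquiv P P' ↔ G.LinEquiv (G.divisorOf P) (G.divisorOf P') := by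
  constructor
  · intro h
    obtain ⟨_, f, hf⟩ := G.forward hP h
    refine ⟨f, fun v => ?_⟩
    simp only [Multigraph.divisorOf, hf]
    ring
  · rintro ⟨f, hf⟩
    have hle : ∀ v, f v ≤ ∑ x, |f x| := fun v =>
      (le_abs_self _).trans (Finset.single_le_sum (f := fun x => |f x|)
        (fun x _ => abs_nonneg _) (mem_univ v))
    have hnn : 0 ≤ ∑ v, (∑ x, |f x| - f v) :=
      Finset.sum_nonneg fun v _ => by have := hle v; omega
    refine G.backward hP' (∑ v, (∑ x, |f x| - f v)).toNat P f (∑ x, |f x|) hP (fun v => ?_) hle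
      (by omega)
    have := hf v
    simp only [Multigraph.divisorOf] at this
    omega
end

section
/- Let G be a graph with genus g = |E(G)| − |V(G)| + 1, let q ∈ V(G), and let 0 ≤ k ≤ g. For every oriented k-spanning tree T of (G,q), the associated divisor D_T (given by D_T(v) = indeg_T(v) − 1) is a q-reduced divisor. -/
/-!
STATEMENT 1: For every oriented `k`-spanning tree `T` of a pointed graph `(G,q)`
(with `0 ≤ k ≤ g`, `g` the genus), the associated divisor `D_T(v) = indeg_T(v) - 1`
is `q`-reduced.
-/

open Finset

namespace Multigraph

variable {V E : Type} (G : Multigraph V E)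

/-- A set of darts is acyclic if it contains no directed cycle. -/
def Acyclic (T : Finset (E × Bool)) : Prop :=
  ∀ l : List (E × Bool), (∀ d ∈ l, d ∈ T) → ¬ G.IsDirCycle l

/-- `v` is reachable from `u` by a directed path using darts from `P`. -/
def ReachIn (P : Finset (E × Bool)) (u v : V) : Prop :=
  Relation.ReflTransGen (fun a b => ∃ d ∈ P, G.dtail d = a ∧ G.dhead d = b) u v

variable [Fintype V] [Fintype E] [DecidableEq V] [DecidableEq E]

/-- An oriented `k`-spanning tree of `(G, q)`: an acyclic set of `(n - 1) + k` darts
reaching every vertex from the unique source `q`. -/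
def IsOrientedSpanningTree (q : V) (k : ℕ) (T : Finset (E × Bool)) : Prop :=
  T.card = Fintype.card V - 1 + k ∧ G.Acyclic T ∧
    (∀ v : V, G.ReachIn T q v) ∧ (∀ d ∈ T, G.dhead d ≠ q)

/-- A divisor `D` is `q`-reduced: nonnegative away from `q`, and every nonempty
`A ⊆ V ∖ {q}` contains a vertex `v` with `D v` smaller than the number of edges
joining `v` to the complement of `A`. -/
def QReduced (q : V) (D : V → ℤ) : Prop :=
  (∀ v, v ≠ q → 0 ≤ D v) ∧
    ∀ A : Finset V, A.Nonempty → q ∉ A →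
      ∃ v ∈ A, D v <
        ((univ.filter (fun d : E × Bool => G.dhead d = v ∧ G.dtail d ∉ A)).card : ℤ)

end Multigraph

theorem exists_all_tails_outside
    {V E : Type} (G : Multigraph V E) [Finite V]
    (T : Finset (E × Bool)) (hT : G.Acyclic T) (A : Finset V) (hA : A.Nonempty) :
    ∃ v ∈ A, ∀ d ∈ T, G.dhead d = v → G.dtail d ∉ A := by
  by_contra! hcon
  choose f hfT hfh hft using hcon
  let g : A → A := fun v => ⟨G.dtail (f v.1 v.2), hft v.1 v.2⟩
  obtain ⟨a, ha⟩ := hA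
  obtain ⟨m, n, hmn, h⟩ := Finite.exists_ne_map_eq_of_infinite (fun n : ℕ => g^[n] ⟨a, ha⟩)
  have key : ∃ x : A, x ∈ Function.periodicPts g := by
    have aux : ∀ m n : ℕ, m < n → g^[m] ⟨a, ha⟩ = g^[n] ⟨a, ha⟩ →
        ∃ x : A, x ∈ Function.periodicPts g := by
      intro m n hlt h
      refine ⟨g^[m] ⟨a, ha⟩, n - m, by omega, ?_⟩
      unfold Function.IsPeriodicPt Function.IsFixedPt
      rw [← Function.iterate_add_apply, Nat.sub_add_cancel hlt.le, h]
    rcases lt_or_gt_of_ne hmn with hlt | hlt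
    · exact aux m n hlt h
    · exact aux n m hlt h.symm
  obtain ⟨x, hx⟩ := key
  have hp := Function.minimalPeriod_pos_of_mem_periodicPts hx
  have hper : g^[Function.minimalPeriod g x] x = x := Function.iterate_minimalPeriod
  have hinj : ∀ i < Function.minimalPeriod g x, ∀ j < Function.minimalPeriod g x,
      g^[i] x = g^[j] x → i = j := fun i hi j hj hij =>
    (Function.iterate_eq_iterate_iff_of_lt_minimalPeriod hi hj).1 hij
  generalize Function.minimalPeriod g x = p at hp hper hinj
  let F : ℕ → E × Bool := fun i => f (g^[i] x).1 (g^[i] x).2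
  have hFh : ∀ i, G.dhead (F i) = (g^[i] x).1 := fun i => hfh _ _
  have hFt : ∀ i, G.dtail (F i) = (g^[i+1] x).1 := fun i => by
    rw [Function.iterate_succ_apply']
  obtain ⟨r, rfl⟩ : ∃ r, p = r + 1 := ⟨p - 1, by omega⟩
  refine hT ((List.range (r+1)).map F).reverse ?_ ⟨?_, ?_, ?_, ?_⟩
  · intro d hd
    simp only [List.mem_reverse, List.mem_map] at hd
    obtain ⟨i, -, rfl⟩ := hd
    exact hfT _ _
  · simp
  · rw [List.nodup_reverse]
    refine List.Nodup.map_on ?_ List.nodup_range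
    intro i hi j hj hij
    refine hinj i (by simpa using hi) j (by simpa using hj) (Subtype.ext ?_)
    rw [← hFh, ← hFh, hij]
  · refine List.isChain_reverse.2 ?_
    rw [List.isChain_map]
    rw [List.isChain_iff_getElem]
    intro i hi
    simp [hFh, hFt]
  · intro h
    rw [List.getLast_reverse, List.head_reverse]
    simp only [List.head_map, List.getLast_map, List.head_range, List.getLast_range, hFh, hFt]
    simp [hper]

theorem divisor_of_oriented_spanning_tree_is_reduced
    {V E : Type} [Fintype V] [Fintype E] [DecidableEq V] [DecidableEq E]
    (G : Multigraph V E) (hG : G.Connected) (q : V) (k : ℕ)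
    (hk : k + Fintype.card V ≤ Fintype.card E + 1)
    (T : Finset (E × Bool)) (hT : G.IsOrientedSpanningTree q k T) :
    G.QReduced q (G.divisorOf T) := by
  obtain ⟨-, hac, hreach, -⟩ := hT
  constructor
  · intro v hv
    have h : 0 < G.indeg T v := by
      rcases Relation.ReflTransGen.cases_tail (hreach v) with h | ⟨c, -, d, hd, -, hh⟩
      · exact absurd h hv
      · exact Finset.card_pos.2 ⟨d, Finset.mem_filter.2 ⟨hd, hh⟩⟩
    unfold Multigraph.divisorOf
    omega
  · intro A hA _
    obtain ⟨v, hv, hout⟩ := exists_all_tails_outside G T hac A hA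
    refine ⟨v, hv, ?_⟩
    have h : G.indeg T v ≤
        (univ.filter (fun d : E × Bool => G.dhead d = v ∧ G.dtail d ∉ A)).card := by
      refine Finset.card_le_card ?_
      intro d hd
      rw [Finset.mem_filter] at hd
      exact Finset.mem_filter.2 ⟨Finset.mem_univ _, hd.2, hout d hd.1 hd.2⟩
    unfold Multigraph.divisorOf
    omega
end

section
/- Let G be a graph with genus g = |E(G)| − |V(G)| + 1, let q ∈ V(G), and let 0 ≤ k ≤ g. For every q-reduced divisor D on G of degree k − 1 with D(q) = −1, there exists an oriented k-spanning tree T of (G,q) whose associated divisor D_T is linearly equivalent to D. -/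
/-!
STATEMENT 2: For every `q`-reduced divisor `D` of degree `k - 1` with `D(q) = -1`
(`0 ≤ k ≤ g`), there exists an oriented `k`-spanning tree `T` of `(G,q)` whose
associated divisor `D_T` is linearly equivalent to `D`.
-/

open Finset

namespace Multigraph

theorem exists_rank {V E : Type} [Fintype V] [Fintype E] [DecidableEq V] [DecidableEq E]
    (G : Multigraph V E) (q : V) (D : V → ℤ) (hD : G.QReduced q D) (n : ℕ) :
    ∀ A : Finset V, A.card = n → q ∉ A → ∃ r : V → ℕ, (∀ v, v ∉ A → r v = 0) ∧ (∀ v ∈ A, 0 < r v) ∧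
      ∀ v ∈ A, D v <
        ((univ.filter (fun d : E × Bool => G.dhead d = v ∧ r (G.dtail d) < r v)).card : ℤ) := by
  induction n with
  | zero =>
    intro A hA _
    rw [Finset.card_eq_zero] at hA
    subst hA
    exact ⟨fun _ => 0, by simp, by simp, by simp⟩
  | succ n ih =>
    intro A hA hqA
    obtain ⟨v, hv, hlt⟩ := hD.2 A (Finset.card_pos.1 (by omega)) hqA
    obtain ⟨r, h0, hp, h⟩ := ih (A.erase v) (by rw [Finset.card_erase_of_mem hv]; omega)
      (fun hh => hqA (Finset.mem_of_mem_erase hh))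
    refine ⟨fun w => if w = v then 1 else if w ∈ A then r w + 1 else 0, ?_, ?_, ?_⟩
    · intro w hw
      have : w ≠ v := fun e => hw (e ▸ hv)
      simp [this, hw]
    · intro w hw
      by_cases e : w = v <;> simp [e, hw]
    · intro w hw
      by_cases e : w = v
      · subst e
        refine lt_of_lt_of_le hlt ?_
        norm_cast
        apply Finset.card_le_card
        intro d
        simp only [Finset.mem_filter, Finset.mem_univ, true_and]
        rintro ⟨h1, h2⟩
        have : G.dtail d ≠ w := fun e => h2 (e ▸ hw)
        simp [h1, h2, this]
      · have hw' : w ∈ A.erase v := Finset.mem_erase.2 ⟨e, hw⟩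
        refine lt_of_lt_of_le (h w hw') ?_
        norm_cast
        apply Finset.card_le_card
        intro d
        simp only [Finset.mem_filter, Finset.mem_univ, true_and]
        rintro ⟨h1, h2⟩
        have := hp w hw'
        refine ⟨h1, ?_⟩
        simp only [e, hw, if_true, if_false]
        split_ifs <;> omega

theorem chain_rank {V E : Type} (G : Multigraph V E) (r : V → ℕ) (l : List (E × Bool)) :
    (∀ d ∈ l, r (G.dtail d) < r (G.dhead d)) →
    l.IsChain (fun d d' => G.dhead d = G.dtail d') →
    ∀ h : l ≠ [], r (G.dtail (l.head h)) < r (G.dhead (l.getLast h)) := by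
  induction l with
  | nil => intro _ _ h; exact absurd rfl h
  | cons a l ih =>
    intro hr hc h
    cases l with
    | nil => simpa using hr
    | cons b l =>
      rw [List.isChain_cons_cons] at hc
      have h1 := ih (fun d hd => hr d (List.mem_cons_of_mem _ hd)) hc.2 (by simp)
      have h2 := hr a (by simp)
      rw [List.getLast_cons (by simp)]
      simp only [List.head_cons] at h1 ⊢
      rw [← hc.1] at h1
      exact h2.trans h1

end Multigraph

theorem reduced_divisor_linEquiv_oriented_spanning_tree
    {V E : Type} [Fintype V] [Fintype E] [DecidableEq V] [DecidableEq E]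
    (G : Multigraph V E) (hG : G.Connected) (q : V) (k : ℕ)
    (hk : k + Fintype.card V ≤ Fintype.card E + 1)
    (D : V → ℤ) (hD : G.QReduced q D) (hq : D q = -1)
    (hdeg : ∑ v : V, D v = (k : ℤ) - 1) :
    ∃ T : Finset (E × Bool), G.IsOrientedSpanningTree q k T ∧
      G.LinEquiv (G.divisorOf T) D := by
  obtain ⟨r, h0, hp, h⟩ := G.exists_rank q D hD _ (univ.erase q) rfl (by simp)
  have hnn : ∀ v, 0 ≤ D v + 1 := by
    intro v
    by_cases e : v = q
    · subst e; omega
    · have := hD.1 v e; omega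
  have hS : ∀ v, ∃ S ⊆ univ.filter (fun d : E × Bool => G.dhead d = v ∧ r (G.dtail d) < r v),
      S.card = (D v + 1).toNat := by
    intro v
    apply Finset.exists_subset_card_eq
    by_cases e : v = q
    · subst e; simp [hq]
    · have := h v (by simp [e]); omega
  choose S hS hc using hS
  have hS' : ∀ v, ∀ d ∈ S v, G.dhead d = v ∧ r (G.dtail d) < r v := by
    intro v d hd
    simpa using hS v hd
  set T : Finset (E × Bool) := univ.filter (fun d => d ∈ S (G.dhead d)) with hT
  have hTr : ∀ d ∈ T, r (G.dtail d) < r (G.dhead d) := by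
    intro d hd
    exact (hS' _ d (by simpa [hT] using hd)).2
  have hfil : ∀ v, T.filter (fun d => G.dhead d = v) = S v := by
    intro v
    ext d
    simp only [hT, Finset.mem_filter, Finset.mem_univ, true_and]
    constructor
    · rintro ⟨h1, h2⟩; rwa [h2] at h1
    · intro h1
      have := (hS' v d h1).1
      exact ⟨by rwa [this], this⟩
  have hin : ∀ v, (G.indeg T v : ℤ) = D v + 1 := by
    intro v
    have := hnn v
    rw [Multigraph.indeg, hfil, hc]; omega
  refine ⟨T, ⟨?_, ?_, ?_, ?_⟩, fun _ => 0, ?_⟩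
  · have h1 : T.card = ∑ v : V, G.indeg T v :=
      Finset.card_eq_sum_card_fiberwise (fun _ _ => by simp)
    have h2 : (T.card : ℤ) = (k : ℤ) - 1 + Fintype.card V := by
      rw [h1]; push_cast
      simp [hin, Finset.sum_add_distrib, hdeg]
    have : 0 < Fintype.card V := Fintype.card_pos_iff.2 ⟨q⟩
    omega
  · intro l hl hcyc
    obtain ⟨hne, -, hch, hcl⟩ := hcyc
    have := G.chain_rank r l (fun d hd => hTr d (hl d hd)) hch hne
    rw [hcl hne] at this
    exact lt_irrefl _ this
  · have key : ∀ n, ∀ v, r v = n → G.ReachIn T q v := by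
      intro n
      induction n using Nat.strong_induction_on with
      | _ n ih =>
        intro v hv
        by_cases e : v = q
        · subst e; exact Relation.ReflTransGen.refl
        · have hpos : 0 < (S v).card := by
            have := hD.1 v e
            rw [hc]; omega
          obtain ⟨d, hd⟩ := Finset.card_pos.1 hpos
          have hd' := hS' v d hd
          refine Relation.ReflTransGen.tail (ih _ (hv ▸ hd'.2) (G.dtail d) rfl) ⟨d, ?_, rfl, hd'.1⟩
          simp [hT, hd'.1, hd]
    exact fun v => key _ v rfl
  · intro d hd e
    have := hTr d hd
    rw [e, h0 q (by simp)] at this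
    omega
  · intro v
    simp [Multigraph.divisorOf, Multigraph.lap, hin]
end

section
/- Let A = {H₁,…,H_m} be an oriented affine hyperplane arrangement in ℝ^{n−1} and let O ⊂ S = k[x₁,…,x_m,y₁,…,y_m] be its oriented matroid ideal. Then the set {x₁ − y₁, …, x_m − y_m} forms a regular sequence on S/O^∨, where O^∨ is the Alexander dual of O. -/
/-!
STATEMENT 5: For an oriented affine hyperplane arrangement `A` in `ℝⁿ` with oriented
matroid ideal `O ⊆ S = k[x₁,…,x_m,y₁,…,y_m]`, the set `{x₁ - y₁, …, x_m - y_m}` is a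
regular sequence on `S/O^∨`.
-/

open MvPolynomial

noncomputable section

open scoped Classical

/-- The Alexander dual of a squarefree monomial ideal. -/
def alexanderDual {ι : Type} (k : Type) [Field k] (I : Ideal (MvPolynomial ι k)) :
    Ideal (MvPolynomial ι k) :=
  Ideal.span {p | ∃ σ : Finset ι, p = ∏ i ∈ σ, X i ∧
    ∀ τ : Finset ι, (∏ i ∈ τ, X i) ∈ I → (σ ∩ τ).Nonempty}

/-- The oriented matroid ideal of the arrangement: generated by the monomials
`m(v) = ∏_{h_i(v) > c_i} x_i ∏_{h_i(v) < c_i} y_i` where `x_i = X (inl i)`,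
`y_i = X (inr i)`. -/
def orientedMatroidIdeal (k : Type) [Field k] (m n : ℕ)
    (h : Fin m → ((Fin n → ℝ) →ₗ[ℝ] ℝ)) (c : Fin m → ℝ) :
    Ideal (MvPolynomial (Fin m ⊕ Fin m) k) :=
  Ideal.span {p | ∃ v : Fin n → ℝ,
    p = (∏ i ∈ Finset.univ.filter (fun i => c i < h i v), X (Sum.inl i)) *
        (∏ i ∈ Finset.univ.filter (fun i => h i v < c i), X (Sum.inr i))}

/-- A convex set meeting every closed orthant meets the common zero set. -/
lemma omi_convex {V : Type} [AddCommGroup V] [Module ℝ V] {J : Type}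
    (h : J → (V →ₗ[ℝ] ℝ)) (c : J → ℝ) (T : Finset J) :
    ∀ P : Set V, Convex ℝ P →
      (∀ s : J → Prop, ∃ v ∈ P, ∀ j ∈ T, (s j → h j v ≤ c j) ∧ (¬ s j → c j ≤ h j v)) →
      ∃ w ∈ P, ∀ j ∈ T, h j w = c j := by
  induction T using Finset.induction_on with
  | empty =>
    intro P hP hs
    obtain ⟨v, hv, -⟩ := hs (fun _ => True)
    exact ⟨v, hv, by simp⟩
  | insert a T ha ih =>
    intro P hP hs
    obtain ⟨p, ⟨hpP, hpa⟩, hp⟩ := ih (P ∩ {v | h a v ≤ c a})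
      (hP.inter (convex_halfSpace_le (h a).isLinear _)) (by
        intro s
        obtain ⟨v, hv, hv'⟩ := hs (fun j => if j = a then True else s j)
        refine ⟨v, ⟨hv, ?_⟩, ?_⟩
        · exact (hv' a (by simp)).1 (by simp)
        · intro j hj
          have hja : j ≠ a := fun e => ha (e ▸ hj)
          simpa [hja] using hv' j (by simp [hj]))
    obtain ⟨q, ⟨hqP, hqa⟩, hq⟩ := ih (P ∩ {v | c a ≤ h a v})
      (hP.inter (convex_halfSpace_ge (h a).isLinear _)) (by
        intro s
        obtain ⟨v, hv, hv'⟩ := hs (fun j => if j = a then False else s j)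
        refine ⟨v, ⟨hv, ?_⟩, ?_⟩
        · exact (hv' a (by simp)).2 (by simp)
        · intro j hj
          have hja : j ≠ a := fun e => ha (e ▸ hj)
          simpa [hja] using hv' j (by simp [hj]))
    simp only [Set.mem_ofPred_eq] at hpa hqa
    rcases eq_or_lt_of_le hpa with e | hlt
    · refine ⟨p, hpP, ?_⟩
      intro j hj
      rcases Finset.mem_insert.1 hj with rfl | hj
      · exact e
      · exact hp j hj
    · have hd : 0 < h a q - h a p := by linarith
      refine ⟨((h a q - c a) / (h a q - h a p)) • p + ((c a - h a p) / (h a q - h a p)) • q,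
        hP hpP hqP (div_nonneg (by linarith) hd.le) (div_nonneg (by linarith) hd.le)
          (by field_simp; ring), ?_⟩
      intro j hj
      rw [map_add, map_smul, map_smul, smul_eq_mul, smul_eq_mul]
      rcases Finset.mem_insert.1 hj with rfl | hj
      · field_simp; ring
      · rw [hp j hj, hq j hj]; field_simp; ring

/-- Nonzerodivisor criterion for a difference of variables modulo a monomial ideal. -/
lemma omi_monomial {ι : Type} {k : Type} [Field k] (D : Set (ι →₀ ℕ)) (a b : ι) (hab : a ≠ b)
    (H : ∀ u : ι →₀ ℕ, (∃ d ∈ D, d ≤ u + Finsupp.single a 1) →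
      (∃ d ∈ D, d ≤ u + Finsupp.single b 1) → ∃ d ∈ D, d ≤ u)
    (f : MvPolynomial ι k)
    (hf : (X a - X b) * f ∈ Ideal.span ((fun s => monomial s (1 : k)) '' D)) :
    f ∈ Ideal.span ((fun s => monomial s (1 : k)) '' D) := by
  rw [mem_ideal_span_monomial_image] at hf ⊢
  by_contra hcon
  push Not at hcon
  -- coefficient identity
  have key : ∀ u : ι →₀ ℕ, coeff (u + Finsupp.single a 1) ((X a - X b) * f) ≠ 0 →
      ∃ d ∈ D, d ≤ u + Finsupp.single a 1 := fun u hu => hf _ (mem_support_iff.2 hu)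
  have key' : ∀ u : ι →₀ ℕ, coeff (u + Finsupp.single b 1) ((X a - X b) * f) ≠ 0 →
      ∃ d ∈ D, d ≤ u + Finsupp.single b 1 := fun u hu => hf _ (mem_support_iff.2 hu)
  -- the bad terms
  let Q : (ι →₀ ℕ) → Prop := fun u => ∃ d ∈ D, d ≤ u
  have Qmono : ∀ u v, Q u → u ≤ v → Q v := fun u v ⟨d, hd, h1⟩ h2 => ⟨d, hd, h1.trans h2⟩
  -- if w is bad, in the support, then some w + (a-shift) and so on
  obtain ⟨u0, hu0, hbad0⟩ := hcon
  let B : Finset (ι →₀ ℕ) := f.support.filter (fun u => ¬ Q u)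
  have hB0 : u0 ∈ B := by
    simp only [B, Finset.mem_filter]
    exact ⟨hu0, fun ⟨d, hd, h1⟩ => hbad0 d hd h1⟩
  -- coefficient at u + a
  have up : ∀ u ∈ B, ¬ Q (u + Finsupp.single a 1) →
      ∃ u' ∈ B, u' + Finsupp.single b 1 = u + Finsupp.single a 1 := by
    intro u hu hq
    have h0 : coeff (u + Finsupp.single a 1) ((X a - X b) * f) = 0 := by
      by_contra h0
      exact hq (key u h0)
    rw [sub_mul, coeff_sub, add_comm u, coeff_X_mul] at h0
    have hub := (mem_support_iff.1 (Finset.mem_filter.1 hu).1)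
    rw [sub_eq_zero] at h0
    rw [coeff_X_mul'] at h0
    split_ifs at h0 with h1
    · have hle : Finsupp.single b 1 ≤ Finsupp.single a 1 + u := by
        rw [Finsupp.single_le_iff]
        exact Nat.one_le_iff_ne_zero.2 (Finsupp.mem_support_iff.1 h1)
      have e := tsub_add_cancel_of_le hle
      refine ⟨Finsupp.single a 1 + u - Finsupp.single b 1, ?_, by rw [e, add_comm]⟩
      simp only [B, Finset.mem_filter, mem_support_iff]
      refine ⟨h0 ▸ hub, fun hQ => hq ?_⟩
      refine Qmono _ _ hQ ?_
      rw [add_comm u]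
      exact tsub_le_self
    · exact absurd h0 hub
  have dn : ∀ u ∈ B, ¬ Q (u + Finsupp.single b 1) →
      ∃ u' ∈ B, u' + Finsupp.single a 1 = u + Finsupp.single b 1 := by
    intro u hu hq
    have h0 : coeff (u + Finsupp.single b 1) ((X a - X b) * f) = 0 := by
      by_contra h0
      exact hq (key' u h0)
    rw [sub_mul, coeff_sub, add_comm u, coeff_X_mul] at h0
    have hub := (mem_support_iff.1 (Finset.mem_filter.1 hu).1)
    rw [sub_eq_zero] at h0
    rw [coeff_X_mul'] at h0
    split_ifs at h0 with h1
    · have hle : Finsupp.single a 1 ≤ Finsupp.single b 1 + u := by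
        rw [Finsupp.single_le_iff]
        exact Nat.one_le_iff_ne_zero.2 (Finsupp.mem_support_iff.1 h1)
      have e := tsub_add_cancel_of_le hle
      refine ⟨Finsupp.single b 1 + u - Finsupp.single a 1, ?_, by rw [e, add_comm]⟩
      simp only [B, Finset.mem_filter, mem_support_iff]
      refine ⟨h0 ▸ hub, fun hQ => hq ?_⟩
      refine Qmono _ _ hQ ?_
      rw [add_comm u]
      exact tsub_le_self
    · exact absurd h0.symm hub
  -- top element: choose u1 in B with maximal a-exponent among those equal to u0 modulo a - b
  let B' : Finset (ι →₀ ℕ) := B.filter (fun u => ∃ r t : ℕ,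
    u + Finsupp.single a r + Finsupp.single b t = u0 + Finsupp.single a t + Finsupp.single b r)
  have hB'0 : u0 ∈ B' := Finset.mem_filter.2 ⟨hB0, 0, 0, by simp⟩
  obtain ⟨u1, hu1, hmax⟩ := B'.exists_max_image (fun u => u a) ⟨u0, hB'0⟩
  obtain ⟨u2, hu2, hmin⟩ := B'.exists_min_image (fun u => u a) ⟨u0, hB'0⟩
  have hu1B := (Finset.mem_filter.1 hu1).1
  have hu2B := (Finset.mem_filter.1 hu2).1
  have ev : ∀ x y : ι →₀ ℕ, x = y → ∀ j, x j = y j := fun x y e j => by rw [e]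
  have hQ1 : Q (u1 + Finsupp.single a 1) := by
    by_contra hq
    obtain ⟨u', hu', e⟩ := up u1 hu1B hq
    have h1 := hmax u' (by
      obtain ⟨r, t, h⟩ := (Finset.mem_filter.1 hu1).2
      refine Finset.mem_filter.2 ⟨hu', r, t + 1, ?_⟩
      have : (u' + Finsupp.single b 1) + Finsupp.single a r + Finsupp.single b t
        = u0 + Finsupp.single a t + Finsupp.single b r + Finsupp.single a 1 := by
        rw [e, ← h]; abel
      rw [Finsupp.single_add, Finsupp.single_add]
      calc _ = (u' + Finsupp.single b 1) + Finsupp.single a r + Finsupp.single b t := by abel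
        _ = _ := by rw [this]; abel)
    have := ev _ _ e a
    simp [hab, hab.symm] at this
    omega
  have hQ2 : Q (u2 + Finsupp.single b 1) := by
    by_contra hq
    obtain ⟨u', hu', e⟩ := dn u2 hu2B hq
    have h1 := hmin u' (by
      obtain ⟨r, t, h⟩ := (Finset.mem_filter.1 hu2).2
      refine Finset.mem_filter.2 ⟨hu', r + 1, t, ?_⟩
      have : (u' + Finsupp.single a 1) + Finsupp.single a r + Finsupp.single b t
        = u0 + Finsupp.single a t + Finsupp.single b r + Finsupp.single b 1 := by
        rw [e, ← h]; abel
      rw [Finsupp.single_add, Finsupp.single_add]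
      calc _ = (u' + Finsupp.single a 1) + Finsupp.single a r + Finsupp.single b t := by abel
        _ = _ := by rw [this]; abel)
    have := ev _ _ e a
    simp [hab, hab.symm] at this
    omega
  -- now u1 + b^N is never in the ideal
  have hN : ∀ N : ℕ, ¬ Q (u1 + Finsupp.single b N) := by
    intro N
    induction N with
    | zero => simpa using (Finset.mem_filter.1 hu1B).2
    | succ N ih =>
      intro hq
      refine ih (H _ ?_ ?_)
      · refine Qmono _ _ hQ1 ?_
        rw [add_right_comm]
        exact le_self_add
      · rw [add_assoc, ← Finsupp.single_add]; exact hq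
  refine hN (u2 b + 1) (Qmono _ _ hQ2 ?_)
  obtain ⟨r, t, h1⟩ := (Finset.mem_filter.1 hu1).2
  obtain ⟨r', t', h2⟩ := (Finset.mem_filter.1 hu2).2
  have h3 := hmin u1 hu1
  intro j
  have e1 := ev _ _ h1 j
  have e2 := ev _ _ h2 j
  by_cases ja : j = a
  · subst ja
    simp [hab, hab.symm] at e1 e2 ⊢
    omega
  · by_cases jb : j = b
    · subst jb
      simp
    · have ja' : a ≠ j := fun e => ja e.symm
      have jb' : b ≠ j := fun e => jb e.symm
      simp [ja', jb', ja, jb] at e1 e2 ⊢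
      omega

/-- identification of the first `i` pairs of variables -/
def omiPi (m i : ℕ) : Fin m ⊕ Fin m → Fin m ⊕ Fin m
  | Sum.inl j => if (j : ℕ) < i then Sum.inr j else Sum.inl j
  | Sum.inr j => Sum.inr j

/-- σ covers: the open half spaces in σ cover the whole space -/
def omiCov {m n : ℕ} (h : Fin m → ((Fin n → ℝ) →ₗ[ℝ] ℝ)) (c : Fin m → ℝ)
    (σ : Finset (Fin m ⊕ Fin m)) : Prop :=
  ∀ v : Fin n → ℝ, ∃ j, (Sum.inl j ∈ σ ∧ c j < h j v) ∨ (Sum.inr j ∈ σ ∧ h j v < c j)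

/-- exponent of the image monomial -/
def omiE {m : ℕ} (i : ℕ) (σ : Finset (Fin m ⊕ Fin m)) : (Fin m ⊕ Fin m) →₀ ℕ :=
  ∑ a ∈ σ, Finsupp.single (omiPi m i a) 1

lemma omiE_apply {m : ℕ} (i : ℕ) (σ : Finset (Fin m ⊕ Fin m)) (b : Fin m ⊕ Fin m) :
    omiE i σ b = (σ.filter (fun a => omiPi m i a = b)).card := by
  rw [omiE, Finsupp.finsetSum_apply, Finset.card_filter]
  exact Finset.sum_congr rfl fun a _ => by rw [Finsupp.single_apply]

lemma omi_comb {m n : ℕ} (h : Fin m → ((Fin n → ℝ) →ₗ[ℝ] ℝ)) (c : Fin m → ℝ) (i : Fin m)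
    (u : (Fin m ⊕ Fin m) →₀ ℕ) (σ σ' : Finset (Fin m ⊕ Fin m))
    (hσ : omiCov h c σ) (hσ' : omiCov h c σ')
    (h1 : omiE i σ ≤ u + Finsupp.single (Sum.inl i) 1)
    (h2 : omiE i σ' ≤ u + Finsupp.single (Sum.inr i) 1) :
    ∃ σ'', omiCov h c σ'' ∧ omiE i σ'' ≤ u := by
  by_contra hcon
  push Not at hcon
  let Bl : Fin m → Prop := fun j => if j < i then 2 ≤ u (Sum.inr j) else 1 ≤ u (Sum.inl j)
  let Br : Fin m → Prop := fun j => if j < i then 2 ≤ u (Sum.inr j) else 1 ≤ u (Sum.inr j)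
  let T : Finset (Fin m) := Finset.univ.filter (fun j => j < i ∧ u (Sum.inr j) = 1)
  let P : Set (Fin n → ℝ) := {v | (∀ j, Bl j → h j v ≤ c j) ∧ (∀ j, Br j → c j ≤ h j v)}
  have hP : Convex ℝ P := by
    have e : P = (⋂ j, ⋂ (_ : Bl j), {v | h j v ≤ c j}) ∩ ⋂ j, ⋂ (_ : Br j), {v | c j ≤ h j v} := by
      ext v; simp [P]
    rw [e]
    exact (convex_iInter₂ fun j _ => convex_halfSpace_le (h j).isLinear _).inter
      (convex_iInter₂ fun j _ => convex_halfSpace_ge (h j).isLinear _)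
  obtain ⟨w, ⟨hw1, hw2⟩, hwT⟩ := omi_convex h c T P hP (by
    intro s
    let L : Fin m → Prop := fun j => Bl j ∨ (j ∈ T ∧ s j)
    let R : Fin m → Prop := fun j => Br j ∨ (j ∈ T ∧ ¬ s j)
    let σs : Finset (Fin m ⊕ Fin m) := Finset.univ.filter (fun a => Sum.elim L R a)
    have hE : omiE i σs ≤ u := by
      intro b
      rw [omiE_apply]
      rcases b with j | j
      · by_cases hj : j < i
        · have : σs.filter (fun a => omiPi m i a = Sum.inl j) = ∅ := by
            ext a
            rcases a with l | l
            · rw [Finset.mem_filter]; simp only [omiPi]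
              split_ifs with hl <;> simp
              rintro - rfl
              exact hl hj
            · simp [omiPi]
          rw [this]; simp
        · by_cases hu : 1 ≤ u (Sum.inl j)
          · refine le_trans (Finset.card_le_one.2 ?_) hu
            have : ∀ a, omiPi m i a = Sum.inl j → a = Sum.inl j := by
              rintro (l | l) <;> simp only [omiPi]
              · split_ifs <;> simp
              · simp
            intro a ha a' ha'
            rw [this a (Finset.mem_filter.1 ha).2, this a' (Finset.mem_filter.1 ha').2]
          · have : σs.filter (fun a => omiPi m i a = Sum.inl j) = ∅ := by
              ext a
              rcases a with l | l
              · rw [Finset.mem_filter]; simp only [omiPi]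
                split_ifs with hl <;> simp
                rintro hm rfl
                simp [σs, L, Bl, T, hj] at hm
                omega
              · simp [omiPi]
            rw [this]; simp
      · have hsub : ∀ a, omiPi m i a = Sum.inr j → (a = Sum.inl j ∧ j < i) ∨ a = Sum.inr j := by
          rintro (l | l) <;> simp only [omiPi]
          · split_ifs with hl <;> simp
            rintro rfl
            exact ⟨rfl, hl⟩
          · simp
        have hl : Sum.inl j ∈ σs ↔ L j := by simp [σs]
        have hr : Sum.inr j ∈ σs ↔ R j := by simp [σs]
        have hsub2 : σs.filter (fun a => omiPi m i a = Sum.inr j) ⊆ {Sum.inl j, Sum.inr j} := by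
          intro a ha
          rcases hsub a (Finset.mem_filter.1 ha).2 with h | h <;> simp [h]
        have hc2 := (Finset.card_le_card hsub2).trans Finset.card_le_two
        by_cases hj : j < i
        · by_cases hu2 : 2 ≤ u (Sum.inr j)
          · exact hc2.trans hu2
          · by_cases hu1 : u (Sum.inr j) = 1
            · rw [hu1, Finset.card_le_one]
              have hT : j ∈ T := by simp [T, hj, hu1]
              have hl' : L j ↔ s j := by simp [L, Bl, hj, hu1, hT]
              have hr' : R j ↔ ¬ s j := by simp [R, Br, hj, hu1, hT]
              intro a ha a' ha'
              rw [Finset.mem_filter] at ha ha'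
              rcases hsub a ha.2 with ⟨rfl, -⟩ | rfl <;> rcases hsub a' ha'.2 with ⟨rfl, -⟩ | rfl
              · rfl
              · exact absurd (hl'.1 (hl.1 ha.1)) (hr'.1 (hr.1 ha'.1))
              · exact absurd (hl'.1 (hl.1 ha'.1)) (hr'.1 (hr.1 ha.1))
              · rfl
            · have hT : j ∉ T := by simp [T, hu1]
              have : σs.filter (fun a => omiPi m i a = Sum.inr j) = ∅ := by
                rw [Finset.filter_eq_empty_iff]
                intro a ha e
                rcases hsub a e with ⟨rfl, -⟩ | rfl
                · rw [hl] at ha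
                  simp [L, Bl, hj, hT] at ha
                  omega
                · rw [hr] at ha
                  simp [R, Br, hj, hT] at ha
                  omega
              rw [this]; simp
        · have hT : j ∉ T := by simp [T, hj]
          by_cases hu : 1 ≤ u (Sum.inr j)
          · refine le_trans (Finset.card_le_one.2 ?_) hu
            intro a ha a' ha'
            rw [Finset.mem_filter] at ha ha'
            rcases hsub a ha.2 with ⟨-, h⟩ | rfl
            · exact absurd h hj
            rcases hsub a' ha'.2 with ⟨-, h⟩ | rfl
            · exact absurd h hj
            rfl
          · have : σs.filter (fun a => omiPi m i a = Sum.inr j) = ∅ := by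
              rw [Finset.filter_eq_empty_iff]
              intro a ha e
              rcases hsub a e with ⟨rfl, h⟩ | rfl
              · exact absurd h hj
              · rw [hr] at ha
                simp [R, Br, hj, hT] at ha
                omega
            rw [this]; simp
    have hnc : ¬ omiCov h c σs := fun hc => hcon σs hc hE
    simp only [omiCov, not_forall, not_exists, not_or, not_and, not_lt] at hnc
    obtain ⟨v, hv⟩ := hnc
    have hl : ∀ j, L j → h j v ≤ c j := fun j hj => (hv j).1 (by simp [σs, hj])
    have hr : ∀ j, R j → c j ≤ h j v := fun j hj => (hv j).2 (by simp [σs, hj])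
    exact ⟨v, ⟨fun j hj => hl j (Or.inl hj), fun j hj => hr j (Or.inl hj)⟩,
      fun j hj => ⟨fun hs => hl j (Or.inr ⟨hj, hs⟩), fun hs => hr j (Or.inr ⟨hj, hs⟩)⟩⟩)
  have pos : ∀ (ρ : Finset (Fin m ⊕ Fin m)) (a b), a ∈ ρ → omiE i ρ ≤ u + Finsupp.single b 1 →
      omiPi m i a ≠ b → 1 ≤ u (omiPi m i a) := by
    intro ρ a b ha hle hne
    have := hle (omiPi m i a)
    rw [omiE_apply] at this
    have h3 : 0 < (ρ.filter (fun a' => omiPi m i a' = omiPi m i a)).card :=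
      Finset.card_pos.2 ⟨a, by simp [ha]⟩
    simp [Finsupp.single_apply, hne.symm] at this
    omega
  have fin : ∀ (ρ : Finset (Fin m ⊕ Fin m)) (b), omiCov h c ρ →
      omiE i ρ ≤ u + Finsupp.single b 1 →
      (b = Sum.inl i ∧ h i w ≤ c i ∨ b = Sum.inr i ∧ c i ≤ h i w) → False := by
    intro ρ b hρ hle hb
    obtain ⟨j, ⟨hj, hlt⟩ | ⟨hj, hlt⟩⟩ := hρ w
    · have hne : omiPi m i (Sum.inl j) ≠ b := by
        rcases hb with ⟨rfl, hb⟩ | ⟨rfl, hb⟩ <;> simp only [omiPi] <;> split_ifs with hji <;> simp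
        · rintro rfl; linarith
        · rintro rfl; omega
      have hp := pos ρ _ b hj hle hne
      by_cases hji : j < i
      · simp [omiPi, hji] at hp
        by_cases h1 : u (Sum.inr j) = 1
        · have := hwT j (by simp [T, hji, h1])
          linarith
        · have := hw1 j (by simp [Bl, hji]; omega)
          linarith
      · simp [omiPi, hji] at hp
        have := hw1 j (by simp [Bl, hji]; omega)
        linarith
    · have hne : omiPi m i (Sum.inr j) ≠ b := by
        rcases hb with ⟨rfl, hb⟩ | ⟨rfl, hb⟩ <;> simp only [omiPi] <;> simp
        rintro rfl; linarith
      have hp := pos ρ _ b hj hle hne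
      simp only [omiPi] at hp
      by_cases hji : j < i
      · by_cases h1 : u (Sum.inr j) = 1
        · have := hwT j (by simp [T, hji, h1])
          linarith
        · have := hw2 j (by simp [Br, hji]; omega)
          linarith
      · have := hw2 j (by simp [Br, hji]; omega)
        linarith
  rcases le_total (h i w) (c i) with hle | hle
  · exact fin σ _ hσ h1 (Or.inl ⟨rfl, hle⟩)
  · exact fin σ' _ hσ' h2 (Or.inr ⟨rfl, hle⟩)

lemma omi_prod {ι k : Type} [Field k] (σ : Finset ι) (g : ι → ι) :
    (∏ a ∈ σ, X (g a) : MvPolynomial ι k) =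
      monomial (∑ a ∈ σ, Finsupp.single (g a) 1) 1 := by
  rw [monomial_sum_one]
  rfl

lemma omi_mem_inter {α : Type} (d : DecidableEq α) (s t : Finset α) (a : α) :
    a ∈ @Inter.inter _ (@Finset.instInter α d) s t ↔ a ∈ s ∧ a ∈ t := Finset.mem_inter

lemma omi_dual (k : Type) [Field k] (m n : ℕ)
    (h : Fin m → ((Fin n → ℝ) →ₗ[ℝ] ℝ)) (c : Fin m → ℝ) :
    alexanderDual k (orientedMatroidIdeal k m n h c) =
      Ideal.span {p | ∃ σ, p = ∏ a ∈ σ, X a ∧ omiCov h c σ} := by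
  unfold alexanderDual
  congr 1
  ext p
  refine exists_congr fun σ => and_congr_right fun _ => ?_
  let S : (Fin n → ℝ) → Finset (Fin m ⊕ Fin m) := fun v =>
    (Finset.univ.filter (fun i => c i < h i v)).disjSum (Finset.univ.filter (fun i => h i v < c i))
  have hS : orientedMatroidIdeal k m n h c = Ideal.span ((fun s => monomial s (1 : k)) ''
      (Set.range fun v => ∑ a ∈ S v, Finsupp.single a 1)) := by
    unfold orientedMatroidIdeal
    congr 1
    ext p
    simp only [Set.mem_ofPred_eq, Set.mem_image, Set.mem_range, exists_exists_eq_and]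
    refine exists_congr fun v => ?_
    rw [← omi_prod (S v) (fun a => a), Finset.prod_disjSum, eq_comm]
  have ind : ∀ (τ : Finset (Fin m ⊕ Fin m)) (a),
      (∑ b ∈ τ, Finsupp.single b 1 : (Fin m ⊕ Fin m) →₀ ℕ) a = if a ∈ τ then 1 else 0 := by
    intro τ a
    simp [Finsupp.finsetSum_apply, Finsupp.single_apply]
  have hmem : ∀ τ : Finset (Fin m ⊕ Fin m), (∏ i ∈ τ, X i : MvPolynomial _ k) ∈
      orientedMatroidIdeal k m n h c ↔ ∃ v, S v ⊆ τ := by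
    intro τ
    rw [hS, mem_ideal_span_monomial_image, omi_prod τ (fun a => a)]
    simp only [support_monomial, one_ne_zero, if_false, Finset.mem_singleton, forall_eq,
      Set.exists_range_iff]
    refine exists_congr fun v => ⟨fun hle a ha => ?_, fun hsub a => ?_⟩
    · have := hle a
      rw [ind, ind, if_pos ha] at this
      by_contra hn
      rw [if_neg hn] at this
      omega
    · rw [ind, ind]
      by_cases ha : a ∈ S v
      · rw [if_pos ha, if_pos (hsub ha)]
      · rw [if_neg ha]; exact Nat.zero_le _
  simp only [hmem]
  constructor
  · intro H v
    obtain ⟨a, ha⟩ := H (S v) ⟨v, subset_rfl⟩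
    replace ha := (omi_mem_inter _ _ _ _).1 ha
    rcases a with j | j
    · exact ⟨j, Or.inl ⟨ha.1, by simpa [S] using ha.2⟩⟩
    · exact ⟨j, Or.inr ⟨ha.1, by simpa [S] using ha.2⟩⟩
  · rintro H τ ⟨v, hv⟩
    obtain ⟨j, ⟨hj, hlt⟩ | ⟨hj, hlt⟩⟩ := H v
    · exact ⟨Sum.inl j, (omi_mem_inter _ _ _ _).2 ⟨hj, hv (by simpa [S] using hlt)⟩⟩
    · exact ⟨Sum.inr j, (omi_mem_inter _ _ _ _).2 ⟨hj, hv (by simpa [S] using hlt)⟩⟩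

lemma omi_mem_smul {R : Type} [CommRing R] (J I : Ideal R) (f : R) :
    (Ideal.Quotient.mk J f) ∈ (I • ⊤ : Submodule R (R ⧸ J)) ↔ f ∈ I ⊔ J := by
  rw [Ideal.smul_top_eq_map, Submodule.restrictScalars_mem, Ideal.Quotient.algebraMap_eq,
    Ideal.mem_quotient_iff_mem_sup]

lemma omi_step (k : Type) [Field k] (m n : ℕ)
    (h : Fin m → ((Fin n → ℝ) →ₗ[ℝ] ℝ)) (c : Fin m → ℝ) (i : Fin m)
    (I : Ideal (MvPolynomial (Fin m ⊕ Fin m) k))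
    (hI : I = Ideal.span {p | ∃ j : Fin m, j < i ∧ p = X (Sum.inl j) - X (Sum.inr j)})
    (f : MvPolynomial (Fin m ⊕ Fin m) k)
    (hf : (X (Sum.inl i) - X (Sum.inr i)) * f ∈
      I ⊔ alexanderDual k (orientedMatroidIdeal k m n h c)) :
    f ∈ I ⊔ alexanderDual k (orientedMatroidIdeal k m n h c) := by
  rw [omi_dual] at *
  set J := Ideal.span {p : MvPolynomial (Fin m ⊕ Fin m) k | ∃ σ, p = ∏ a ∈ σ, X a ∧ omiCov h c σ}
    with hJ
  let φ : MvPolynomial (Fin m ⊕ Fin m) k →ₐ[k] MvPolynomial (Fin m ⊕ Fin m) k :=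
    rename (omiPi m i)
  let D : Set ((Fin m ⊕ Fin m) →₀ ℕ) := {d | ∃ σ, omiCov h c σ ∧ d = omiE i σ}
  have gen : ∀ σ : Finset (Fin m ⊕ Fin m),
      φ (∏ a ∈ σ, X a) = monomial (omiE i σ) 1 := by
    intro σ
    simp only [φ, map_prod, rename_X]
    exact omi_prod σ _
  have hcong : ∀ p, p - φ p ∈ I := by
    intro p
    induction p using MvPolynomial.induction_on with
    | C a => simp [φ]
    | add p q hp hq =>
      rw [map_add, add_sub_add_comm]
      exact I.add_mem hp hq
    | mul_X p a hp =>
      have ha : X a - φ (X a) ∈ I := by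
        simp only [φ, rename_X]
        rcases a with j | j
        · by_cases hj : j < i
          · simp only [omiPi, Fin.val_fin_lt, hj, if_true]
            rw [hI]
            exact Ideal.subset_span ⟨j, hj, rfl⟩
          · simp [omiPi, hj]
        · simp [omiPi]
      have e : p * X a - φ (p * X a) = X a * (p - φ p) + φ p * (X a - φ (X a)) := by
        rw [map_mul]; ring
      rw [e]
      exact I.add_mem (I.mul_mem_left _ hp) (I.mul_mem_left _ ha)
  have fwd : ∀ p ∈ I ⊔ J, φ p ∈ Ideal.span ((fun s => monomial s (1 : k)) '' D) := by
    have : I ⊔ J ≤ (Ideal.span ((fun s => monomial s (1 : k)) '' D)).comap φ := by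
      rw [sup_le_iff, hI, hJ, Ideal.span_le, Ideal.span_le]
      constructor
      · rintro _ ⟨j, hj, rfl⟩
        simp [φ, omiPi, hj]
      · rintro _ ⟨σ, rfl, hσ⟩
        rw [SetLike.mem_coe, Ideal.mem_comap, gen]
        exact Ideal.subset_span ⟨_, ⟨σ, hσ, rfl⟩, rfl⟩
    exact fun p hp => this hp
  have bwd : Ideal.span ((fun s => monomial s (1 : k)) '' D) ≤ I ⊔ J := by
    rw [Ideal.span_le]
    rintro _ ⟨_, ⟨σ, hσ, rfl⟩, rfl⟩
    simp only [SetLike.mem_coe]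
    rw [← gen]
    have h1 : (∏ a ∈ σ, X a : MvPolynomial (Fin m ⊕ Fin m) k) ∈ J :=
      Ideal.subset_span ⟨σ, rfl, hσ⟩
    have := (I ⊔ J).sub_mem (Ideal.mem_sup_right h1) (Ideal.mem_sup_left (hcong (∏ a ∈ σ, X a)))
    simpa using this
  have h1 := fwd _ hf
  have e : φ ((X (Sum.inl i) - X (Sum.inr i)) * f) = (X (Sum.inl i) - X (Sum.inr i)) * φ f := by
    simp [φ, omiPi]
  rw [e] at h1
  have h2 := omi_monomial D (Sum.inl i) (Sum.inr i) (by simp) (by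
    rintro u ⟨_, ⟨σ, hσ, rfl⟩, hle⟩ ⟨_, ⟨σ', hσ', rfl⟩, hle'⟩
    obtain ⟨σ'', h1, h2⟩ := omi_comb h c i u σ σ' hσ hσ' hle hle'
    exact ⟨_, ⟨σ'', h1, rfl⟩, h2⟩) _ h1
  have := (I ⊔ J).add_mem (Ideal.mem_sup_left (hcong f)) (bwd h2)
  simpa using this

theorem isRegular_diff_on_alexanderDual_orientedMatroidIdeal
    (k : Type) [Field k] (m n : ℕ)
    (h : Fin m → ((Fin n → ℝ) →ₗ[ℝ] ℝ)) (c : Fin m → ℝ)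
    (hh : ∀ j, h j ≠ 0) :
    RingTheory.Sequence.IsRegular
      (MvPolynomial (Fin m ⊕ Fin m) k ⧸ alexanderDual k (orientedMatroidIdeal k m n h c))
      (List.ofFn fun i : Fin m => (X (Sum.inl i) - X (Sum.inr i) :
        MvPolynomial (Fin m ⊕ Fin m) k)) := by
  rw [RingTheory.Sequence.isRegular_iff, RingTheory.Sequence.isWeaklyRegular_iff]
  constructor
  · intro i hi
    have him : i < m := by simpa using hi
    rw [isSMulRegular_quotient_iff_mem_of_smul_mem]
    intro x hx
    obtain ⟨f, rfl⟩ := Ideal.Quotient.mk_surjective x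
    rw [omi_mem_smul]
    refine omi_step k m n h c ⟨i, him⟩ _ ?_ f ?_
    · unfold Ideal.ofList
      congr 1
      ext p
      simp only [Set.mem_ofPred_eq, List.mem_take_iff_getElem, List.getElem_ofFn, List.length_ofFn]
      constructor
      · rintro ⟨j, hj, rfl⟩
        exact ⟨⟨j, by omega⟩, by simp [Fin.lt_def]; omega, rfl⟩
      · rintro ⟨j, hj, rfl⟩
        exact ⟨j, by simp [Fin.lt_def] at hj; omega, rfl⟩
    · rw [← omi_mem_smul]
      rw [List.getElem_ofFn] at hx
      exact hx
  · intro htop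
    have h1 : (Ideal.Quotient.mk (alexanderDual k (orientedMatroidIdeal k m n h c)) 1) ∈
      (Ideal.ofList (List.ofFn fun i : Fin m => (X (Sum.inl i) - X (Sum.inr i) :
        MvPolynomial (Fin m ⊕ Fin m) k)) • ⊤ : Submodule (MvPolynomial (Fin m ⊕ Fin m) k) _) := by
      rw [← htop]; trivial
    rw [omi_mem_smul, omi_dual] at h1
    have hle : Ideal.ofList (List.ofFn fun i : Fin m => (X (Sum.inl i) - X (Sum.inr i) :
        MvPolynomial (Fin m ⊕ Fin m) k)) ⊔
        Ideal.span {p | ∃ σ, p = ∏ a ∈ σ, X a ∧ omiCov h c σ} ≤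
        RingHom.ker (constantCoeff : MvPolynomial (Fin m ⊕ Fin m) k →+* k) := by
      unfold Ideal.ofList
      rw [sup_le_iff, Ideal.span_le, Ideal.span_le]
      constructor
      · intro p hp
        simp only [Set.mem_ofPred_eq, List.mem_ofFn] at hp
        obtain ⟨j, rfl⟩ := hp
        simp [RingHom.mem_ker]
      · rintro _ ⟨σ, rfl, hσ⟩
        obtain ⟨j, hj⟩ := hσ 0
        obtain ⟨a, ha⟩ : ∃ a, a ∈ σ := by
          rcases hj with hj | hj
          · exact ⟨_, hj.1⟩
          · exact ⟨_, hj.1⟩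
        simp only [SetLike.mem_coe, RingHom.mem_ker, map_prod, constantCoeff_X]
        exact Finset.prod_eq_zero ha rfl
    have := hle h1
    simp [RingHom.mem_ker] at this


end
end

section
/- Let A = {H₁,…,H_m} be an oriented affine hyperplane arrangement in ℝ^{n−1}, let O ⊂ S = k[x₁,…,x_m,y₁,…,y_m] be its oriented matroid ideal and Ō ⊂ R = k[x₁,…,x_m] the ideal obtained by identifying y_i with x_i. Then the ℤ-graded (and multigraded) Betti numbers of the Alexander duals O^∨ and Ō^∨ coincide. -/
/-!
STATEMENT 6: The ℤ-graded and multigraded Betti numbers of the Alexander duals `O^∨`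
(of the oriented matroid ideal, in `k[x,y]`) and `Ō^∨` (in `k[x]`) coincide.
-/

open MvPolynomial

noncomputable section

open scoped Classical

/-- The ideal `Ō ⊆ k[x]`, obtained from `O` by identifying `y_i` with `x_i`. -/
def arrangementIdeal (k : Type) [Field k] (m n : ℕ)
    (h : Fin m → ((Fin n → ℝ) →ₗ[ℝ] ℝ)) (c : Fin m → ℝ) :
    Ideal (MvPolynomial (Fin m) k) :=
  Ideal.span {p | ∃ v : Fin n → ℝ,
    p = ∏ i ∈ Finset.univ.filter (fun i => h i v ≠ c i), X i}

/-- A minimal multigraded free resolution of an ideal `I ⊆ S = k[x_i : i ∈ σ]`. -/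
structure MinFreeRes (k : Type) [Field k] (σ : Type) [Fintype σ]
    (I : Ideal (MvPolynomial σ k)) where
  F : ℕ → Type
  finite : ∀ i, Finite (F i)
  deg : (i : ℕ) → F i → (σ →₀ ℕ)
  eps : (F 0 →₀ MvPolynomial σ k) →ₗ[MvPolynomial σ k] MvPolynomial σ k
  d : (i : ℕ) →
    ((F (i + 1) →₀ MvPolynomial σ k) →ₗ[MvPolynomial σ k] (F i →₀ MvPolynomial σ k))
  eps_graded : ∀ g : F 0, ∃ a : k, eps (Finsupp.single g 1) = monomial (deg 0 g) a
  d_graded : ∀ (i : ℕ) (g : F (i + 1)) (g' : F i),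
    (deg i g' ≤ deg (i + 1) g ∧
      ∃ a : k, (d i (Finsupp.single g 1)) g' = monomial (deg (i + 1) g - deg i g') a) ∨
    (d i (Finsupp.single g 1)) g' = 0
  range_eps : LinearMap.range eps = I
  exact_eps : LinearMap.ker eps = LinearMap.range (d 0)
  exact_d : ∀ i : ℕ, LinearMap.ker (d i) = LinearMap.range (d (i + 1))
  minimal : ∀ (i : ℕ) (g : F (i + 1)) (g' : F i),
    constantCoeff ((d i (Finsupp.single g 1)) g') = 0

/-- Identify multidegrees in `k[x,y]` with multidegrees in `k[x]` via `y_i ↦ x_i`. -/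
def collapseDeg (m : ℕ) (b : (Fin m ⊕ Fin m) →₀ ℕ) : Fin m →₀ ℕ :=
  Finsupp.equivFunOnFinite.symm (fun i => b (Sum.inl i) + b (Sum.inr i))

/-! ### Filtered resolutions over the field -/

/-- Vectors supported on generators whose degree lies in `D`. -/
abbrev WW (k : Type) [Field k] {P G : Type} (deg : G → P) (D : Set P) : Submodule k (G →₀ k) :=
  Finsupp.supported k k (deg ⁻¹' D)

/-- The scalar form of a minimal multigraded resolution. -/
structure FRes (k : Type) [Field k] (P : Type) [PartialOrder P] (U : P → Prop) where
  F : ℕ → Type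
  fin : ∀ i, Finite (F i)
  deg : (i : ℕ) → F i → P
  eps : (F 0 →₀ k) →ₗ[k] k
  d : (i : ℕ) → (F (i + 1) →₀ k) →ₗ[k] (F i →₀ k)
  eps_U : ∀ g, eps (Finsupp.single g 1) ≠ 0 → U (deg 0 g)
  eps_surj : ∀ b, U b → ∃ w ∈ WW k (deg 0) (Set.Iic b), eps w = 1
  eps_d : ∀ z, eps (d 0 z) = 0
  d_d : ∀ i z, d i (d (i + 1) z) = 0
  ex0 : ∀ b, ∀ z ∈ WW k (deg 0) (Set.Iic b), eps z = 0 →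
    ∃ w ∈ WW k (deg 1) (Set.Iic b), d 0 w = z
  ex : ∀ i b, ∀ z ∈ WW k (deg (i + 1)) (Set.Iic b), d i z = 0 →
    ∃ w ∈ WW k (deg (i + 2)) (Set.Iic b), d (i + 1) w = z
  min : ∀ i g g', d i (Finsupp.single g 1) g' ≠ 0 → deg i g' < deg (i + 1) g

lemma mem_WW {k : Type} [Field k] {P G : Type} {deg : G → P} {D : Set P} {z : G →₀ k} :
    z ∈ WW k deg D ↔ ∀ g, z g ≠ 0 → deg g ∈ D := by
  rw [Finsupp.mem_supported']
  constructor
  · intro h g hg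
    by_contra hD
    exact hg (h g hD)
  · intro h g hg
    by_contra hD
    exact hg (h g hD)

lemma single_mem_WW {k : Type} [Field k] {P G : Type} {deg : G → P} {D : Set P} (g : G) (c : k)
    (hg : deg g ∈ D) : Finsupp.single g c ∈ WW k deg D :=
  Finsupp.single_mem_supported k c hg

/-- A linear map which maps generators appropriately maps the supported vectors. -/
lemma map_WW {k : Type} [Field k] {P G H : Type} {deg : G → P} {deg' : H → P} {D D' : Set P}
    (f : (G →₀ k) →ₗ[k] (H →₀ k))
    (hf : ∀ g, deg g ∈ D → f (Finsupp.single g 1) ∈ WW k deg' D') {z : G →₀ k}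
    (hz : z ∈ WW k deg D) : f z ∈ WW k deg' D' := by
  have : WW k deg D ≤ (WW k deg' D').comap f := by
    unfold WW
    rw [Finsupp.supported_eq_span_single, Submodule.span_le]
    rintro _ ⟨g, hg, rfl⟩
    exact hf g hg
  exact this hz

/-- Filtered maps. -/
def Filt {k : Type} [Field k] {P : Type} [PartialOrder P] {G H : Type} (deg : G → P)
    (deg' : H → P) (f : (G →₀ k) →ₗ[k] (H →₀ k)) : Prop :=
  ∀ g, f (Finsupp.single g 1) ∈ WW k deg' (Set.Iic (deg g))

lemma Filt.map {k : Type} [Field k] {P : Type} [PartialOrder P] {G H : Type} {deg : G → P}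
    {deg' : H → P} {f : (G →₀ k) →ₗ[k] (H →₀ k)} (hf : Filt deg deg' f) {D : Set P}
    (hD : IsLowerSet D) {z : G →₀ k} (hz : z ∈ WW k deg D) : f z ∈ WW k deg' D := by
  refine map_WW f (fun g hg => ?_) hz
  refine mem_WW.2 fun g' h' => hD (mem_WW.1 (hf g) g' h') hg

lemma FRes.filt_d {k : Type} [Field k] {P : Type} [PartialOrder P] {U : P → Prop}
    (C : FRes k P U) (i : ℕ) : Filt (C.deg (i + 1)) (C.deg i) (C.d i) :=
  fun g => mem_WW.2 fun g' h' => (C.min i g g' h').le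

/-- Construct a filtered map from choices on generators. -/
lemma exists_filt {k : Type} [Field k] {P : Type} [PartialOrder P] {G H : Type} {deg : G → P}
    {deg' : H → P} {M : Type} [AddCommGroup M] [Module k M]
    (q : (H →₀ k) →ₗ[k] M) (r : (G →₀ k) →ₗ[k] M)
    (hx : ∀ g, ∃ w ∈ WW k deg' (Set.Iic (deg g)), q w = r (Finsupp.single g 1)) :
    ∃ f : (G →₀ k) →ₗ[k] (H →₀ k), Filt deg deg' f ∧ ∀ z, q (f z) = r z := by
  choose w hw hq using hx
  refine ⟨Finsupp.linearCombination k w, fun g => ?_, fun z => ?_⟩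
  · simpa using hw g
  · have : q ∘ₗ Finsupp.linearCombination k w = r := by
      apply Finsupp.lhom_ext'
      intro g
      ext
      simp [hq]
    exact LinearMap.congr_fun this z

/-- The cycles. -/
def FRes.K {k : Type} [Field k] {P : Type} [PartialOrder P] {U : P → Prop}
    (C : FRes k P U) : (i : ℕ) → Submodule k (C.F i →₀ k)
  | 0 => LinearMap.ker C.eps
  | (i + 1) => LinearMap.ker (C.d i)

lemma FRes.d_mem_K {k : Type} [Field k] {P : Type} [PartialOrder P] {U : P → Prop}
    (C : FRes k P U) (i : ℕ) (z : C.F (i + 1) →₀ k) : C.d i z ∈ C.K i := by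
  cases i with
  | zero => exact C.eps_d z
  | succ i => exact C.d_d i z

lemma FRes.exK {k : Type} [Field k] {P : Type} [PartialOrder P] {U : P → Prop}
    (C : FRes k P U) (i : ℕ) (b : P) (z : C.F i →₀ k) (hz : z ∈ WW k (C.deg i) (Set.Iic b))
    (hK : z ∈ C.K i) : ∃ w ∈ WW k (C.deg (i + 1)) (Set.Iic b), C.d i w = z := by
  cases i with
  | zero => exact C.ex0 b z hz hK
  | succ i => exact C.ex i b z hz hK

/-- Comparison maps exist. -/
lemma FRes.comparison {k : Type} [Field k] {P : Type} [PartialOrder P] {U : P → Prop}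
    (C C' : FRes k P U) :
    ∃ α : ∀ i, (C.F i →₀ k) →ₗ[k] (C'.F i →₀ k),
      (∀ i, Filt (C.deg i) (C'.deg i) (α i)) ∧ (∀ z, C'.eps (α 0 z) = C.eps z) ∧
      ∀ i z, C'.d i (α (i + 1) z) = α i (C.d i z) := by
  have h0 : ∃ f : (C.F 0 →₀ k) →ₗ[k] (C'.F 0 →₀ k), Filt (C.deg 0) (C'.deg 0) f ∧
      ∀ z, C'.eps (f z) = C.eps z := by
    apply exists_filt
    intro g
    by_cases hg : C.eps (Finsupp.single g 1) = 0
    · exact ⟨0, Submodule.zero_mem _, by simp [hg]⟩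
    · obtain ⟨w, hw, h1⟩ := C'.eps_surj _ (C.eps_U g hg)
      exact ⟨C.eps (Finsupp.single g 1) • w, Submodule.smul_mem _ _ hw, by simp [h1]⟩
  let T : ℕ → Type := fun i => {f : (C.F i →₀ k) →ₗ[k] (C'.F i →₀ k) //
    Filt (C.deg i) (C'.deg i) f ∧ ∀ z ∈ C.K i, f z ∈ C'.K i}
  have hs : ∀ i (f : T i), ∃ f' : T (i + 1), ∀ z, C'.d i (f'.1 z) = f.1 (C.d i z) := by
    rintro i ⟨f, hf, hK⟩
    obtain ⟨f', hf', he⟩ := exists_filt (deg := C.deg (i + 1)) (deg' := C'.deg (i + 1))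
      (C'.d i) (f ∘ₗ C.d i) (fun g => by
        refine C'.exK i _ _ ?_ (hK _ (C.d_mem_K i _))
        exact hf.map (isLowerSet_Iic _) (C.filt_d i g))
    refine ⟨⟨f', hf', fun z hz => ?_⟩, he⟩
    have hz' : C.d i z = 0 := hz
    have := he z
    simp only [LinearMap.comp_apply, hz', map_zero] at this
    exact this
  choose nxt hnxt using hs
  obtain ⟨f0, hf0, he0⟩ := h0
  let s : ∀ i, T i := fun i => Nat.rec (motive := T) ⟨f0, hf0, fun z hz => by
    have hz' : C.eps z = 0 := hz
    show C'.eps (f0 z) = 0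
    rw [he0, hz']⟩ (fun i f => nxt i f) i
  exact ⟨fun i => (s i).1, fun i => (s i).2.1, he0, fun i z => hnxt i (s i) z⟩

/-- A filtered self map lifting zero has no diagonal terms. -/
lemma FRes.null {k : Type} [Field k] {P : Type} [PartialOrder P] {U : P → Prop}
    (C : FRes k P U) (γ : ∀ i, (C.F i →₀ k) →ₗ[k] (C.F i →₀ k))
    (hγ : ∀ i, Filt (C.deg i) (C.deg i) (γ i)) (h0 : ∀ z, C.eps (γ 0 z) = 0)
    (hd : ∀ i z, C.d i (γ (i + 1) z) = γ i (C.d i z)) (i : ℕ) :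
    (∀ g g', C.deg i g = C.deg i g' → γ i (Finsupp.single g 1) g' = 0) ∧
    ∃ s : (C.F i →₀ k) →ₗ[k] (C.F (i + 1) →₀ k), Filt (C.deg i) (C.deg (i + 1)) s ∧
      ∀ z, γ i (C.d i z) = C.d i (s (C.d i z)) := by
  have key : ∀ i (s : (C.F i →₀ k) →ₗ[k] (C.F (i + 1) →₀ k)),
      Filt (C.deg i) (C.deg (i + 1)) s →
      ∀ g g', C.deg i g = C.deg i g' → C.d i (s (Finsupp.single g 1)) g' = 0 := by
    intro i s hs g g' e
    have : C.d i (s (Finsupp.single g 1)) ∈ WW k (C.deg i) (Set.Iio (C.deg i g)) := by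
      refine map_WW _ (fun g1 hg1 => mem_WW.2 fun g2 h2 => ?_) (hs g)
      exact (C.min i g1 g2 h2).trans_le hg1
    by_contra hne
    have := mem_WW.1 this g' hne
    rw [e] at this
    exact lt_irrefl _ this
  induction i with
  | zero =>
    obtain ⟨s, hs, he⟩ := exists_filt (deg := C.deg 0) (deg' := C.deg 1) (C.d 0) (γ 0)
      (fun g => C.ex0 _ _ (hγ 0 g) (h0 _))
    refine ⟨fun g g' e => ?_, s, hs, fun z => (he _).symm⟩
    rw [← he]
    exact key 0 s hs g g' e
  | succ i ih =>
    obtain ⟨-, s, hs, he⟩ := ih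
    obtain ⟨s', hs', he'⟩ := exists_filt (deg := C.deg (i + 1)) (deg' := C.deg (i + 2))
      (C.d (i + 1)) (γ (i + 1) - s ∘ₗ C.d i) (fun g => by
        refine C.ex i _ _ (Submodule.sub_mem _ (hγ (i + 1) g)
          (hs.map (isLowerSet_Iic _) (C.filt_d i g))) ?_
        simp [hd, he])
    refine ⟨fun g g' e => ?_, s', hs', fun z => ?_⟩
    · have h1 := he' (Finsupp.single g 1)
      have h2 : γ (i + 1) (Finsupp.single g 1) =
          C.d (i + 1) (s' (Finsupp.single g 1)) + s (C.d i (Finsupp.single g 1)) := by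
        rw [h1]; simp
      rw [h2, Finsupp.add_apply, key (i + 1) s' hs' g g' e, zero_add]
      have h3 : s (C.d i (Finsupp.single g 1)) ∈
          WW k (C.deg (i + 1)) (Set.Iio (C.deg (i + 1) g)) :=
        hs.map (isLowerSet_Iio _) (mem_WW.2 fun g2 h2 => C.min i g g2 h2)
      by_contra hne
      have := mem_WW.1 h3 g' hne
      rw [e] at this
      exact lt_irrefl _ this
    · rw [he']
      simp [C.d_d]

/-- the diagonal block computation -/
lemma block_mul {k : Type} [Field k] {P : Type} [PartialOrder P] {G H : Type} [Finite G]
    [Fintype H]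
    (deg : G → P) (deg' : H → P) (f : (G →₀ k) →ₗ[k] (H →₀ k)) (f' : (H →₀ k) →ₗ[k] (G →₀ k))
    (hf : Filt deg deg' f) (hf' : Filt deg' deg f') (a : P)
    (hid : ∀ g g', deg g = deg g' →
      (Finsupp.single g (1 : k) - f' (f (Finsupp.single g 1))) g' = 0) :
    (Matrix.of fun (g : {g // deg g = a}) (h : {h // deg' h = a}) =>
        f (Finsupp.single g.1 1) h.1) *
      (Matrix.of fun (h : {h // deg' h = a}) (g : {g // deg g = a}) =>
        f' (Finsupp.single h.1 1) g.1) = 1 := by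
  ext ⟨g, hg⟩ ⟨g', hg'⟩
  have h1 := hid g g' (hg.trans hg'.symm)
  rw [Finsupp.sub_apply, sub_eq_zero] at h1
  rw [Matrix.mul_apply, Matrix.one_apply]
  have h2 : (Finsupp.single g (1 : k)) g' = if (⟨g, hg⟩ : {g // deg g = a}) = ⟨g', hg'⟩ then 1 else 0 := by
    rw [Finsupp.single_apply]; simp [Subtype.ext_iff]
  rw [← h2, h1]
  have h3 : f (Finsupp.single g 1) = ∑ h : H, Finsupp.single h (f (Finsupp.single g 1) h) := by
    exact (Finsupp.univ_sum_single _).symm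
  have h4 : f' (f (Finsupp.single g 1)) g' =
      ∑ h : H, f (Finsupp.single g 1) h * f' (Finsupp.single h 1) g' := by
    conv_lhs => rw [h3]
    rw [map_sum, Finsupp.finsetSum_apply]
    refine Finset.sum_congr rfl fun h _ => ?_
    rw [← mul_one (f (Finsupp.single g 1) h), ← smul_eq_mul, ← Finsupp.smul_single, map_smul]
    simp
  rw [h4]
  simp only [Matrix.of_apply]
  rw [← Finset.sum_subtype (Finset.univ.filter fun h => deg' h = a) (by simp)
    (fun h => f (Finsupp.single g 1) h * f' (Finsupp.single h 1) g')]
  refine Finset.sum_subset (Finset.subset_univ _) fun h _ hh => ?_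
  by_contra hne
  have ha : deg' h ≤ deg g := mem_WW.1 (hf g) h (left_ne_zero_of_mul hne)
  have hb : deg g' ≤ deg' h := mem_WW.1 (hf' h) g' (right_ne_zero_of_mul hne)
  apply hh
  simp only [Finset.mem_filter, Finset.mem_univ, true_and]
  exact le_antisymm (ha.trans hg.le) (hg'.ge.trans hb)

lemma FRes.card_eq {k : Type} [Field k] {P : Type} [PartialOrder P] {U : P → Prop}
    (C C' : FRes k P U) (i : ℕ) (a : P) :
    Nat.card {g : C.F i // C.deg i g = a} = Nat.card {g : C'.F i // C'.deg i g = a} := by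
  have := C.fin i
  have := C'.fin i
  let _ := Fintype.ofFinite (C.F i)
  let _ := Fintype.ofFinite (C'.F i)
  obtain ⟨α, hα, hα0, hαd⟩ := C.comparison C'
  obtain ⟨β, hβ, hβ0, hβd⟩ := C'.comparison C
  have aux : ∀ (C C' : FRes k P U) (α : ∀ i, (C.F i →₀ k) →ₗ[k] (C'.F i →₀ k))
      (β : ∀ i, (C'.F i →₀ k) →ₗ[k] (C.F i →₀ k)),
      (∀ i, Filt (C.deg i) (C'.deg i) (α i)) → (∀ z, C'.eps (α 0 z) = C.eps z) →
      (∀ i z, C'.d i (α (i + 1) z) = α i (C.d i z)) →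
      (∀ i, Filt (C'.deg i) (C.deg i) (β i)) → (∀ z, C.eps (β 0 z) = C'.eps z) →
      (∀ i z, C.d i (β (i + 1) z) = β i (C'.d i z)) → ∀ g g', C.deg i g = C.deg i g' →
      (Finsupp.single g (1 : k) - β i (α i (Finsupp.single g 1))) g' = 0 := by
    intro C C' α β hα hα0 hαd hβ hβ0 hβd
    refine (C.null (fun i => LinearMap.id - β i ∘ₗ α i) ?_ ?_ ?_ i).1
    · intro i g
      exact Submodule.sub_mem _ (single_mem_WW _ _ le_rfl)
        ((hβ i).map (isLowerSet_Iic _) (hα i g))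
    · intro z; simp [hα0, hβ0]
    · intro i z; simp [hαd, hβd]
  have h1 := block_mul _ _ _ _ (hα i) (hβ i) a (aux C C' α β hα hα0 hαd hβ hβ0 hβd)
  have h2 := block_mul _ _ _ _ (hβ i) (hα i) a (aux C' C β α hβ hβ0 hβd hα hα0 hαd)
  rw [Nat.card_eq_fintype_card, Nat.card_eq_fintype_card]
  exact Matrix.square_of_invertible _ _ h1 h2

/-! ### From polynomial resolutions to scalar ones -/

section conv
variable {k : Type} [Field k] {σ G H : Type}

/-- The degree `b` component of a vector over the polynomial ring. -/
def lam [Finite G] (deg : G → (σ →₀ ℕ)) (b : σ →₀ ℕ) :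
    (G →₀ MvPolynomial σ k) →ₗ[k] (G →₀ k) where
  toFun u := Finsupp.equivFunOnFinite.symm fun g => if deg g ≤ b then coeff (b - deg g) (u g) else 0
  map_add' u v := by
    ext g
    by_cases h : deg g ≤ b <;> simp [h]
  map_smul' c v := by
    ext g
    by_cases h : deg g ≤ b <;> simp [h]

lemma lam_apply [Finite G] (deg : G → (σ →₀ ℕ)) (b : σ →₀ ℕ) (u : G →₀ MvPolynomial σ k) (g : G) :
    lam deg b u g = if deg g ≤ b then coeff (b - deg g) (u g) else 0 := rfl

lemma lam_mem [Finite G] (deg : G → (σ →₀ ℕ)) (b : σ →₀ ℕ) (u : G →₀ MvPolynomial σ k) :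
    lam deg b u ∈ WW k deg (Set.Iic b) := by
  refine mem_WW.2 fun g hg => ?_
  by_contra h
  exact hg (by rw [lam_apply]; exact if_neg h)

lemma lam_single [Finite G] (deg : G → (σ →₀ ℕ)) (b : σ →₀ ℕ) (g : G) (e : σ →₀ ℕ) (c : k) :
    lam deg b (Finsupp.single g (monomial e c)) =
      if e + deg g = b then Finsupp.single g c else 0 := by
  ext g'
  rw [lam_apply]
  by_cases hg : g = g'
  · subst hg
    rw [Finsupp.single_eq_same, coeff_monomial]
    by_cases h : e + deg g = b
    · have h1 : deg g ≤ b := h ▸ le_add_self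
      have h2 : e = b - deg g := by rw [← h]; simp
      rw [if_pos h, if_pos h1, if_pos h2]; simp
    · rw [if_neg h]
      by_cases h1 : deg g ≤ b
      · rw [if_pos h1, if_neg]
        · simp
        · rintro rfl
          exact h (tsub_add_cancel_of_le h1)
      · rw [if_neg h1]; simp
  · have : (Finsupp.single g (monomial e c)) g' = (0 : MvPolynomial σ k) := by
      simp [Finsupp.single_apply, hg]
    rw [this]
    split_ifs <;> simp [Finsupp.single_apply, hg]

/-- `u ↦` the polynomial vector of degree `b` with given coefficients -/
def kap (deg : G → (σ →₀ ℕ)) (b : σ →₀ ℕ) : (G →₀ k) →ₗ[k] (G →₀ MvPolynomial σ k) :=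
  Finsupp.linearCombination k
    (fun g => if deg g ≤ b then Finsupp.single g (monomial (b - deg g) (1 : k)) else 0)

lemma kap_apply (deg : G → (σ →₀ ℕ)) (b : σ →₀ ℕ) (z : G →₀ k) (g : G) :
    kap deg b z g = if deg g ≤ b then monomial (b - deg g) (z g) else 0 := by
  induction z using Finsupp.induction_linear with
  | zero => simp
  | add u v hu hv => 
    rw [map_add, Finsupp.add_apply, hu, hv]
    split_ifs <;> simp
  | single g' c =>
    simp only [kap, Finsupp.linearCombination_single]
    by_cases hg : g' = g
    · subst hg
      split_ifs <;> simp [smul_monomial]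
    · by_cases h1 : deg g' ≤ b <;> by_cases h2 : deg g ≤ b <;>
        simp [h1, h2, Finsupp.single_apply, hg]

lemma lam_kap [Finite G] (deg : G → (σ →₀ ℕ)) (b : σ →₀ ℕ) {z : G →₀ k}
    (hz : z ∈ WW k deg (Set.Iic b)) : lam deg b (kap deg b z) = z := by
  ext g
  rw [lam_apply, kap_apply]
  by_cases h : deg g ≤ b
  · simp [h]
  · rw [if_neg h]
    by_contra hne
    exact h (mem_WW.1 hz g (Ne.symm hne))

/-- induction over monomial vectors -/
lemma vec_ext {M : Type} [AddCommGroup M] [Module k M]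
    (f f' : (G →₀ MvPolynomial σ k) →ₗ[k] M)
    (h : ∀ g e c, f (Finsupp.single g (monomial e c)) = f' (Finsupp.single g (monomial e c))) :
    f = f' := by
  apply Finsupp.lhom_ext'
  intro g
  refine LinearMap.ext fun p => ?_
  simp only [LinearMap.comp_apply, Finsupp.lsingle_apply]
  induction p using MvPolynomial.induction_on' with
  | monomial e c => exact h g e c
  | add p q hp hq => rw [Finsupp.single_add, map_add, map_add, hp, hq]

lemma single_mon (g : G) (e : σ →₀ ℕ) (c : k) : Finsupp.single g (monomial e c) =
    (monomial e c : MvPolynomial σ k) • Finsupp.single g (1 : MvPolynomial σ k) := by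
  simp

/-- gradedness of a polynomial matrix -/
def Gr (deg : G → (σ →₀ ℕ)) (deg' : H → (σ →₀ ℕ))
    (f : (G →₀ MvPolynomial σ k) →ₗ[MvPolynomial σ k] (H →₀ MvPolynomial σ k)) : Prop :=
  ∀ g g', (deg' g' ≤ deg g ∧
      ∃ a : k, (f (Finsupp.single g 1)) g' = monomial (deg g - deg' g') a) ∨
    (f (Finsupp.single g 1)) g' = 0

/-- scalar matrix -/
def sc [Finite H] (deg : G → (σ →₀ ℕ)) (deg' : H → (σ →₀ ℕ))
    (f : (G →₀ MvPolynomial σ k) →ₗ[MvPolynomial σ k] (H →₀ MvPolynomial σ k)) :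
    (G →₀ k) →ₗ[k] (H →₀ k) :=
  Finsupp.linearCombination k (fun g => lam deg' (deg g) (f (Finsupp.single g 1)))

lemma lam_map [Finite G] [Finite H] {deg : G → (σ →₀ ℕ)} {deg' : H → (σ →₀ ℕ)}
    {f : (G →₀ MvPolynomial σ k) →ₗ[MvPolynomial σ k] (H →₀ MvPolynomial σ k)}
    (hf : Gr deg deg' f) (b : σ →₀ ℕ) (u : G →₀ MvPolynomial σ k) :
    lam deg' b (f u) = sc deg deg' f (lam deg b u) := by
  have : lam deg' b ∘ₗ f.restrictScalars k = sc deg deg' f ∘ₗ lam deg b := by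
    apply vec_ext
    intro g e c
    simp only [LinearMap.comp_apply, LinearMap.restrictScalars_apply]
    rw [lam_single, single_mon, map_smul]
    ext g'
    rw [lam_apply, Finsupp.smul_apply]
    by_cases h : e + deg g = b
    · rw [if_pos h, sc, Finsupp.linearCombination_single, Finsupp.smul_apply, lam_apply]
      rcases hf g g' with ⟨hle, a, ha⟩ | h0
      · have h1 : deg' g' ≤ b := hle.trans (h ▸ le_add_self)
        rw [if_pos h1, if_pos hle, ha, smul_eq_mul, monomial_mul, coeff_monomial, coeff_monomial,
          if_pos, if_pos rfl, smul_eq_mul]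
        rw [← h, add_tsub_assoc_of_le hle]
      · rw [h0]; simp
    · rw [if_neg h, map_zero, Finsupp.zero_apply]
      rcases hf g g' with ⟨hle, a, ha⟩ | h0
      · split_ifs with h1
        · rw [ha, smul_eq_mul, monomial_mul, coeff_monomial, if_neg]
          intro h2
          rw [← add_tsub_assoc_of_le hle] at h2
          apply h
          have h3 := congrArg (· + deg' g') h2
          beta_reduce at h3
          rwa [tsub_add_cancel_of_le h1, tsub_add_cancel_of_le (hle.trans le_add_self)] at h3
        · rfl
      · rw [h0]; simp
  exact LinearMap.congr_fun this u

lemma map_kap [Finite H] {deg : G → (σ →₀ ℕ)} {deg' : H → (σ →₀ ℕ)}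
    {f : (G →₀ MvPolynomial σ k) →ₗ[MvPolynomial σ k] (H →₀ MvPolynomial σ k)}
    (hf : Gr deg deg' f) (b : σ →₀ ℕ) {z : G →₀ k} (hz : z ∈ WW k deg (Set.Iic b)) :
    f (kap deg b z) = kap deg' b (sc deg deg' f z) := by
  have : WW k deg (Set.Iic b) ≤ LinearMap.eqLocus (f.restrictScalars k ∘ₗ kap deg b)
      (kap deg' b ∘ₗ sc deg deg' f) := by
    unfold WW
    rw [Finsupp.supported_eq_span_single, Submodule.span_le]
    rintro _ ⟨g, hg, rfl⟩
    have hg' : deg g ≤ b := hg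
    simp only [SetLike.mem_coe, LinearMap.mem_eqLocus, LinearMap.comp_apply,
      LinearMap.restrictScalars_apply]
    ext1 g'
    rw [kap_apply, sc, kap, Finsupp.linearCombination_single, one_smul, if_pos hg', single_mon,
      map_smul, Finsupp.smul_apply, Finsupp.linearCombination_single, one_smul, lam_apply]
    rcases hf g g' with ⟨hle, a, ha⟩ | h0
    · rw [if_pos (hle.trans hg'), if_pos hle, ha, smul_eq_mul, monomial_mul, coeff_monomial,
        if_pos rfl, one_mul, tsub_add_tsub_cancel hg' hle]
    · rw [h0]; simp
  exact this hz

/-- scalar augmentation -/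
def sce (deg : G → (σ →₀ ℕ))
    (f : (G →₀ MvPolynomial σ k) →ₗ[MvPolynomial σ k] MvPolynomial σ k) :
    (G →₀ k) →ₗ[k] k :=
  Finsupp.linearCombination k (fun g => coeff (deg g) (f (Finsupp.single g 1)))

lemma coeff_map [Finite G] {deg : G → (σ →₀ ℕ)}
    {f : (G →₀ MvPolynomial σ k) →ₗ[MvPolynomial σ k] MvPolynomial σ k}
    (hf : ∀ g, ∃ a : k, f (Finsupp.single g 1) = monomial (deg g) a) (b : σ →₀ ℕ)
    (u : G →₀ MvPolynomial σ k) :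
    coeff b (f u) = sce deg f (lam deg b u) := by
  have : lcoeff k b ∘ₗ f.restrictScalars k = sce deg f ∘ₗ lam deg b := by
    apply vec_ext
    intro g e c
    simp only [LinearMap.comp_apply, LinearMap.restrictScalars_apply]
    rw [lam_single, single_mon, map_smul]
    obtain ⟨a, ha⟩ := hf g
    rw [ha, lcoeff_apply, smul_eq_mul, monomial_mul, coeff_monomial]
    split_ifs with h
    · simp [sce, ha]
    · simp
  exact LinearMap.congr_fun this u

lemma map_kap_eps {deg : G → (σ →₀ ℕ)}
    {f : (G →₀ MvPolynomial σ k) →ₗ[MvPolynomial σ k] MvPolynomial σ k}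
    (hf : ∀ g, ∃ a : k, f (Finsupp.single g 1) = monomial (deg g) a) (b : σ →₀ ℕ) {z : G →₀ k}
    (hz : z ∈ WW k deg (Set.Iic b)) :
    f (kap deg b z) = monomial b (sce deg f z) := by
  have : WW k deg (Set.Iic b) ≤ LinearMap.eqLocus (f.restrictScalars k ∘ₗ kap deg b)
      (monomial b ∘ₗ sce deg f) := by
    unfold WW
    rw [Finsupp.supported_eq_span_single, Submodule.span_le]
    rintro _ ⟨g, hg, rfl⟩
    have hg' : deg g ≤ b := hg
    simp only [SetLike.mem_coe, LinearMap.mem_eqLocus, LinearMap.comp_apply,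
      LinearMap.restrictScalars_apply]
    obtain ⟨a, ha⟩ := hf g
    rw [sce, kap, Finsupp.linearCombination_single, one_smul, if_pos hg', single_mon,
      map_smul, Finsupp.linearCombination_single, one_smul, ha, smul_eq_mul, monomial_mul,
      coeff_monomial, if_pos rfl, one_mul, tsub_add_cancel_of_le hg']
  exact this hz

/-- every generator is the component of the corresponding polynomial generator -/
lemma ext_single {M : Type} [AddCommGroup M] [Module k M]
    (f : (G →₀ k) →ₗ[k] M) (h : ∀ g, f (Finsupp.single g 1) = 0) (z) : f z = 0 := by
  have : f = 0 := by
    apply Finsupp.lhom_ext'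
    intro g
    ext
    simpa using h g
  rw [this]; rfl

lemma lam_gen [Finite G] (deg : G → (σ →₀ ℕ)) (g : G) :
    lam deg (deg g) (Finsupp.single g (1 : MvPolynomial σ k)) = Finsupp.single g 1 := by
  have := lam_single deg (deg g) g 0 (1 : k)
  simpa using this

/-- The scalar resolution. -/
def MinFreeRes.toFRes [Fintype σ] {I : Ideal (MvPolynomial σ k)} (C : MinFreeRes k σ I)
    (U : (σ →₀ ℕ) → Prop) (hU : ∀ b, U b ↔ (monomial b 1 : MvPolynomial σ k) ∈ I) :
    FRes k (σ →₀ ℕ) U :=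
  haveI := C.finite
  { F := C.F
    fin := C.finite
    deg := C.deg
    eps := sce (C.deg 0) C.eps
    d := fun i => sc (C.deg (i + 1)) (C.deg i) (C.d i)
    eps_U := by
      intro g hg
      rw [hU]
      obtain ⟨a, ha⟩ := C.eps_graded g
      have h1 : (monomial (C.deg 0 g) a : MvPolynomial σ k) ∈ I := by
        rw [← ha]
        exact C.range_eps.le ⟨_, rfl⟩
      have ha0 : a ≠ 0 := by
        rintro rfl
        apply hg
        simp [sce, ha]
      have h2 := I.mul_mem_left (MvPolynomial.C a⁻¹) h1
      rwa [C_mul_monomial, inv_mul_cancel₀ ha0] at h2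
    eps_surj := by
      intro b hb
      obtain ⟨u, hu⟩ := C.range_eps.ge ((hU b).1 hb)
      refine ⟨lam (C.deg 0) b u, lam_mem _ _ _, ?_⟩
      rw [← coeff_map C.eps_graded, hu, coeff_monomial, if_pos rfl]
    eps_d := by
      intro z
      refine ext_single (sce (C.deg 0) C.eps ∘ₗ sc (C.deg 1) (C.deg 0) (C.d 0)) (fun g => ?_) z
      have h : C.eps (C.d 0 (Finsupp.single g 1)) = 0 := by
        rw [← LinearMap.mem_ker, C.exact_eps]
        exact ⟨_, rfl⟩
      rw [LinearMap.comp_apply, ← lam_gen (C.deg 1), ← lam_map (C.d_graded 0),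
        ← coeff_map C.eps_graded, h, coeff_zero]
    d_d := by
      intro i z
      refine ext_single (sc (C.deg (i + 1)) (C.deg i) (C.d i) ∘ₗ
        sc (C.deg (i + 2)) (C.deg (i + 1)) (C.d (i + 1))) (fun g => ?_) z
      have h : C.d i (C.d (i + 1) (Finsupp.single g 1)) = 0 := by
        rw [← LinearMap.mem_ker, C.exact_d]
        exact ⟨_, rfl⟩
      rw [LinearMap.comp_apply, ← lam_gen (C.deg (i + 2)), ← lam_map (C.d_graded (i + 1)),
        ← lam_map (C.d_graded i), h, map_zero]
    ex0 := by
      intro b z hz h0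
      have h1 : kap (C.deg 0) b z ∈ LinearMap.ker C.eps := by
        rw [LinearMap.mem_ker, map_kap_eps C.eps_graded b hz, h0, map_zero]
      rw [C.exact_eps] at h1
      obtain ⟨u, hu⟩ := h1
      refine ⟨lam (C.deg 1) b u, lam_mem _ _ _, ?_⟩
      rw [← lam_map (C.d_graded 0), hu, lam_kap _ _ hz]
    ex := by
      intro i b z hz h0
      have h1 : kap (C.deg (i + 1)) b z ∈ LinearMap.ker (C.d i) := by
        rw [LinearMap.mem_ker, map_kap (C.d_graded i) b hz, h0, map_zero]
      rw [C.exact_d] at h1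
      obtain ⟨u, hu⟩ := h1
      refine ⟨lam (C.deg (i + 2)) b u, lam_mem _ _ _, ?_⟩
      rw [← lam_map (C.d_graded (i + 1)), hu, lam_kap _ _ hz]
    min := by
      intro i g g' h
      rw [sc, Finsupp.linearCombination_single, one_smul, lam_apply] at h
      by_cases hle : C.deg i g' ≤ C.deg (i + 1) g
      · refine lt_of_le_of_ne hle fun he => h ?_
        rw [if_pos hle, he, tsub_self]
        exact C.minimal i g g'
      · exact absurd (if_neg hle) h }

end conv

/-! ### Mayer-Vietoris -/

/-- Exactness of the strand attached to a set of degrees. -/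
def FRes.Good {k : Type} [Field k] {P : Type} [PartialOrder P] {U : P → Prop}
    (C : FRes k P U) (D : Set P) : Prop :=
  (∀ i, ∀ z ∈ WW k (C.deg i) D, z ∈ C.K i → ∃ w ∈ WW k (C.deg (i + 1)) D, C.d i w = z) ∧
  ((∃ b ∈ D, U b) → ∃ w ∈ WW k (C.deg 0) D, C.eps w = 1)

lemma FRes.good_Iic {k : Type} [Field k] {P : Type} [PartialOrder P] {U : P → Prop}
    (C : FRes k P U) (b : P) : C.Good (Set.Iic b) := by
  refine ⟨fun i z hz hK => C.exK i b z hz hK, ?_⟩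
  rintro ⟨b', hb', hU⟩
  obtain ⟨w, hw, h1⟩ := C.eps_surj b' hU
  exact ⟨w, mem_WW.2 fun g hg => le_trans (mem_WW.1 hw g hg) hb', h1⟩

lemma WW_mono {k : Type} [Field k] {P G : Type} (deg : G → P) {D D' : Set P} (h : D ⊆ D') :
    WW k deg D ≤ WW k deg D' :=
  fun _ hz => mem_WW.2 fun g hg => h (mem_WW.1 hz g hg)

lemma FRes.eps_meets {k : Type} [Field k] {P : Type} [PartialOrder P] {U : P → Prop}
    (C : FRes k P U) {D : Set P} {z : C.F 0 →₀ k} (hz : z ∈ WW k (C.deg 0) D)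
    (h0 : C.eps z ≠ 0) : ∃ b ∈ D, U b := by
  by_contra hne
  push Not at hne
  apply h0
  have : WW k (C.deg 0) D ≤ LinearMap.ker C.eps := by
    unfold WW
    rw [Finsupp.supported_eq_span_single, Submodule.span_le]
    rintro _ ⟨g, hg, rfl⟩
    by_contra h
    exact hne _ hg (C.eps_U g h)
  exact this hz

lemma FRes.good_union {k : Type} [Field k] {P : Type} [PartialOrder P] {U : P → Prop}
    (C : FRes k P U) {A B : Set P} (lA : IsLowerSet A) (lB : IsLowerSet B)
    (hA : C.Good A) (hB : C.Good B) (hAB : C.Good (A ∩ B))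
    (hU : (∃ b ∈ A, U b) → (∃ b ∈ B, U b) → ∃ b ∈ A ∩ B, U b) : C.Good (A ∪ B) := by
  constructor
  · intro i z hz hK
    have hsup : z ∈ WW k (C.deg i) A ⊔ WW k (C.deg i) B := by
      unfold WW
      rw [← Finsupp.supported_union]
      exact hz
    obtain ⟨zA, hzA, zB, hzB, rfl⟩ := Submodule.mem_sup.1 hsup
    have key : ∃ w ∈ WW k (C.deg i) (A ∩ B), zA - w ∈ C.K i := by
      cases i with
      | zero =>
        have hK' : C.eps (zA + zB) = 0 := hK
        rw [map_add] at hK'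
        by_cases h0 : C.eps zA = 0
        · exact ⟨0, Submodule.zero_mem _, by simpa [FRes.K] using h0⟩
        · have h0' : C.eps zB ≠ 0 := by
            intro h
            rw [h, add_zero] at hK'
            exact h0 hK'
          obtain ⟨w, hw, h1⟩ := hAB.2 (hU (C.eps_meets hzA h0) (C.eps_meets hzB h0'))
          refine ⟨C.eps zA • w, Submodule.smul_mem _ _ hw, ?_⟩
          simp [FRes.K, h1]
      | succ i =>
        have hK' : C.d i (zA + zB) = 0 := hK
        rw [map_add] at hK'
        have h1 : C.d i zA ∈ WW k (C.deg i) A := (C.filt_d i).map lA hzA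
        have h2 : C.d i zA ∈ WW k (C.deg i) B := by
          rw [eq_neg_of_add_eq_zero_left hK']
          exact Submodule.neg_mem _ ((C.filt_d i).map lB hzB)
        obtain ⟨w, hw, hw'⟩ := hAB.1 i (C.d i zA)
          (mem_WW.2 fun g hg => ⟨mem_WW.1 h1 g hg, mem_WW.1 h2 g hg⟩) (C.d_mem_K i zA)
        refine ⟨w, hw, ?_⟩
        simp [FRes.K, hw']
    obtain ⟨w, hw, hwK⟩ := key
    have hwA := WW_mono (C.deg i) Set.inter_subset_left hw
    have hwB := WW_mono (C.deg i) Set.inter_subset_right hw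
    have hwK' : zB + w ∈ C.K i := by
      have := Submodule.sub_mem _ hK hwK
      have e : zA + zB - (zA - w) = zB + w := by abel
      rwa [e] at this
    obtain ⟨u, hu, hu'⟩ := hA.1 i (zA - w) (Submodule.sub_mem _ hzA hwA) hwK
    obtain ⟨u2, hu2, hu2'⟩ := hB.1 i (zB + w) (Submodule.add_mem _ hzB hwB) hwK'
    refine ⟨u + u2, Submodule.add_mem _ (WW_mono _ Set.subset_union_left hu)
      (WW_mono _ Set.subset_union_right hu2), ?_⟩
    rw [map_add, hu', hu2']
    abel
  · rintro ⟨b, hb | hb, hb'⟩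
    · obtain ⟨w, hw, h1⟩ := hA.2 ⟨b, hb, hb'⟩
      exact ⟨w, WW_mono _ Set.subset_union_left hw, h1⟩
    · obtain ⟨w, hw, h1⟩ := hB.2 ⟨b, hb, hb'⟩
      exact ⟨w, WW_mono _ Set.subset_union_right hw, h1⟩

/-! ### Squarefree monomial ideals -/

section sqf
variable {k : Type} [Field k] {ι : Type}

lemma prod_X_eq (τ : Finset ι) : (∏ i ∈ τ, X i : MvPolynomial ι k) =
    monomial (∑ i ∈ τ, Finsupp.single i 1) 1 := by
  rw [monomial_sum_one]
  rfl

lemma ind_le (τ : Finset ι) (e : ι →₀ ℕ) :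
    (∑ i ∈ τ, Finsupp.single i 1) ≤ e ↔ ∀ i ∈ τ, e i ≠ 0 := by
  have hv : ∀ j, (∑ i ∈ τ, Finsupp.single i 1 : ι →₀ ℕ) j = if j ∈ τ then 1 else 0 := by
    intro j
    rw [Finsupp.finsetSum_apply]
    simp [Finsupp.single_apply]
  constructor
  · intro h i hi
    have := h i
    rw [hv, if_pos hi] at this
    omega
  · intro h i
    rw [hv]
    split_ifs with hi
    · have := h i hi
      omega
    · omega

lemma mem_sqf (T : Set (Finset ι)) (e : ι →₀ ℕ) :
    (monomial e 1 : MvPolynomial ι k) ∈ Ideal.span {p | ∃ τ ∈ T, p = ∏ i ∈ τ, X i} ↔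
      ∃ τ ∈ T, ∀ i ∈ τ, e i ≠ 0 := by
  have : {p : MvPolynomial ι k | ∃ τ ∈ T, p = ∏ i ∈ τ, X i} =
      (fun s => monomial s (1 : k)) '' ((fun τ => ∑ i ∈ τ, Finsupp.single i 1) '' T) := by
    ext p
    simp only [Set.mem_setOf_eq, Set.mem_image, exists_exists_and_eq_and, prod_X_eq]
    constructor
    · rintro ⟨τ, h, rfl⟩; exact ⟨τ, h, rfl⟩
    · rintro ⟨τ, h, rfl⟩; exact ⟨τ, h, rfl⟩
  rw [this, mem_ideal_span_monomial_image]
  rw [support_monomial, if_neg one_ne_zero]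
  simp [ind_le]

lemma mem_dual (T : Set (Finset ι)) (I : Ideal (MvPolynomial ι k))
    (hI : I = Ideal.span {p | ∃ τ ∈ T, p = ∏ i ∈ τ, X i}) (e : ι →₀ ℕ) :
    (monomial e 1 : MvPolynomial ι k) ∈ alexanderDual k I ↔ ∀ τ ∈ T, ∃ i ∈ τ, e i ≠ 0 := by
  have hx : ∀ τ : Finset ι, (∏ i ∈ τ, X i : MvPolynomial ι k) ∈ I ↔ ∃ τ' ∈ T, τ' ⊆ τ := by
    intro τ
    rw [hI, prod_X_eq, mem_sqf]
    refine exists_congr fun τ' => and_congr_right fun _ => ?_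
    refine forall₂_congr fun i _ => ?_
    rw [Finsupp.finsetSum_apply]
    simp [Finsupp.single_apply]
  have h2 : alexanderDual k I = Ideal.span {p : MvPolynomial ι k |
      ∃ σ ∈ {σ : Finset ι | ∀ τ : Finset ι, (∏ i ∈ τ, X i : MvPolynomial ι k) ∈ I →
        (σ ∩ τ).Nonempty}, p = ∏ i ∈ σ, X i} := by
    unfold alexanderDual
    congr 1
    ext p
    simp only [Set.mem_setOf_eq]
    exact exists_congr fun σ => and_comm
  rw [h2, mem_sqf]
  constructor
  · rintro ⟨σ, hσ, he⟩ τ hτ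
    obtain ⟨i, hi⟩ := hσ τ ((hx τ).2 ⟨τ, hτ, subset_rfl⟩)
    rw [Finset.mem_inter] at hi
    exact ⟨i, hi.2, he i hi.1⟩
  · intro h
    refine ⟨e.support, fun τ hτ => ?_, fun i hi => Finsupp.mem_support_iff.1 hi⟩
    obtain ⟨τ', hτ', hs⟩ := (hx τ).1 hτ
    obtain ⟨i, hi, hi'⟩ := h τ' hτ'
    exact ⟨i, Finset.mem_inter.2 ⟨Finsupp.mem_support_iff.2 hi', hs hi⟩⟩

end sqf

/-! ### The arrangement -/

section arr
variable {m n : ℕ} (h : Fin m → ((Fin n → ℝ) →ₗ[ℝ] ℝ)) (c : Fin m → ℝ)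

/-- infeasibility for the oriented ideal -/
def UO (e : (Fin m ⊕ Fin m) →₀ ℕ) : Prop :=
  ∀ v : Fin n → ℝ, ∃ j, (c j < h j v ∧ e (Sum.inl j) ≠ 0) ∨ (h j v < c j ∧ e (Sum.inr j) ≠ 0)

/-- infeasibility for the unoriented ideal -/
def UA (a : Fin m →₀ ℕ) : Prop :=
  ∀ v : Fin n → ℝ, ∃ j, h j v ≠ c j ∧ a j ≠ 0

lemma UO_iff (k : Type) [Field k] (e : (Fin m ⊕ Fin m) →₀ ℕ) :
    UO h c e ↔ (monomial e 1 : MvPolynomial _ k) ∈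
      alexanderDual k (orientedMatroidIdeal k m n h c) := by
  rw [mem_dual (Set.range fun v : Fin n → ℝ =>
    (Finset.univ.filter (fun i => c i < h i v)).disjSum
      (Finset.univ.filter (fun i => h i v < c i)))]
  · rw [Set.forall_mem_range]
    refine forall_congr' fun v => ?_
    constructor
    · rintro ⟨j, ⟨h1, h2⟩ | ⟨h1, h2⟩⟩
      · exact ⟨Sum.inl j, by simpa using h1, h2⟩
      · exact ⟨Sum.inr j, by simpa using h1, h2⟩
    · rintro ⟨j | j, h1, h2⟩
      · exact ⟨j, Or.inl ⟨by simpa using h1, h2⟩⟩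
      · exact ⟨j, Or.inr ⟨by simpa using h1, h2⟩⟩
  · unfold orientedMatroidIdeal
    congr 1
    ext p
    simp [Finset.prod_disjSum]

lemma UA_iff (k : Type) [Field k] (a : Fin m →₀ ℕ) :
    UA h c a ↔ (monomial a 1 : MvPolynomial _ k) ∈
      alexanderDual k (arrangementIdeal k m n h c) := by
  rw [mem_dual (Set.range fun v : Fin n → ℝ => Finset.univ.filter (fun i => h i v ≠ c i))]
  · rw [Set.forall_mem_range]
    refine forall_congr' fun v => ?_
    simp
  · unfold arrangementIdeal
    congr 1
    ext p
    simp

/-- The partially collapsed boxes. -/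
def Box (T : Finset (Fin m)) (p q : Fin m → ℕ) : Set ((Fin m ⊕ Fin m) →₀ ℕ) :=
  {e | ∀ j, if j ∈ T then e (Sum.inl j) + e (Sum.inr j) ≤ p j else
    e (Sum.inl j) ≤ p j ∧ e (Sum.inr j) ≤ q j}

/-- Infeasibility of the partially collapsed system. -/
def Inf (T : Finset (Fin m)) (p q : Fin m → ℕ) : Prop :=
  ∀ v : Fin n → ℝ, ∃ j, if j ∈ T then h j v ≠ c j ∧ p j ≠ 0 else
    (c j < h j v ∧ p j ≠ 0) ∨ (h j v < c j ∧ q j ≠ 0)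

lemma Box_lower (T : Finset (Fin m)) (p q : Fin m → ℕ) : IsLowerSet (Box T p q) := by
  intro e e' hle he j
  have h1 := hle (Sum.inl j)
  have h2 := hle (Sum.inr j)
  have := he j
  split_ifs at this ⊢ <;> omega

lemma Inf_of_Box {T : Finset (Fin m)} {p q : Fin m → ℕ} {e} (he : e ∈ Box T p q)
    (hU : UO h c e) : Inf h c T p q := by
  intro v
  obtain ⟨j, hj⟩ := hU v
  refine ⟨j, ?_⟩
  have := he j
  split_ifs at this ⊢
  · rcases hj with ⟨h1, h2⟩ | ⟨h1, h2⟩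
    · exact ⟨h1.ne', by omega⟩
    · exact ⟨h1.ne, by omega⟩
  · rcases hj with ⟨h1, h2⟩ | ⟨h1, h2⟩
    · exact Or.inl ⟨h1, by omega⟩
    · exact Or.inr ⟨h1, by omega⟩

/-- The convexity step. -/
lemma Inf_split {T : Finset (Fin m)} {i : Fin m} (hi : i ∉ T) {p q : Fin m → ℕ}
    (hI : Inf h c (insert i T) p q) :
    Inf h c T p (Function.update q i 0) ∨
      Inf h c T (Function.update p i 0) (Function.update q i (p i)) := by
  by_contra hne
  rw [not_or] at hne
  obtain ⟨h1, h2⟩ := hne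
  unfold Inf at h1 h2
  push Not at h1 h2
  obtain ⟨v1, hv1⟩ := h1
  obtain ⟨v2, hv2⟩ := h2
  by_cases hp : p i = 0
  · obtain ⟨j, hj⟩ := hI v1
    have := hv1 j
    by_cases hji : j = i
    · subst hji
      simp [hp] at hj
    · simp only [Finset.mem_insert, hji, false_or, Function.update_of_ne hji, ne_eq, not_false_eq_true] at hj this
      exact this hj
  have a1 : h i v1 ≤ c i := by
    have := hv1 i
    simp [hi, hp] at this
    exact this
  have a2 : c i ≤ h i v2 := by
    have := hv2 i
    simp [hi, hp] at this
    exact this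
  obtain ⟨s, t, hs, ht, hst, hc⟩ : ∃ s t : ℝ, 0 ≤ s ∧ 0 ≤ t ∧ s + t = 1 ∧
      s * h i v1 + t * h i v2 = c i := by
    by_cases he : h i v1 = h i v2
    · exact ⟨1, 0, by simp, by simp, by simp, by linarith⟩
    · have hpos : 0 < h i v2 - h i v1 := by
        rcases lt_or_eq_of_le (a1.trans a2) with h | h
        · linarith
        · exact absurd h he
      refine ⟨(h i v2 - c i) / (h i v2 - h i v1), (c i - h i v1) / (h i v2 - h i v1),
        div_nonneg (by linarith) hpos.le, div_nonneg (by linarith) hpos.le, ?_, ?_⟩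
      · field_simp; ring
      · field_simp; ring
  obtain ⟨j, hj⟩ := hI (s • v1 + t • v2)
  have hval : ∀ j, h j (s • v1 + t • v2) = s * h j v1 + t * h j v2 := by
    intro j; simp
  rw [hval] at hj
  have b1 := hv1 j
  have b2 := hv2 j
  have hcj : c j = s * c j + t * c j := by rw [← add_mul, hst, one_mul]
  by_cases hji : j = i
  · subst hji
    simp [hc] at hj
  · simp only [Finset.mem_insert, hji, false_or, Function.update_of_ne hji, ne_eq, not_false_eq_true] at hj b1 b2
    by_cases hjT : j ∈ T
    · simp only [hjT, if_true] at hj b1 b2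
      have e1 : h j v1 = c j := by
        by_contra h'; exact b1 ⟨h', hj.2⟩
      have e2 : h j v2 = c j := by
        by_contra h'; exact b2 ⟨h', hj.2⟩
      apply hj.1
      rw [e1, e2]; exact hcj.symm
    · simp only [hjT, if_false] at hj b1 b2
      rw [not_or] at b1 b2
      rcases hj with ⟨k1, k2⟩ | ⟨k1, k2⟩
      · have e1 : h j v1 ≤ c j := by
          by_contra h'; exact b1.1 ⟨not_le.1 h', k2⟩
        have e2 : h j v2 ≤ c j := by
          by_contra h'; exact b2.1 ⟨not_le.1 h', k2⟩
        have := mul_le_mul_of_nonneg_left e1 hs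
        have := mul_le_mul_of_nonneg_left e2 ht
        linarith
      · have e1 : c j ≤ h j v1 := by
          by_contra h'; exact b1.2 ⟨not_le.1 h', k2⟩
        have e2 : c j ≤ h j v2 := by
          by_contra h'; exact b2.2 ⟨not_le.1 h', k2⟩
        have := mul_le_mul_of_nonneg_left e1 hs
        have := mul_le_mul_of_nonneg_left e2 ht
        linarith

lemma Box_insert {T : Finset (Fin m)} {i : Fin m} (hi : i ∉ T) {p q : Fin m → ℕ} {r s : ℕ}
    (hrs : r + s ≤ p i) :
    Box T (Function.update p i r) (Function.update q i s) ⊆ Box (insert i T) p q := by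
  intro e he j
  have := he j
  by_cases hji : j = i
  · subst hji
    simp [hi] at this ⊢
    omega
  · simpa [hji] using this

lemma exists_Box {T : Finset (Fin m)} : ∀ {p q : Fin m → ℕ}, Inf h c T p q →
    ∃ e ∈ Box T p q, UO h c e := by
  induction T using Finset.induction_on with
  | empty =>
    intro p q hI
    refine ⟨Finsupp.equivFunOnFinite.symm (Sum.elim p q), fun j => by simp, fun v => ?_⟩
    obtain ⟨j, hj⟩ := hI v
    exact ⟨j, by simpa using hj⟩
  | insert i T hi ih =>
    intro p q hI
    rcases Inf_split h c hi hI with h1 | h1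
    · obtain ⟨e, he, hU⟩ := ih h1
      refine ⟨e, Box_insert hi (r := p i) (s := 0) (by omega) ?_, hU⟩
      simpa using he
    · obtain ⟨e, he, hU⟩ := ih h1
      exact ⟨e, Box_insert hi (r := 0) (s := p i) (by omega) he, hU⟩

/-- The staircase inside a collapsed box. -/
def Stair (T : Finset (Fin m)) (i : Fin m) (p q : Fin m → ℕ) (N : ℕ) :
    Set ((Fin m ⊕ Fin m) →₀ ℕ) :=
  {e | e ∈ Box (insert i T) p q ∧ e (Sum.inl i) ≤ N}

lemma Stair_zero {T : Finset (Fin m)} {i : Fin m} (hi : i ∉ T) (p q : Fin m → ℕ) :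
    Stair T i p q 0 = Box T (Function.update p i 0) (Function.update q i (p i)) := by
  ext e
  constructor
  · rintro ⟨he, h0⟩ j
    have := he j
    by_cases hji : j = i
    · subst hji
      simp [hi] at this ⊢
      omega
    · simpa [hji] using this
  · intro he
    refine ⟨Box_insert hi (by omega) he, ?_⟩
    have := he i
    simp [hi] at this
    omega

lemma Stair_succ {T : Finset (Fin m)} {i : Fin m} (hi : i ∉ T) (p q : Fin m → ℕ) (N : ℕ)
    (hN : N + 1 ≤ p i) :
    Stair T i p q (N + 1) = Stair T i p q N ∪
      Box T (Function.update p i (N + 1)) (Function.update q i (p i - (N + 1))) := by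
  ext e
  constructor
  · rintro ⟨he, h0⟩
    by_cases h1 : e (Sum.inl i) ≤ N
    · exact Or.inl ⟨he, h1⟩
    · right
      intro j
      have := he j
      by_cases hji : j = i
      · subst hji
        simp [hi] at this ⊢
        omega
      · simpa [hji] using this
  · rintro (⟨he, h0⟩ | he)
    · exact ⟨he, by omega⟩
    · refine ⟨Box_insert hi (by omega) he, ?_⟩
      have := he i
      simp [hi] at this
      omega

lemma Stair_inter {T : Finset (Fin m)} {i : Fin m} (hi : i ∉ T) (p q : Fin m → ℕ) (N : ℕ)
    (hN : N + 1 ≤ p i) :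
    Stair T i p q N ∩
      Box T (Function.update p i (N + 1)) (Function.update q i (p i - (N + 1))) =
    Box T (Function.update p i N) (Function.update q i (p i - (N + 1))) := by
  ext e
  constructor
  · rintro ⟨⟨-, h0⟩, he⟩ j
    have := he j
    by_cases hji : j = i
    · subst hji
      simp [hi] at this ⊢
      omega
    · simpa [hji] using this
  · intro he
    have h2 := he i
    simp [hi] at h2
    refine ⟨⟨Box_insert hi (by omega) he, by omega⟩, fun j => ?_⟩
    have := he j
    by_cases hji : j = i
    · subst hji
      simp [hi] at this ⊢
      omega
    · simpa [hji] using this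

lemma Stair_U {T : Finset (Fin m)} {i : Fin m} (hi : i ∉ T) (p q : Fin m → ℕ) (N : ℕ)
    (hN : N + 1 ≤ p i) (hA : ∃ e ∈ Stair T i p q N, UO h c e)
    (hB : ∃ e ∈ Box T (Function.update p i (N + 1)) (Function.update q i (p i - (N + 1))),
      UO h c e) :
    ∃ e ∈ Box T (Function.update p i N) (Function.update q i (p i - (N + 1))), UO h c e := by
  apply exists_Box
  obtain ⟨e, he, heU⟩ := hA
  obtain ⟨e', he', heU'⟩ := hB
  have hI' := Inf_of_Box h c he' heU'
  have hI : Inf h c T (Function.update p i (e (Sum.inl i)))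
      (Function.update q i (p i - e (Sum.inl i))) := by
    refine Inf_of_Box h c (e := e) (fun j => ?_) heU
    have := he.1 j
    by_cases hji : j = i
    · subst hji
      simp [hi] at this ⊢
      omega
    · simpa [hji] using this
  have hle := he.2
  intro v
  obtain ⟨j, hj⟩ := hI v
  obtain ⟨j', hj'⟩ := hI' v
  by_cases hji : j = i
  · by_cases hji' : j' = i
    · rw [hji] at hj
      rw [hji'] at hj'
      refine ⟨i, ?_⟩
      simp [hi] at hj hj' ⊢
      rcases hj with ⟨u1, u2⟩ | ⟨u1, u2⟩
      · exact Or.inl ⟨u1, by omega⟩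
      · rcases hj' with u3 | ⟨u3, u4⟩
        · linarith
        · exact Or.inr ⟨u1, by omega⟩
    · exact ⟨j', by simpa [hji'] using hj'⟩
  · exact ⟨j, by simpa [hji] using hj⟩

lemma good_Box {k : Type} [Field k] (C : FRes k ((Fin m ⊕ Fin m) →₀ ℕ) (UO h c))
    (T : Finset (Fin m)) : ∀ p q : Fin m → ℕ, C.Good (Box T p q) := by
  induction T using Finset.induction_on with
  | empty =>
    intro p q
    have : Box ∅ p q = Set.Iic (Finsupp.equivFunOnFinite.symm (Sum.elim p q)) := by
      ext e
      simp only [Box, Finset.notMem_empty, if_false, Set.mem_setOf_eq, Set.mem_Iic]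
      constructor
      · rintro he (j | j)
        · exact (he j).1
        · exact (he j).2
      · intro he j
        exact ⟨he (Sum.inl j), he (Sum.inr j)⟩
    rw [this]
    exact C.good_Iic _
  | insert i T hi ih =>
    intro p q
    have hst : ∀ N, N ≤ p i → C.Good (Stair T i p q N) := by
      intro N
      induction N with
      | zero =>
        intro _
        rw [Stair_zero hi]
        exact ih _ _
      | succ N ihN =>
        intro hN
        rw [Stair_succ hi p q N hN]
        apply C.good_union
        · intro e e' hle he
          exact ⟨Box_lower _ _ _ hle he.1, (hle _).trans he.2⟩
        · exact Box_lower _ _ _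
        · exact ihN (by omega)
        · exact ih _ _
        · rw [Stair_inter hi p q N hN]
          exact ih _ _
        · rw [Stair_inter hi p q N hN]
          exact Stair_U h c hi p q N hN
    have : Box (insert i T) p q = Stair T i p q (p i) := by
      ext e
      refine ⟨fun he => ⟨he, ?_⟩, fun he => he.1⟩
      have := he i
      simp at this
      omega
    rw [this]
    exact hst _ le_rfl

lemma collapse_apply (e : (Fin m ⊕ Fin m) →₀ ℕ) (j : Fin m) :
    collapseDeg m e j = e (Sum.inl j) + e (Sum.inr j) := rfl

lemma collapse_lt {e e' : (Fin m ⊕ Fin m) →₀ ℕ} (hlt : e < e') :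
    collapseDeg m e < collapseDeg m e' := by
  refine lt_of_le_of_ne (fun j => ?_) fun heq => hlt.ne ?_
  · rw [collapse_apply, collapse_apply]
    exact add_le_add (hlt.le _) (hlt.le _)
  · have key : ∀ j, e (Sum.inl j) = e' (Sum.inl j) ∧ e (Sum.inr j) = e' (Sum.inr j) := by
      intro j
      have h1 := hlt.le (Sum.inl j)
      have h2 := hlt.le (Sum.inr j)
      have h3 := DFunLike.congr_fun heq j
      rw [collapse_apply, collapse_apply] at h3
      omega
    ext (j | j)
    · exact (key j).1
    · exact (key j).2

lemma Box_univ (a : Fin m →₀ ℕ) :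
    Box Finset.univ a 0 = collapseDeg m ⁻¹' Set.Iic a := by
  ext e
  simp only [Box, Finset.mem_univ, if_true, Set.mem_setOf_eq, Set.mem_preimage, Set.mem_Iic]
  rfl

/-- The collapsed resolution. -/
def FRes.collapse {k : Type} [Field k] (C : FRes k ((Fin m ⊕ Fin m) →₀ ℕ) (UO h c)) :
    FRes k (Fin m →₀ ℕ) (UA h c) where
  F := C.F
  fin := C.fin
  deg := fun i g => collapseDeg m (C.deg i g)
  eps := C.eps
  d := C.d
  eps_U := by
    intro g hg v
    obtain ⟨j, hj⟩ := C.eps_U g hg v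
    refine ⟨j, ?_⟩
    rw [collapse_apply]
    rcases hj with ⟨h1, h2⟩ | ⟨h1, h2⟩
    · exact ⟨h1.ne', by omega⟩
    · exact ⟨h1.ne, by omega⟩
  eps_surj := by
    intro a ha
    have hI : Inf h c Finset.univ a 0 := by
      intro v
      obtain ⟨j, hj⟩ := ha v
      exact ⟨j, by simpa using hj⟩
    have := (good_Box h c C Finset.univ a 0).2 (exists_Box h c hI)
    rw [Box_univ] at this
    exact this
  eps_d := C.eps_d
  d_d := C.d_d
  ex0 := by
    intro a z hz h0
    have := (good_Box h c C Finset.univ a 0).1 0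
    rw [Box_univ] at this
    exact this z hz h0
  ex := by
    intro i a z hz h0
    have := (good_Box h c C Finset.univ a 0).1 (i + 1)
    rw [Box_univ] at this
    exact this z hz h0
  min := fun i g g' hne => collapse_lt (C.min i g g' hne)

end arr

lemma sum_collapseDeg {m : ℕ} (e : (Fin m ⊕ Fin m) →₀ ℕ) :
    (collapseDeg m e).sum (fun _ x => x) = e.sum (fun _ x => x) := by
  rw [Finsupp.sum_fintype _ _ (fun _ => rfl), Finsupp.sum_fintype _ _ (fun _ => rfl),
    Fintype.sum_sum_type, ← Finset.sum_add_distrib]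
  rfl

/-- counting by fibres -/
lemma card_of_fibres {A B Q : Type} [Finite A] [Finite B] (f : A → Q) (g : B → Q)
    (hc : ∀ q, Nat.card {x // f x = q} = Nat.card {x // g x = q}) (S : Q → Prop) :
    Nat.card {x // S (f x)} = Nat.card {x // S (g x)} := by
  have he : ∀ q, Nonempty ({x // f x = q} ≃ {x // g x = q}) :=
    fun q => Finite.card_eq.1 (hc q)
  let E := fun q => (he q).some
  let E' : A ≃ B := (Equiv.sigmaFiberEquiv f).symm.trans
    ((Equiv.sigmaCongrRight E).trans (Equiv.sigmaFiberEquiv g))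
  have hE : ∀ x, g (E' x) = f x := fun x => (E (f x) ⟨x, rfl⟩).2
  exact Nat.card_congr (E'.subtypeEquiv fun x => by rw [hE])

theorem betti_alexanderDual_eq
    (k : Type) [Field k] (m n : ℕ)
    (h : Fin m → ((Fin n → ℝ) →ₗ[ℝ] ℝ)) (c : Fin m → ℝ)
    (hh : ∀ j, h j ≠ 0)
    (Res₁ : MinFreeRes k (Fin m ⊕ Fin m)
      (alexanderDual k (orientedMatroidIdeal k m n h c)))
    (Res₂ : MinFreeRes k (Fin m)
      (alexanderDual k (arrangementIdeal k m n h c))) :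
    (∀ i j : ℕ,
      Nat.card {g : Res₁.F i // (Res₁.deg i g).sum (fun _ x => x) = j} =
      Nat.card {g : Res₂.F i // (Res₂.deg i g).sum (fun _ x => x) = j}) ∧
    (∀ (i : ℕ) (a : Fin m →₀ ℕ),
      Nat.card {g : Res₁.F i // collapseDeg m (Res₁.deg i g) = a} =
      Nat.card {g : Res₂.F i // Res₂.deg i g = a}) := by
  have key : ∀ (i : ℕ) (a : Fin m →₀ ℕ),
      Nat.card {g : Res₁.F i // collapseDeg m (Res₁.deg i g) = a} =
      Nat.card {g : Res₂.F i // Res₂.deg i g = a} := fun i a =>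
    FRes.card_eq (FRes.collapse h c (Res₁.toFRes (UO h c) (UO_iff h c k)))
      (Res₂.toFRes (UA h c) (UA_iff h c k)) i a
  refine ⟨fun i j => ?_, key⟩
  have := Res₁.finite i
  have := Res₂.finite i
  have h1 := card_of_fibres (fun g => collapseDeg m (Res₁.deg i g)) (Res₂.deg i) (key i)
    (fun a => a.sum (fun _ x => x) = j)
  simp only [sum_collapseDeg] at h1
  exact h1

end
end

section
/- Let G be a directed graph with a source q and oriented edge set 𝔼(G), and let Σ_G^q be the Stanley–Reisner complex of the oriented cut ideal C_G^q. Then the facets of Σ_G^q are in bijection with the oriented spanning trees of G: for each oriented spanning tree T, the corresponding facet is τ_T = {y_e : e ∈ 𝔼(G) ∖ O_T}. -/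
/-!
STATEMENT 7: The facets of the Stanley–Reisner complex `Σ_G^q` of the oriented cut
ideal `C_G^q` of a directed graph `G` with source `q` are exactly the complements of
the oriented spanning trees of `G`.
-/

open Finset MvPolynomial

noncomputable section

open scoped Classical

/-- A finite directed multigraph without loops. -/
structure DirGraph (V E : Type) where
  head : E → V
  tail : E → V
  no_loop : ∀ e, head e ≠ tail e

namespace DirGraph

variable {V E : Type} (G : DirGraph V E)

/-- Reachability by a directed path using edges from `T`. -/
def ReachIn (T : Finset E) (u v : V) : Prop :=
  Relation.ReflTransGen (fun a b => ∃ e ∈ T, G.tail e = a ∧ G.head e = b) u v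

variable [Fintype V] [Fintype E]

/-- An oriented spanning tree of `G` (rooted at `q`): `n - 1` edges reaching every
vertex from `q` by directed paths. -/
def IsOrientedSpanningTree (q : V) (T : Finset E) : Prop :=
  T.card = Fintype.card V - 1 ∧ ∀ v : V, G.ReachIn T q v

/-- The oriented cut ideal `C_G^q`: generated by the monomials of the cuts
`𝔼(A, Aᶜ)` with `q ∉ A`. -/
def cutIdeal (k : Type) [Field k] (q : V) : Ideal (MvPolynomial E k) :=
  Ideal.span {p | ∃ A : Finset V, A.Nonempty ∧ q ∉ A ∧
    p = ∏ e ∈ univ.filter (fun e => G.head e ∈ A ∧ G.tail e ∉ A), X e}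

end DirGraph

/-- `τ` is a face of the Stanley–Reisner complex of the squarefree monomial ideal `I`. -/
def IsSRFace {E k : Type} [Field k] (I : Ideal (MvPolynomial E k)) (τ : Finset E) :
    Prop := (∏ e ∈ τ, X e) ∉ I

/-- `τ` is a facet (maximal face) of the Stanley–Reisner complex of `I`. -/
def IsSRFacet {E k : Type} [Field k] (I : Ideal (MvPolynomial E k)) (τ : Finset E) :
    Prop := IsSRFace I τ ∧ ∀ τ' : Finset E, τ ⊂ τ' → ¬ IsSRFace I τ'

theorem DirGraph.reach_mono {V E : Type} (G : DirGraph V E) {S T : Finset E} (h : S ⊆ T) {u v : V}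
    (hr : G.ReachIn S u v) : G.ReachIn T u v := by
  refine Relation.ReflTransGen.mono (p := fun a b => ∃ e ∈ T, G.tail e = a ∧ G.head e = b) ?_ _ _ hr
  rintro a b ⟨e, he, h1, h2⟩
  exact ⟨e, h he, h1, h2⟩

theorem DirGraph.exists_cross {V E : Type} (G : DirGraph V E) {R : Finset E} {q v : V}
    (P : V → Prop) (hq : P q) (hv : ¬ P v) (hr : G.ReachIn R q v) :
    ∃ e ∈ R, P (G.tail e) ∧ ¬ P (G.head e) := by
  by_contra hcon
  push Not at hcon
  apply hv
  unfold DirGraph.ReachIn at hr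
  clear hv
  induction hr with
  | refl => exact hq
  | tail _ h ih =>
    obtain ⟨e, he, rfl, rfl⟩ := h
    exact hcon e he ih

theorem DirGraph.card_lower {V E : Type} [Fintype V] (G : DirGraph V E) {T : Finset E} {q : V}
    (h : ∀ v, G.ReachIn T q v) : Fintype.card V - 1 ≤ T.card := by
  have hsub : (univ : Finset V).erase q ⊆ T.image G.head := by
    intro v hv
    have hne : v ≠ q := (Finset.mem_erase.mp hv).1
    obtain ⟨e, he, h1, h2⟩ := G.exists_cross (fun x => x ≠ v) hne.symm (by simp) (h v)
    exact Finset.mem_image.mpr ⟨e, he, not_not.mp h2⟩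
  have h1 := (Finset.card_le_card hsub).trans Finset.card_image_le
  rwa [Finset.card_erase_of_mem (Finset.mem_univ q), Finset.card_univ] at h1

theorem DirGraph.exists_tree {V E : Type} [Fintype V] [Fintype E] (G : DirGraph V E)
    {R : Finset E} {q : V}
    (h : ∀ v, G.ReachIn R q v) : ∃ T ⊆ R, G.IsOrientedSpanningTree q T := by
  let S : Finset (Finset E) := R.powerset.filter
    (fun T => T.card + 1 ≤ (univ.filter (fun v => G.ReachIn T q v)).card)
  have hS : S.Nonempty := by
    refine ⟨∅, Finset.mem_filter.mpr ⟨by simp, ?_⟩⟩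
    rw [Finset.card_empty, zero_add, Nat.succ_le_iff, Finset.card_pos]
    exact ⟨q, Finset.mem_filter.mpr ⟨Finset.mem_univ _, Relation.ReflTransGen.refl⟩⟩
  obtain ⟨T, hT, hmax⟩ := Finset.exists_max_image S Finset.card hS
  obtain ⟨hTR, hc⟩ := Finset.mem_filter.mp hT
  rw [Finset.mem_powerset] at hTR
  have hall : ∀ v, G.ReachIn T q v := by
    by_contra hcon
    push Not at hcon
    obtain ⟨v, hv⟩ := hcon
    obtain ⟨e, he, h1, h2⟩ := G.exists_cross (fun x => G.ReachIn T q x)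
      Relation.ReflTransGen.refl hv (h v)
    have heT : e ∉ T := fun h3 => h2 (Relation.ReflTransGen.tail h1 ⟨e, h3, rfl, rfl⟩)
    have hin : insert e T ∈ S := by
      refine Finset.mem_filter.mpr ⟨?_, ?_⟩
      · rw [Finset.mem_powerset]
        exact Finset.insert_subset he hTR
      · rw [Finset.card_insert_of_notMem heT]
        have hlt : (univ.filter (fun v => G.ReachIn T q v)).card <
            (univ.filter (fun v => G.ReachIn (insert e T) q v)).card := by
          apply Finset.card_lt_card
          rw [Finset.ssubset_iff_of_subset]
          · refine ⟨G.head e, Finset.mem_filter.mpr ⟨Finset.mem_univ _, ?_⟩, ?_⟩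
            · exact Relation.ReflTransGen.tail (G.reach_mono (Finset.subset_insert e T) h1)
                ⟨e, Finset.mem_insert_self e T, rfl, rfl⟩
            · intro h3
              exact h2 (Finset.mem_filter.mp h3).2
          · intro w hw
            exact Finset.mem_filter.mpr ⟨Finset.mem_univ _,
              G.reach_mono (Finset.subset_insert e T) (Finset.mem_filter.mp hw).2⟩
        omega
    have := hmax _ hin
    rw [Finset.card_insert_of_notMem heT] at this
    omega
  refine ⟨T, hTR, ?_, hall⟩
  have h1 := G.card_lower hall
  have h2 := Finset.card_le_univ (univ.filter (fun v => G.ReachIn T q v))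
  omega

theorem DirGraph.face_iff {V E : Type} [Fintype V] [Fintype E] (k : Type) [Field k]
    (G : DirGraph V E) (q : V) (τ : Finset E) :
    IsSRFace (G.cutIdeal k q) τ ↔ ∀ v, G.ReachIn (univ \ τ) q v := by
  constructor
  · intro hf
    by_contra hcon
    push Not at hcon
    obtain ⟨v, hv⟩ := hcon
    apply hf
    let A : Finset V := univ.filter (fun v => ¬ G.ReachIn (univ \ τ) q v)
    have hmemA : ∀ x, x ∈ A ↔ ¬ G.ReachIn (univ \ τ) q x := fun x => by simp [A]
    have hsub : univ.filter (fun e => G.head e ∈ A ∧ G.tail e ∉ A) ⊆ τ := by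
      intro e he
      obtain ⟨_, h1, h2⟩ := Finset.mem_filter.mp he
      rw [hmemA] at h1 h2
      by_contra hτ
      exact h1 (Relation.ReflTransGen.tail (not_not.mp h2) ⟨e, by simp [hτ], rfl, rfl⟩)
    refine Ideal.mem_of_dvd _ (Finset.prod_dvd_prod_of_subset _ _ _ hsub) (Ideal.subset_span ?_)
    refine ⟨A, ⟨v, (hmemA v).2 hv⟩, ?_, rfl⟩
    rw [hmemA]
    exact not_not.mpr Relation.ReflTransGen.refl
  · intro hr hmem
    let φ : MvPolynomial E k →+* k := MvPolynomial.eval (fun e => if e ∈ τ then 1 else 0)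
    have hle : G.cutIdeal k q ≤ RingHom.ker φ := by
      refine Ideal.span_le.mpr ?_
      rintro p ⟨A, ⟨v, hv⟩, hqA, rfl⟩
      obtain ⟨e, he, h1, h2⟩ := G.exists_cross (fun x => x ∉ A) hqA (not_not.mpr hv) (hr v)
      have heτ : e ∉ τ := (Finset.mem_sdiff.mp he).2
      change φ _ = 0
      rw [map_prod]
      refine Finset.prod_eq_zero (i := e) ?_ ?_
      · exact Finset.mem_filter.mpr ⟨Finset.mem_univ _, not_not.mp h2, h1⟩
      · simp [φ, heτ]
    have h0 : φ (∏ e ∈ τ, X e) = 0 := hle hmem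
    rw [map_prod, Finset.prod_eq_one] at h0
    · exact one_ne_zero h0
    · intro e he
      simp [φ, he]

theorem facets_of_cutIdeal_complex
    {V E : Type} [Fintype V] [Fintype E] (k : Type) [Field k]
    (G : DirGraph V E) (q : V)
    (hq : ∀ e, G.head e ≠ q)
    (hreach : ∀ v : V, G.ReachIn (univ : Finset E) q v) :
    ∀ τ : Finset E, IsSRFacet (G.cutIdeal k q) τ ↔
      ∃ T : Finset E, G.IsOrientedSpanningTree q T ∧ τ = univ \ T := by
  intro τ
  constructor
  · rintro ⟨hf, hmax⟩
    rw [G.face_iff k] at hf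
    obtain ⟨T, hTR, hT⟩ := G.exists_tree hf
    refine ⟨T, hT, ?_⟩
    by_contra hne
    have hsub : τ ⊆ univ \ T := by
      intro e he
      refine Finset.mem_sdiff.mpr ⟨Finset.mem_univ _, fun h => ?_⟩
      exact (Finset.mem_sdiff.mp (hTR h)).2 he
    refine hmax _ (lt_of_le_of_ne hsub hne) ?_
    rw [G.face_iff k]
    intro v
    refine G.reach_mono ?_ (hT.2 v)
    intro e he
    simp [he]
  · rintro ⟨T, hT, rfl⟩
    have hTT : univ \ (univ \ T) = T := by ext; simp
    refine ⟨?_, ?_⟩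
    · rw [G.face_iff k, hTT]
      exact hT.2
    · intro τ' hss hf
      rw [G.face_iff k] at hf
      have h1 := G.card_lower hf
      have h2 := Finset.card_lt_card hss
      rw [Finset.card_sdiff_of_subset (Finset.subset_univ _)] at h1 h2
      have h3 := hT.1
      have h4 := Finset.card_le_card (Finset.subset_univ T)
      have h5 := Finset.card_le_card (Finset.subset_univ τ')
      omega

end
end

section
/- Let G be a directed graph with a source q. For each oriented spanning tree T of G let P_T = ⟨y_e : e ∈ O_T⟩ ⊂ S. Then the minimal prime decomposition of the oriented cut ideal is C_G^q = ⋂_T P_T, the intersection being over all oriented spanning trees of G. -/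
/-!
STATEMENT 8: The minimal prime decomposition of the oriented cut ideal of a directed
graph with source `q` is `C_G^q = ⋂_T P_T`, the intersection over all oriented
spanning trees `T`, with `P_T = ⟨y_e : e ∈ O_T⟩`.
-/

open Finset MvPolynomial

noncomputable section

open scoped Classical

/-- The prime `P_T = ⟨y_e : e ∈ T⟩`. -/
def treePrime {E : Type} (k : Type) [Field k] (T : Finset E) :
    Ideal (MvPolynomial E k) :=
  Ideal.span {p | ∃ e ∈ T, p = X e}

theorem aux_tree {V E : Type} [Fintype V] [Fintype E] (G : DirGraph V E) (q : V) (S : Finset E)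
    (hS : ∀ A : Finset V, A.Nonempty → q ∉ A → ∃ e ∈ S, G.head e ∈ A ∧ G.tail e ∉ A) :
    ∃ T ⊆ S, G.IsOrientedSpanningTree q T := by
  have key : ∀ n : ℕ, n + 1 ≤ Fintype.card V → ∃ (T : Finset E) (R : Finset V), T ⊆ S ∧ q ∈ R ∧
      R.card = n + 1 ∧ T.card = n ∧ (∀ e ∈ T, G.head e ∈ R) ∧ ∀ v ∈ R, G.ReachIn T q v := by
    intro n
    induction n with
    | zero =>
      intro _
      refine ⟨∅, {q}, by simp, by simp, by simp, by simp, by simp, ?_⟩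
      intro v hv
      rw [Finset.mem_singleton] at hv
      subst hv
      exact Relation.ReflTransGen.refl
    | succ n ih =>
      intro hn
      obtain ⟨T, R, hTS, hqR, hR, hT, hh, hr⟩ := ih (by omega)
      have hne : (Rᶜ).Nonempty := by
        rw [← Finset.card_pos, Finset.card_compl]
        omega
      obtain ⟨e, heS, he1, he2⟩ := hS Rᶜ hne (by simpa using hqR)
      have he1' : G.head e ∉ R := by simpa using he1
      have he2' : G.tail e ∈ R := by simpa using he2
      have heT : e ∉ T := fun h => he1' (hh e h)
      have hmono : ∀ v, G.ReachIn T q v → G.ReachIn (insert e T) q v := by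
        intro v hv
        refine Relation.ReflTransGen.mono ?_ _ _ hv
        rintro a b ⟨f, hf, h⟩
        exact ⟨f, Finset.mem_insert_of_mem hf, h⟩
      refine ⟨insert e T, insert (G.head e) R, Finset.insert_subset heS hTS,
        Finset.mem_insert_of_mem hqR, ?_, ?_, ?_, ?_⟩
      · rw [Finset.card_insert_of_notMem he1', hR]
      · rw [Finset.card_insert_of_notMem heT, hT]
      · intro f hf
        rcases Finset.mem_insert.1 hf with rfl | hf
        · exact Finset.mem_insert_self _ _
        · exact Finset.mem_insert_of_mem (hh f hf)
      · intro v hv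
        rcases Finset.mem_insert.1 hv with rfl | hv
        · exact Relation.ReflTransGen.tail (hmono _ (hr _ he2'))
            ⟨e, Finset.mem_insert_self _ _, rfl, rfl⟩
        · exact hmono _ (hr v hv)
  have hpos : 0 < Fintype.card V := Fintype.card_pos_iff.2 ⟨q⟩
  obtain ⟨T, R, hTS, -, hR, hT, -, hr⟩ := key (Fintype.card V - 1) (by omega)
  have hRu : R = univ := by
    rw [← Finset.card_eq_iff_eq_univ]
    omega
  exact ⟨T, hTS, hT, fun v => hr v (by simp [hRu])⟩

theorem aux_hit {V E : Type} [Fintype V] [Fintype E] (G : DirGraph V E) (q : V) (T : Finset E)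
    (hT : G.IsOrientedSpanningTree q T) (A : Finset V) (hA : A.Nonempty) (hqA : q ∉ A) :
    ∃ e ∈ T, G.head e ∈ A ∧ G.tail e ∉ A := by
  obtain ⟨v, hv⟩ := hA
  by_contra hcon
  push Not at hcon
  have : ∀ w, G.ReachIn T q w → w ∉ A := by
    intro w hw
    induction hw with
    | refl => exact hqA
    | tail _ hbc ih =>
      obtain ⟨e, he, rfl, rfl⟩ := hbc
      exact fun h => ih (hcon e he h)
  exact this v (hT.2 v) hv

theorem aux_treePrime_eq {E : Type} (k : Type) [Field k] (T : Finset E) :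
    treePrime k T = Ideal.span (X '' (T : Set E)) := by
  unfold treePrime
  congr 1
  ext p
  simp [eq_comm]

theorem aux_X_mem {E : Type} (k : Type) [Field k] (T : Finset E) (e : E) :
    (X e : MvPolynomial E k) ∈ treePrime k T ↔ e ∈ T := by
  rw [aux_treePrime_eq, mem_ideal_span_X_image]
  simp [support_X, Finsupp.single_apply]

theorem aux_prime {E : Type} (k : Type) [Field k] (T : Finset E) :
    (treePrime k T).IsPrime := by
  let φ : MvPolynomial E k →ₐ[k] MvPolynomial E k := aeval (fun e => if e ∈ T then 0 else X e)
  have h : treePrime k T = RingHom.ker φ := by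
    apply le_antisymm
    · refine Ideal.span_le.2 ?_
      rintro p ⟨e, he, rfl⟩
      simp [φ, RingHom.mem_ker, he]
    · intro p hp
      have hcomp : (Ideal.Quotient.mkₐ k (treePrime k T)).comp φ =
          Ideal.Quotient.mkₐ k (treePrime k T) := by
        apply MvPolynomial.algHom_ext
        intro e
        by_cases he : e ∈ T
        · have := (aux_X_mem k T e).2 he
          simp only [AlgHom.comp_apply, φ, aeval_X, if_pos he, map_zero]
          exact (Ideal.Quotient.eq_zero_iff_mem.2 this).symm
        · simp [φ, he]
      have h2 := congrArg (fun f => f p) hcomp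
      have hp' : φ p = 0 := hp
      simp only [AlgHom.comp_apply, hp', map_zero] at h2
      exact Ideal.Quotient.eq_zero_iff_mem.1 h2.symm
  rw [h]
  exact RingHom.ker_isPrime _

theorem aux_le {V E : Type} [Fintype V] [Fintype E] (k : Type) [Field k]
    (G : DirGraph V E) (q : V) (T : Finset E)
    (hT : G.IsOrientedSpanningTree q T) : G.cutIdeal k q ≤ treePrime k T := by
  refine Ideal.span_le.2 ?_
  rintro p ⟨A, hA, hqA, rfl⟩
  obtain ⟨e, he, h⟩ := aux_hit G q T hT A hA hqA
  exact Ideal.mem_of_dvd _ (Finset.dvd_prod_of_mem _ (by simpa using h)) ((aux_X_mem k T e).2 he)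

theorem aux_exists {V E : Type} [Fintype V] [Fintype E] (k : Type) [Field k]
    (G : DirGraph V E) (q : V) (P : Ideal (MvPolynomial E k)) (hP : P.IsPrime)
    (h : G.cutIdeal k q ≤ P) : ∃ T, G.IsOrientedSpanningTree q T ∧ treePrime k T ≤ P := by
  obtain ⟨T, hTS, hT⟩ := aux_tree G q (univ.filter fun e => (X e : MvPolynomial E k) ∈ P) (by
    intro A hA hqA
    have := h (Ideal.subset_span ⟨A, hA, hqA, rfl⟩)
    rw [Ideal.IsPrime.prod_mem_iff] at this
    obtain ⟨e, he, heP⟩ := this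
    exact ⟨e, by simpa using heP, by simpa using he⟩)
  refine ⟨T, hT, Ideal.span_le.2 ?_⟩
  rintro p ⟨e, he, rfl⟩
  simpa using hTS he

theorem aux_ge {V E : Type} [Fintype V] [Fintype E] (k : Type) [Field k]
    (G : DirGraph V E) (q : V) (p : MvPolynomial E k)
    (hp : ∀ T, G.IsOrientedSpanningTree q T → p ∈ treePrime k T) : p ∈ G.cutIdeal k q := by
  rw [p.as_sum]
  refine Ideal.sum_mem _ fun m hm => ?_
  have hcut : ∃ A : Finset V, A.Nonempty ∧ q ∉ A ∧
      ∀ e, G.head e ∈ A → G.tail e ∉ A → m e ≠ 0 := by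
    by_contra hcon
    push Not at hcon
    obtain ⟨T, hTS, hT⟩ := aux_tree G q (univ.filter fun e => m e = 0) (by
      intro A hA hqA
      obtain ⟨e, h1, h2, h3⟩ := hcon A hA hqA
      exact ⟨e, by simpa using h3, h1, h2⟩)
    have := hp T hT
    rw [aux_treePrime_eq, mem_ideal_span_X_image] at this
    obtain ⟨e, he, hne⟩ := this m hm
    exact hne (by simpa using hTS he)
  obtain ⟨A, hA, hqA, hm⟩ := hcut
  refine Ideal.mem_of_dvd _ ?_ (Ideal.subset_span ⟨A, hA, hqA, rfl⟩)
  rw [monomial_eq]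
  refine Dvd.dvd.mul_left ?_ _
  rw [Finsupp.prod]
  refine (Finset.prod_dvd_prod_of_dvd _ (fun e => X e ^ m e) ?_).trans
    (Finset.prod_dvd_prod_of_subset _ _ _ ?_)
  · intro e he
    simp only [Finset.mem_filter] at he
    exact dvd_pow_self _ (hm e he.2.1 he.2.2)
  · intro e he
    simp only [Finset.mem_filter] at he
    simpa using hm e he.2.1 he.2.2

theorem cutIdeal_minimal_prime_decomposition
    {V E : Type} [Fintype V] [Fintype E] (k : Type) [Field k]
    (G : DirGraph V E) (q : V)
    (hq : ∀ e, G.head e ≠ q)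
    (hreach : ∀ v : V, G.ReachIn (univ : Finset E) q v) :
    G.cutIdeal k q =
      sInf {J | ∃ T : Finset E, G.IsOrientedSpanningTree q T ∧ J = treePrime k T} ∧
    (G.cutIdeal k q).minimalPrimes =
      {J | ∃ T : Finset E, G.IsOrientedSpanningTree q T ∧ J = treePrime k T} := by
  refine ⟨le_antisymm (le_sInf ?_) ?_, ?_⟩
  · rintro J ⟨T, hT, rfl⟩
    exact aux_le k G q T hT
  · intro p hp
    exact aux_ge k G q p fun T hT => (Submodule.mem_sInf.1 hp) _ ⟨T, hT, rfl⟩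
  · ext J
    constructor
    · intro hJ
      obtain ⟨T, hT, hle⟩ := aux_exists k G q J hJ.1.1 hJ.1.2
      exact ⟨T, hT, le_antisymm (hJ.2 ⟨aux_prime k T, aux_le k G q T hT⟩ hle) hle⟩
    · rintro ⟨T, hT, rfl⟩
      refine ⟨⟨aux_prime k T, aux_le k G q T hT⟩, ?_⟩
      rintro Q ⟨hQ, hcQ⟩ hQT
      obtain ⟨T', hT', hle⟩ := aux_exists k G q Q hQ hcQ
      have hsub : T' ⊆ T := fun e he =>
        (aux_X_mem k T e).1 (hQT (hle ((aux_X_mem k T' e).2 he)))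
      have : T' = T := Finset.eq_of_subset_of_card_le hsub (by rw [hT.1, hT'.1])
      exact this ▸ hle

end
end

section
/- Let G be a directed graph on n vertices with a source q and let Σ_G^q be the Stanley–Reisner complex of the oriented cut ideal C_G^q. Then every facet τ of Σ_G^q satisfies |τ| = |𝔼(G)| − n + 1, and therefore the Krull dimension of the Stanley–Reisner ring k[Σ_G^q] = S/C_G^q equals |𝔼(G)| − n + 1. -/
/-!
STATEMENT 9: Every facet `τ` of the Stanley–Reisner complex `Σ_G^q` of the oriented
cut ideal satisfies `|τ| = |𝔼(G)| - n + 1`; hence the Krull dimension of the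
Stanley–Reisner ring `k[Σ_G^q] = S/C_G^q` equals `|𝔼(G)| - n + 1`.
-/

open Finset MvPolynomial

noncomputable section

open scoped Classical

namespace CutAux

/-- `T` meets every oriented cut. -/
def Hit {V E : Type} (G : DirGraph V E) (q : V) (T : Finset E) : Prop :=
  ∀ A : Finset V, A.Nonempty → q ∉ A → ∃ e ∈ T, G.head e ∈ A ∧ G.tail e ∉ A

variable {V E : Type} (G : DirGraph V E) (q : V)

theorem hit_univ [Fintype E] (hreach : ∀ v : V, G.ReachIn (univ : Finset E) q v) :
    Hit G q univ := by
  intro A hA hqA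
  obtain ⟨v, hv⟩ := hA
  have key : ∀ w, G.ReachIn (univ : Finset E) q w → w ∈ A →
      ∃ e ∈ (univ : Finset E), G.head e ∈ A ∧ G.tail e ∉ A := by
    intro w hw
    induction hw with
    | refl => intro h; exact absurd h hqA
    | tail _ hbc ih =>
      rename_i b c _
      intro hc
      obtain ⟨e, he, h1, h2⟩ := hbc
      by_cases hb : b ∈ A
      · exact ih hb
      · exact ⟨e, he, by rw [h2]; exact hc, by rw [h1]; exact hb⟩
  exact key v (hreach v) hv

theorem card_le_of_hit [Fintype V] (T : Finset E) (hT : Hit G q T) :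
    Fintype.card V ≤ T.card + 1 := by
  have h : (univ : Finset V).erase q ⊆ T.image G.head := by
    intro v hv
    have hvq : v ≠ q := (Finset.mem_erase.1 hv).1
    obtain ⟨e, he, h1, -⟩ := hT {v} ⟨v, by simp⟩ (by simpa using hvq.symm)
    exact Finset.mem_image.2 ⟨e, he, by simpa using h1⟩
  have h2 := (Finset.card_le_card h).trans Finset.card_image_le
  rw [Finset.card_erase_of_mem (Finset.mem_univ q), Finset.card_univ] at h2
  omega

theorem grow [Fintype V] (T : Finset E) (hT : Hit G q T) (j : ℕ) (hj : j + 1 ≤ Fintype.card V) :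
    ∃ (R : Finset V) (T' : Finset E), T' ⊆ T ∧ q ∈ R ∧ R.card = j + 1 ∧ T'.card ≤ j ∧
      ∀ A : Finset V, q ∉ A → (∃ v ∈ A, v ∈ R) → ∃ e ∈ T', G.head e ∈ A ∧ G.tail e ∉ A := by
  induction j with
  | zero =>
    refine ⟨{q}, ∅, by simp, by simp, by simp, by simp, ?_⟩
    rintro A hA ⟨v, hv, hv'⟩
    rw [Finset.mem_singleton] at hv'
    exact absurd (hv' ▸ hv) hA
  | succ j ih =>
    obtain ⟨R, T', hTT, hqR, hR, hc, hA⟩ := ih (by omega)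
    obtain ⟨e, heT, h1, h2⟩ := hT Rᶜ (by
      rw [← Finset.card_pos, Finset.card_compl]; omega) (by simpa using hqR)
    rw [Finset.mem_compl] at h1
    rw [Finset.mem_compl, not_not] at h2
    refine ⟨insert (G.head e) R, insert e T', Finset.insert_subset heT hTT,
      Finset.mem_insert_of_mem hqR, by rw [Finset.card_insert_of_notMem h1, hR],
      (Finset.card_insert_le _ _).trans (by omega), ?_⟩
    rintro A hqA ⟨v, hv, hv'⟩
    by_cases hm : ∃ v ∈ A, v ∈ R
    · obtain ⟨f, hf, hf'⟩ := hA A hqA hm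
      exact ⟨f, Finset.mem_insert_of_mem hf, hf'⟩
    · rcases Finset.mem_insert.1 hv' with rfl | hvR
      · exact ⟨e, Finset.mem_insert_self _ _, hv, fun h => hm ⟨_, h, h2⟩⟩
      · exact absurd ⟨v, hv, hvR⟩ hm

theorem exists_small_hit [Fintype V] (T : Finset E) (hT : Hit G q T) :
    ∃ T' ⊆ T, Hit G q T' ∧ T'.card + 1 = Fintype.card V := by
  have hpos : 0 < Fintype.card V := Fintype.card_pos_iff.2 ⟨q⟩
  obtain ⟨R, T', hTT, hqR, hR, hc, hA⟩ := grow G q T hT (Fintype.card V - 1) (by omega)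
  have hRu : R = univ := by
    rw [← Finset.card_eq_iff_eq_univ]; omega
  have hH : Hit G q T' := by
    rintro A ⟨v, hv⟩ hq
    exact hA A hq ⟨v, hv, by rw [hRu]; simp⟩
  refine ⟨T', hTT, hH, ?_⟩
  have := card_le_of_hit G q T' hH
  omega

variable [Fintype V] [Fintype E] (k : Type) [Field k]

theorem face_iff (τ : Finset E) : IsSRFace (G.cutIdeal k q) τ ↔ Hit G q τᶜ := by
  constructor
  · intro h A hA hqA
    by_contra hcon
    push Not at hcon
    apply h
    have hmem : (∏ e ∈ univ.filter (fun e => G.head e ∈ A ∧ G.tail e ∉ A), (X e : MvPolynomial E k))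
        ∈ G.cutIdeal k q := Ideal.subset_span ⟨A, hA, hqA, rfl⟩
    refine Ideal.mem_of_dvd _ (Finset.prod_dvd_prod_of_subset _ _ _ ?_) hmem
    intro e he
    obtain ⟨h1, h2⟩ := (Finset.mem_filter.1 he).2
    by_contra hτ
    exact h2 (hcon e (Finset.mem_compl.2 hτ) h1)
  · intro h hmem
    let f : MvPolynomial E k →ₐ[k] k := aeval (fun e => if e ∈ τ then 1 else 0)
    have hle : G.cutIdeal k q ≤ RingHom.ker f := by
      refine Ideal.span_le.2 ?_
      rintro p ⟨A, hA, hqA, rfl⟩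
      obtain ⟨e, he, h1, h2⟩ := h A hA hqA
      change f _ = 0
      rw [map_prod]
      refine Finset.prod_eq_zero (i := e) (by simp [h1, h2]) ?_
      simp [f, Finset.mem_compl.1 he]
    have h0 : f (∏ e ∈ τ, X e) = 0 := hle hmem
    rw [map_prod, Finset.prod_eq_one] at h0
    · exact one_ne_zero h0
    · intro e he
      simp [f, he]

theorem dim_mv (T : Finset E) :
    ringKrullDim (MvPolynomial {e // e ∉ T} k) =
      ((Fintype.card E - T.card : ℕ) : WithBot (WithTop ℕ)) := by
  rw [MvPolynomial.ringKrullDim_of_isNoetherianRing, ringKrullDim_eq_zero_of_field, zero_add]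
  have : Nat.card {e // e ∉ T} = Fintype.card E - T.card := by
    rw [Nat.card_eq_fintype_card, Fintype.card_subtype_compl, Fintype.card_coe]
  rw [this]
  rfl

theorem dim_ge (T : Finset E) (hT : Hit G q T) :
    ((Fintype.card E - T.card : ℕ) : WithBot (WithTop ℕ)) ≤
      ringKrullDim (MvPolynomial E k ⧸ G.cutIdeal k q) := by
  rw [← dim_mv k T]
  let f : MvPolynomial E k →ₐ[k] MvPolynomial {e // e ∉ T} k :=
    aeval (fun e => if h : e ∉ T then X ⟨e, h⟩ else 0)
  have hle : ∀ a ∈ G.cutIdeal k q, f a = 0 := by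
    have : G.cutIdeal k q ≤ RingHom.ker f := by
      refine Ideal.span_le.2 ?_
      rintro p ⟨A, hA, hqA, rfl⟩
      obtain ⟨e, he, h1, h2⟩ := hT A hA hqA
      change f _ = 0
      rw [map_prod]
      refine Finset.prod_eq_zero (i := e) (by simp [h1, h2]) ?_
      simp [f, he]
    exact fun a ha => this ha
  refine ringKrullDim_le_of_surjective
    (Ideal.Quotient.lift (G.cutIdeal k q) (f : MvPolynomial E k →+* _) hle) ?_
  refine Ideal.Quotient.lift_surjective_of_surjective _ _ ?_
  intro p
  refine ⟨rename Subtype.val p, ?_⟩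
  change f _ = p
  rw [show f = aeval (fun e => if h : e ∉ T then X ⟨e, h⟩ else 0) from rfl, aeval_rename]
  conv_rhs => rw [← aeval_X_left_apply p]
  congr 2
  funext e
  simp [e.2]

theorem dim_prime (P : Ideal (MvPolynomial E k)) (T : Finset E) (hT : ∀ e ∈ T, X e ∈ P) :
    ringKrullDim (MvPolynomial E k ⧸ P) ≤
      ((Fintype.card E - T.card : ℕ) : WithBot (WithTop ℕ)) := by
  rw [← dim_mv k T]
  let g : MvPolynomial {e // e ∉ T} k →ₐ[k] (MvPolynomial E k ⧸ P) :=
    aeval (fun e => Ideal.Quotient.mk P (X e.1))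
  refine ringKrullDim_le_of_surjective (g : _ →+* _) ?_
  intro y
  obtain ⟨p, rfl⟩ := Ideal.Quotient.mk_surjective y
  change ∃ a, g a = _
  induction p using MvPolynomial.induction_on with
  | C a => exact ⟨C a, by simp [g]; rfl⟩
  | add p r hp hr =>
    obtain ⟨a, ha⟩ := hp
    obtain ⟨b, hb⟩ := hr
    exact ⟨a + b, by rw [map_add, map_add, ha, hb]⟩
  | mul_X p e hp =>
    obtain ⟨a, ha⟩ := hp
    by_cases he : e ∈ T
    · refine ⟨0, ?_⟩
      rw [map_mul, Ideal.Quotient.eq_zero_iff_mem.2 (hT e he), mul_zero, map_zero]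
    · exact ⟨a * X ⟨e, he⟩, by rw [map_mul, map_mul, ha]; simp [g]⟩

theorem dim_le :
    ringKrullDim (MvPolynomial E k ⧸ G.cutIdeal k q) ≤
      ((Fintype.card E + 1 - Fintype.card V : ℕ) : WithBot (WithTop ℕ)) := by
  rw [ringKrullDim_quotient]
  refine iSup_le fun p => ?_
  let P := p.head.1.asIdeal
  have hP : P.IsPrime := p.head.1.isPrime
  have hCP : G.cutIdeal k q ≤ P := p.head.2
  let T : Finset E := univ.filter (fun e => (X e : MvPolynomial E k) ∈ P)
  have hT : Hit G q T := by
    intro A hA hqA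
    have hmem : (∏ e ∈ univ.filter (fun e => G.head e ∈ A ∧ G.tail e ∉ A), (X e : MvPolynomial E k))
        ∈ P := hCP (Ideal.subset_span ⟨A, hA, hqA, rfl⟩)
    obtain ⟨e, he, heP⟩ := (hP.prod_mem_iff).1 hmem
    exact ⟨e, by simpa [T] using heP, (Finset.mem_filter.1 he).2⟩
  have h1 := card_le_of_hit G q T hT
  have h2 := dim_prime k P T (fun e he => by simpa [T] using he)
  rw [ringKrullDim_quotient] at h2
  let p' : LTSeries (PrimeSpectrum.zeroLocus (P : Set (MvPolynomial E k))) :=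
    { length := p.length
      toFun := fun i => ⟨(p i).1, (show p.head ≤ p i from LTSeries.head_le p i)⟩
      step := fun i => p.step i }
  have h3 : ((p'.length : ℕ) : WithBot (WithTop ℕ)) ≤ _ := (le_iSup _ p').trans h2
  refine le_trans h3 ?_
  have h4 : Fintype.card E - T.card ≤ Fintype.card E + 1 - Fintype.card V := by omega
  exact Nat.mono_cast (α := WithBot ℕ∞) h4

end CutAux

theorem facet_card_and_krullDim_of_cutIdeal
    {V E : Type} [Fintype V] [Fintype E] (k : Type) [Field k]
    (G : DirGraph V E) (q : V)
    (hq : ∀ e, G.head e ≠ q)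
    (hreach : ∀ v : V, G.ReachIn (univ : Finset E) q v) :
    (∀ τ : Finset E, IsSRFacet (G.cutIdeal k q) τ →
      τ.card = Fintype.card E + 1 - Fintype.card V) ∧
    ringKrullDim (MvPolynomial E k ⧸ G.cutIdeal k q) =
      ((Fintype.card E + 1 - Fintype.card V : ℕ) : WithBot (WithTop ℕ)) := by
  obtain ⟨T, -, hT, hTc⟩ := CutAux.exists_small_hit G q univ (CutAux.hit_univ G q hreach)
  have hTE : T.card ≤ Fintype.card E := Finset.card_le_univ T
  refine ⟨?_, le_antisymm (CutAux.dim_le G q k) ?_⟩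
  · rintro τ ⟨hf, hmax⟩
    rw [CutAux.face_iff] at hf
    obtain ⟨T', hTT, hH, hc⟩ := CutAux.exists_small_hit G q τᶜ hf
    have hsub : τ ⊆ T'ᶜ := by
      intro e he
      rw [Finset.mem_compl]
      intro h
      exact Finset.mem_compl.1 (hTT h) he
    have heq : τ = T'ᶜ := by
      by_contra hne
      refine hmax T'ᶜ (Finset.ssubset_iff_subset_ne.2 ⟨hsub, hne⟩) ?_
      rw [CutAux.face_iff, compl_compl]
      exact hH
    rw [heq, Finset.card_compl]
    omega
  · have h := CutAux.dim_ge G q k T hT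
    have h4 : Fintype.card E - T.card = Fintype.card E + 1 - Fintype.card V := by omega
    rwa [h4] at h

end
end
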